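/- Let (u_p)_{p>1} be a family of nodal solutions of (𝒫_p) satisfying conditions (A) and (B), let Ω̃_p⁻ := {x ∈ Ω : u_p(x) < 0} be the negative nodal domain, and define z_p⁻(x) := (p/u_p(x_p⁺))·(−u_p(ε_p x + x_p⁻) − u_p(x_p⁺)) on Ω̃⁻(ε_p) := (Ω̃_p⁻ − x_p⁻)/ε_p. Then the sets Ω̃⁻(ε_p) exhaust ℝ² (every compact set is contained in Ω̃⁻(ε_p) for p large), and for every sequence p_n → +∞ there exist a subsequence and μ ∈ (0,1] such that along it z_{p_n}⁻ converges in C²_loc(ℝ²) to U_μ(x) := log(μ/(1 + μ|x|²/8)²); if the constant K in condition (B) equals 0, then μ = 1. -/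

import Mathlib

open MeasureTheory Real Set Filter Topology Metric

noncomputable section

/-- The Euclidean plane. -/
abbrev R2 : Type := EuclideanSpace ℝ (Fin 2)

/-- The Laplacian: sum of the two pure second directional derivatives. -/
def lap (u : R2 → ℝ) (x : R2) : ℝ :=
  ∑ i : Fin 2,
    fderiv ℝ (fun y => fderiv ℝ u y (EuclideanSpace.single i 1)) x (EuclideanSpace.single i 1)

/-- Each point of ∂Ω has a neighborhood in which ∂Ω is the graph of a C^∞ function
(in suitable Euclidean coordinates). -/
def SmoothBoundary (Ω : Set R2) : Prop :=
  ∀ x ∈ frontier Ω, ∃ V : Set R2, IsOpen V ∧ x ∈ V ∧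
    ∃ (e : R2 ≃ᵢ R2) (g : ℝ → ℝ), ContDiff ℝ (⊤ : ℕ∞) g ∧
      frontier Ω ∩ V = {y | y ∈ V ∧ e y 1 = g (e y 0)}

/-- A (classical) solution of the Lane–Emden problem `(𝒫_p)` on Ω. -/
def IsSolution (Ω : Set R2) (p : ℝ) (u : R2 → ℝ) : Prop :=
  ContDiffOn ℝ 2 u Ω ∧ ContDiffOn ℝ 1 u (closure Ω) ∧
  (∀ x ∈ Ω, -lap u x = |u x| ^ (p - 1) * u x) ∧
  (∀ x ∈ frontier Ω, u x = 0)

/-- A nodal (sign-changing) function on Ω. -/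
def IsNodal (Ω : Set R2) (u : R2 → ℝ) : Prop :=
  (∃ x ∈ Ω, 0 < u x) ∧ ∃ x ∈ Ω, u x < 0

/-- The energy functional E_p. -/
def energy (Ω : Set R2) (p : ℝ) (u : R2 → ℝ) : ℝ :=
  (1 / 2) * ∫ x in Ω, ‖gradient u x‖ ^ 2 - (1 / (p + 1)) * ∫ x in Ω, |u x| ^ (p + 1)

/-- Condition (A): p·∫_Ω |∇u_p|² → 16πe. -/
def CondA (Ω : Set R2) (u : ℝ → R2 → ℝ) : Prop :=
  Tendsto (fun p : ℝ => p * ∫ x in Ω, ‖gradient (u p) x‖ ^ 2) atTop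
    (𝓝 (16 * π * Real.exp 1))

/-- Condition (B): p·(u_p(x_p⁺) + u_p(x_p⁻)) → K for some K ≥ 0. -/
def CondB (u : ℝ → R2 → ℝ) (xp xm : ℝ → R2) : Prop :=
  ∃ K : ℝ, 0 ≤ K ∧ Tendsto (fun p : ℝ => p * (u p (xp p) + u p (xm p))) atTop (𝓝 K)

/-- ε_p := (p·u_p(x_p⁺)^{p−1})^{−1/2}. -/
def eps (u : ℝ → R2 → ℝ) (xp : ℝ → R2) (p : ℝ) : ℝ :=
  1 / Real.sqrt (p * u p (xp p) ^ (p - 1))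

/-- The rescaling z_p of u_p around x_p⁺. -/
def zp (u : ℝ → R2 → ℝ) (xp : ℝ → R2) (p : ℝ) (x : R2) : ℝ :=
  (p / u p (xp p)) * (u p (eps u xp p • x + xp p) - u p (xp p))

/-- The rescaling z_p⁻ of u_p around x_p⁻ (with the scale ε_p of the maximum). -/
def zm (u : ℝ → R2 → ℝ) (xp xm : ℝ → R2) (p : ℝ) (x : R2) : ℝ :=
  (p / u p (xp p)) * (-u p (eps u xp p • x + xm p) - u p (xp p))

/-- Convergence in C²_loc(ℝ²) of a family of functions f_i defined on sets D_i:
every compact set K is eventually contained in D_i, and on K all derivatives up to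
order 2 converge uniformly. -/
def TendstoC2loc {ι : Type} (l : Filter ι) (D : ι → Set R2) (f : ι → R2 → ℝ)
    (g : R2 → ℝ) : Prop :=
  ∀ K : Set R2, IsCompact K →
    (∀ᶠ i in l, K ⊆ D i) ∧
    ∀ n : ℕ, n ≤ 2 →
      TendstoUniformlyOn (fun i x => iteratedFDeriv ℝ n (f i) x)
        (fun x => iteratedFDeriv ℝ n g x) l K

/-- The standard bubble U(x) = −2 log(1 + |x|²/8). -/
def stdBubble (x : R2) : ℝ := -2 * Real.log (1 + ‖x‖ ^ 2 / 8)

/-- The bubble U_μ(x) = log(μ/(1 + μ|x|²/8)²). -/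
def bubble (μ : ℝ) (x : R2) : ℝ := Real.log (μ / (1 + μ * ‖x‖ ^ 2 / 8) ^ 2)

/-- A C^∞ function compactly supported in S. -/
def CcSmoothIn (S : Set R2) (v : R2 → ℝ) : Prop :=
  ContDiff ℝ (⊤ : ℕ∞) v ∧ HasCompactSupport v ∧ tsupport v ⊆ S

/-- The quadratic form of the linearized operator at u. -/
def Qform (p : ℝ) (u v : R2 → ℝ) : ℝ :=
  ∫ x, (‖gradient v x‖ ^ 2 - p * |u x| ^ (p - 1) * v x ^ 2)

/-- Morse index one hypothesis (M): for p large, the quadratic form of the linearized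
operator is negative somewhere on C_c^∞ of the positive nodal domain, but is not
negative definite on any 2-dimensional subspace. -/
def MorseOne (Ω : Set R2) (u : ℝ → R2 → ℝ) : Prop :=
  ∀ᶠ p : ℝ in atTop,
    (∃ v : R2 → ℝ, CcSmoothIn {x ∈ Ω | 0 < u p x} v ∧ Qform p (u p) v < 0) ∧
    ¬ ∃ v w : R2 → ℝ, CcSmoothIn {x ∈ Ω | 0 < u p x} v ∧
        CcSmoothIn {x ∈ Ω | 0 < u p x} w ∧
        LinearIndependent ℝ ![v, w] ∧
        ∀ a b : ℝ, ¬(a = 0 ∧ b = 0) →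
          Qform p (u p) (fun x => a * v x + b * w x) < 0

/-- The partial derivative in the `i`-th coordinate direction. -/
def pd (i : Fin 2) (u : R2 → ℝ) (x : R2) : ℝ := fderiv ℝ u x (EuclideanSpace.single i 1)

lemma lap_eq (u : R2 → ℝ) (x : R2) : lap u x = pd 0 (pd 0 u) x + pd 1 (pd 1 u) x := by
  simp only [lap, Fin.sum_univ_two]; rfl

lemma Filter.EventuallyEq.pd_eq {i : Fin 2} {u v : R2 → ℝ} {x : R2} (h : u =ᶠ[𝓝 x] v) :
    pd i u x = pd i v x := by
  simp only [pd, h.fderiv_eq]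

lemma Filter.EventuallyEq.pd {i : Fin 2} {u v : R2 → ℝ} {x : R2} (h : u =ᶠ[𝓝 x] v) :
    _root_.pd i u =ᶠ[𝓝 x] _root_.pd i v := by
  filter_upwards [h.eventuallyEq_nhds] with y hy using hy.pd_eq

lemma Filter.EventuallyEq.lap_eq {u v : R2 → ℝ} {x : R2} (h : u =ᶠ[𝓝 x] v) :
    lap u x = lap v x := by
  simp only [_root_.lap_eq, h.pd.pd_eq]

lemma pd_add {i : Fin 2} {u v : R2 → ℝ} {x : R2} (hu : DifferentiableAt ℝ u x)
    (hv : DifferentiableAt ℝ v x) : pd i (fun y => u y + v y) x = pd i u x + pd i v x := by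
  simp [pd, fderiv_fun_add hu hv]

lemma pd_sub {i : Fin 2} {u v : R2 → ℝ} {x : R2} (hu : DifferentiableAt ℝ u x)
    (hv : DifferentiableAt ℝ v x) : pd i (fun y => u y - v y) x = pd i u x - pd i v x := by
  simp [pd, fderiv_fun_sub hu hv]

lemma pd_mul {i : Fin 2} {u v : R2 → ℝ} {x : R2} (hu : DifferentiableAt ℝ u x)
    (hv : DifferentiableAt ℝ v x) :
    pd i (fun y => u y * v y) x = pd i u x * v x + u x * pd i v x := by
  simp [pd, fderiv_fun_mul hu hv]; ring

lemma pd_neg {i : Fin 2} {u : R2 → ℝ} {x : R2} : pd i (fun y => -u y) x = -pd i u x := by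
  simp [pd]

lemma pd_const {i : Fin 2} {c : ℝ} {x : R2} : pd i (fun _ => c) x = 0 := by
  simp [pd]

lemma pd_const_mul {i : Fin 2} {c : ℝ} {u : R2 → ℝ} {x : R2} (hu : DifferentiableAt ℝ u x) :
    pd i (fun y => c * u y) x = c * pd i u x := by
  simp [pd, fderiv_const_mul hu]

lemma hasFDerivAt_coord (i : Fin 2) (x : R2) :
    HasFDerivAt (fun y : R2 => y i) (EuclideanSpace.proj i : R2 →L[ℝ] ℝ) x :=
  (EuclideanSpace.proj i : R2 →L[ℝ] ℝ).hasFDerivAt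

lemma contDiff_coord {n : WithTop ℕ∞} (i : Fin 2) : ContDiff ℝ n (fun y : R2 => y i) :=
  (EuclideanSpace.proj i : R2 →L[ℝ] ℝ).contDiff

lemma differentiable_coord (i : Fin 2) : Differentiable ℝ (fun y : R2 => y i) :=
  fun x => (hasFDerivAt_coord i x).differentiableAt

lemma pd_coord (i j : Fin 2) (x : R2) : pd i (fun y => y j) x = if j = i then 1 else 0 := by
  simp [pd, (hasFDerivAt_coord j x).fderiv]

lemma HasDerivAt.pd_comp {i : Fin 2} {f : ℝ → ℝ} {f' : ℝ} {u : R2 → ℝ} {x : R2}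
    (hf : HasDerivAt f f' (u x)) (hu : DifferentiableAt ℝ u x) :
    pd i (fun y => f (u y)) x = f' * pd i u x := by
  have := hf.comp_hasFDerivAt x hu.hasFDerivAt
  have h2 : fderiv ℝ (fun y => f (u y)) x = f' • fderiv ℝ u x := this.fderiv
  simp [pd, h2]

lemma pd_comp_affine {i : Fin 2} {u : R2 → ℝ} {t : ℝ} {c x : R2}
    (hu : DifferentiableAt ℝ u (t • x + c)) :
    pd i (fun y => u (t • y + c)) x = t * pd i u (t • x + c) := by
  have h1 : HasFDerivAt (fun y : R2 => t • y + c) (t • ContinuousLinearMap.id ℝ R2) x :=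
    ((hasFDerivAt_id x).const_smul t).add_const c
  have h2 : HasFDerivAt (fun y => u (t • y + c))
    ((fderiv ℝ u (t • x + c)).comp (t • ContinuousLinearMap.id ℝ R2)) x :=
    HasFDerivAt.comp x hu.hasFDerivAt h1
  simp [pd, h2.fderiv]

lemma ContDiffAt.pd {n m : WithTop ℕ∞} {i : Fin 2} {u : R2 → ℝ} {x : R2} (hu : ContDiffAt ℝ n u x)
    (hmn : m + 1 ≤ n) : ContDiffAt ℝ m (pd i u) x :=
  (hu.fderiv_right hmn).clm_apply contDiffAt_const

lemma ContDiff.pd {n m : WithTop ℕ∞} {i : Fin 2} {u : R2 → ℝ} (hu : ContDiff ℝ n u)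
    (hmn : m + 1 ≤ n) : ContDiff ℝ m (pd i u) :=
  (hu.fderiv_right hmn).clm_apply contDiff_const

lemma ContDiffAt.pd_one {i : Fin 2} {u : R2 → ℝ} {x : R2} (hu : ContDiffAt ℝ 2 u x) :
    ContDiffAt ℝ 1 (_root_.pd i u) x := hu.pd (by norm_num)

lemma ContDiff.pd_one {i : Fin 2} {u : R2 → ℝ} (hu : ContDiff ℝ 2 u) :
    ContDiff ℝ 1 (_root_.pd i u) := hu.pd (by norm_num)

lemma ContDiff.continuous_pd {i : Fin 2} {u : R2 → ℝ} (hu : ContDiff ℝ 1 u) :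
    Continuous (_root_.pd i u) := (hu.pd (m := 0) (by norm_num)).continuous

lemma ContDiffAt.continuousAt_pd {i : Fin 2} {u : R2 → ℝ} {x : R2} (hu : ContDiffAt ℝ 1 u x) :
    ContinuousAt (_root_.pd i u) x := (hu.pd (m := 0) (by norm_num)).continuousAt

lemma ContDiffAt.eventually_differentiableAt {u : R2 → ℝ} {x : R2} (hu : ContDiffAt ℝ 2 u x) :
    ∀ᶠ y in 𝓝 x, DifferentiableAt ℝ u y := by
  filter_upwards [hu.eventually (by simp)] with y hy using hy.differentiableAt (by norm_num)

lemma ContDiffAt.differentiableAt_pd {i : Fin 2} {u : R2 → ℝ} {x : R2} (hu : ContDiffAt ℝ 2 u x) :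
    DifferentiableAt ℝ (_root_.pd i u) x := hu.pd_one.differentiableAt (by norm_num)

lemma pd_comm {i j : Fin 2} {u : R2 → ℝ} {x : R2} (hu : ContDiffAt ℝ 2 u x) :
    pd i (pd j u) x = pd j (pd i u) x := by
  have hd : DifferentiableAt ℝ (fderiv ℝ u) x :=
    (hu.fderiv_right (m := 1) (by norm_num)).differentiableAt (by norm_num)
  have key : ∀ a b : Fin 2, pd a (pd b u) x = fderiv ℝ (fderiv ℝ u) x
      (EuclideanSpace.single a 1) (EuclideanSpace.single b 1) := by
    intro a b
    have : HasFDerivAt (pd b u) _ x := hd.hasFDerivAt.clm_apply (hasFDerivAt_const _ _)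
    simp [pd, this.fderiv]
  rw [key, key]
  exact (hu.isSymmSndFDerivAt (by simp)).eq _ _

lemma pd_pd_add {i j : Fin 2} {u v : R2 → ℝ} {x : R2} (hu : ContDiffAt ℝ 2 u x)
    (hv : ContDiffAt ℝ 2 v x) :
    pd i (pd j (fun y => u y + v y)) x = pd i (pd j u) x + pd i (pd j v) x := by
  have : pd j (fun y => u y + v y) =ᶠ[𝓝 x] fun y => pd j u y + pd j v y := by
    filter_upwards [hu.eventually_differentiableAt, hv.eventually_differentiableAt] with y h1 h2
      using pd_add h1 h2
  rw [this.pd_eq, pd_add hu.differentiableAt_pd hv.differentiableAt_pd]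

lemma pd_pd_const_mul {i j : Fin 2} {c : ℝ} {u : R2 → ℝ} {x : R2} (hu : ContDiffAt ℝ 2 u x) :
    pd i (pd j (fun y => c * u y)) x = c * pd i (pd j u) x := by
  have : pd j (fun y => c * u y) =ᶠ[𝓝 x] fun y => c * pd j u y := by
    filter_upwards [hu.eventually_differentiableAt] with y h1 using pd_const_mul h1
  rw [this.pd_eq, pd_const_mul hu.differentiableAt_pd]

lemma lap_add {u v : R2 → ℝ} {x : R2} (hu : ContDiffAt ℝ 2 u x) (hv : ContDiffAt ℝ 2 v x) :
    lap (fun y => u y + v y) x = lap u x + lap v x := by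
  simp only [lap_eq, pd_pd_add hu hv]; ring

lemma lap_const_mul {c : ℝ} {u : R2 → ℝ} {x : R2} (hu : ContDiffAt ℝ 2 u x) :
    lap (fun y => c * u y) x = c * lap u x := by
  simp only [lap_eq, pd_pd_const_mul hu]; ring

lemma lap_neg {u : R2 → ℝ} {x : R2} (hu : ContDiffAt ℝ 2 u x) :
    lap (fun y => -u y) x = -lap u x := by
  simpa using lap_const_mul (c := -1) hu

lemma lap_sub {u v : R2 → ℝ} {x : R2} (hu : ContDiffAt ℝ 2 u x) (hv : ContDiffAt ℝ 2 v x) :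
    lap (fun y => u y - v y) x = lap u x - lap v x := by
  simpa [sub_eq_add_neg, lap_neg hv] using lap_add hu hv.neg

lemma lap_const {c : ℝ} {x : R2} : lap (fun _ => c) x = 0 := by
  have : ∀ i, pd i (fun _ : R2 => c) = fun _ => 0 := fun i => funext fun y => pd_const
  simp [lap_eq, this, pd_const]

lemma lap_comp_affine {u : R2 → ℝ} {t : ℝ} {c x : R2} (hu : ContDiffAt ℝ 2 u (t • x + c)) :
    lap (fun y => u (t • y + c)) x = t ^ 2 * lap u (t • x + c) := by
  have hc : ContinuousAt (fun y : R2 => t • y + c) x := by fun_prop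
  have : ∀ i, pd i (fun y => u (t • y + c)) =ᶠ[𝓝 x] fun y => t * pd i u (t • y + c) := by
    intro i
    filter_upwards [hc.eventually hu.eventually_differentiableAt] with y h1 using pd_comp_affine h1
  have h2 : ∀ i, pd i (fun y => t * pd i u (t • y + c)) x = t * (t * pd i (pd i u) (t • x + c)) := by
    intro i
    have hd : DifferentiableAt ℝ (pd i u) (t • x + c) := hu.differentiableAt_pd
    rw [pd_const_mul, pd_comp_affine hd]
    exact DifferentiableAt.comp x (f := fun y : R2 => t • y + c) hd (by fun_prop)
  simp only [lap_eq, (this _).pd_eq, h2]; ring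

/-- The integral of a partial derivative of a compactly supported function vanishes. -/
lemma integral_pd_eq_zero {i : Fin 2} {f : R2 → ℝ} (hf : ContDiff ℝ 1 f) (hc : HasCompactSupport f) :
    ∫ x, pd i f x = 0 := by
  have hc' : HasCompactSupport (fun x => fderiv ℝ f x (EuclideanSpace.single i 1)) :=
    hc.fderiv_apply (𝕜 := ℝ) (EuclideanSpace.single i 1)
  have := integral_mul_fderiv_eq_neg_fderiv_mul_of_integrable (μ := (volume : Measure R2))
    (𝕜 := ℝ) (f := fun _ : R2 => (1 : ℝ)) (g := f) (v := EuclideanSpace.single i 1)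
    (by simp) (by
      simp only [one_mul]
      exact Continuous.integrable_of_hasCompactSupport (hf.continuous_pd (i := i)) hc')
    (by simpa using hf.continuous.integrable_of_hasCompactSupport hc)
    (by intros; fun_prop) (fun x _ => hf.differentiable (by norm_num) x)
  simpa [pd] using this

lemma HasCompactSupport.pd {i : Fin 2} {f : R2 → ℝ} (hc : HasCompactSupport f) :
    HasCompactSupport (pd i f) :=
  hc.fderiv_apply (𝕜 := ℝ) (EuclideanSpace.single i 1)

/-- Integration by parts. -/
lemma integral_pd_mul {i : Fin 2} {f g : R2 → ℝ} (hf : ContDiff ℝ 1 f) (hg : ContDiff ℝ 1 g)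
    (hc : HasCompactSupport f) : ∫ x, pd i f x * g x = -∫ x, f x * pd i g x := by
  have h := integral_pd_eq_zero (i := i) (hf.mul hg) hc.mul_right
  have h1 : ∀ x, pd i (fun y => f y * g y) x = pd i f x * g x + f x * pd i g x := fun x =>
    pd_mul (hf.differentiable (by norm_num) x) (hg.differentiable (by norm_num) x)
  simp only [h1] at h
  rw [integral_add] at h
  · linarith
  · exact (hf.continuous_pd.mul hg.continuous).integrable_of_hasCompactSupport hc.pd.mul_right
  · exact (hf.continuous.mul hg.continuous_pd).integrable_of_hasCompactSupport hc.mul_right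

lemma pd_pd_nonpos_of_isLocalMax {i : Fin 2} {w : R2 → ℝ} {x : R2} (hw : ContDiffAt ℝ 2 w x)
    (hm : IsLocalMax w x) : pd i (pd i w) x ≤ 0 := by
  by_contra! hpos
  set e : R2 := EuclideanSpace.single i 1
  have hline : ∀ (v : R2 → ℝ) (s : ℝ), DifferentiableAt ℝ v (x + s • e) →
      HasDerivAt (fun s : ℝ => v (x + s • e)) (pd i v (x + s • e)) s := by
    intro v s hv
    have h1 : HasDerivAt (fun s : ℝ => x + s • e) e s := by
      simpa using ((hasDerivAt_id s).smul_const e).const_add x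
    exact HasFDerivAt.comp_hasDerivAt s hv.hasFDerivAt h1
  have hc : ContinuousAt (fun s : ℝ => x + s • e) 0 := by fun_prop
  have hc' : Tendsto (fun s : ℝ => x + s • e) (𝓝 0) (𝓝 x) := by simpa using hc.tendsto
  have hd1 : deriv (fun s : ℝ => w (x + s • e)) =ᶠ[𝓝 0] fun s => pd i w (x + s • e) := by
    filter_upwards [hc'.eventually hw.eventually_differentiableAt] with s hs
      using (hline w s hs).deriv
  have hd2 : deriv (deriv (fun s : ℝ => w (x + s • e))) 0 = pd i (pd i w) x := by
    rw [hd1.deriv_eq]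
    have := (hline (pd i w) 0 (by simpa using hw.differentiableAt_pd)).deriv
    simpa using this
  have hd0 : deriv (fun s : ℝ => w (x + s • e)) 0 = 0 := by
    rw [hd1.self_of_nhds]; simp [pd, hm.fderiv_eq_zero]
  have hmin : IsLocalMin (fun s : ℝ => w (x + s • e)) 0 := by
    refine isLocalMin_of_deriv_deriv_pos (by rw [hd2]; exact hpos) hd0 ?_
    have : ContinuousAt w (x + (0 : ℝ) • e) := by simpa using hw.continuousAt
    exact ContinuousAt.comp (f := fun s : ℝ => x + s • e) this hc
  have hmax : IsLocalMax (fun s : ℝ => w (x + s • e)) 0 := by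
    have := hc'.eventually hm
    filter_upwards [this] with s hs; simpa using hs
  have hconst : (fun s : ℝ => w (x + s • e)) =ᶠ[𝓝 0] fun _ => w x := by
    filter_upwards [hmin, hmax] with s h1 h2
    have h1' : w x ≤ w (x + s • e) := by simpa using h1
    have h2' : w (x + s • e) ≤ w x := by simpa using h2
    exact le_antisymm h2' h1'
  have : deriv (deriv (fun s : ℝ => w (x + s • e))) 0 = 0 := by
    rw [hconst.deriv.deriv_eq]; simp
  linarith

lemma lap_nonpos_of_isLocalMax {w : R2 → ℝ} {x : R2} (hw : ContDiffAt ℝ 2 w x)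
    (hm : IsLocalMax w x) : lap w x ≤ 0 := by
  rw [lap_eq]
  exact add_nonpos (pd_pd_nonpos_of_isLocalMax hw hm) (pd_pd_nonpos_of_isLocalMax hw hm)

/-- The weak maximum principle for strictly subharmonic functions. -/
lemma nonpos_of_lap_pos {S : Set R2} (hS : IsCompact S) {w : R2 → ℝ} (hw : ContinuousOn w S)
    (h : ∀ x ∈ S, w x ≤ 0 ∨ (S ∈ 𝓝 x ∧ ContDiffAt ℝ 2 w x ∧ 0 < lap w x)) :
    ∀ x ∈ S, w x ≤ 0 := by
  intro x hx
  obtain ⟨y, hy, hmax⟩ := hS.exists_isMaxOn ⟨x, hx⟩ hw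
  rcases h y hy with h0 | ⟨h1, h2, h3⟩
  · exact (hmax hx).trans h0
  · exact absurd (lap_nonpos_of_isLocalMax h2 (hmax.isLocalMax h1)) (not_le.2 h3)

lemma lap_coord (i : Fin 2) (x : R2) : lap (fun y => y i) x = 0 := by
  have : ∀ k, pd k (fun y : R2 => y i) = fun _ => if i = k then 1 else 0 :=
    fun k => funext fun y => pd_coord k i y
  simp [lap_eq, this, pd_const]

lemma lap_coord_sq (i : Fin 2) (x : R2) : lap (fun y => y i ^ 2) x = 2 := by
  have : ∀ k, pd k (fun y : R2 => y i ^ 2) = fun y => (if i = k then 2 else 0) * y i := by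
    intro k; funext y
    have h := pd_mul (i := k) (differentiable_coord i y) (differentiable_coord i y)
    simp only [← sq] at h
    rw [h, pd_coord]; split_ifs <;> ring
  simp only [lap_eq, this]
  rw [pd_const_mul (differentiable_coord i x), pd_const_mul (differentiable_coord i x),
    pd_coord, pd_coord]
  fin_cases i <;> simp

/-- Reflection of the `i`-th coordinate. -/
def reflectCoord (i : Fin 2) : R2 →L[ℝ] R2 :=
  ContinuousLinearMap.id ℝ R2 -
    (2 : ℝ) • (EuclideanSpace.proj i : R2 →L[ℝ] ℝ).smulRight (EuclideanSpace.single i (1 : ℝ))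

lemma reflectCoord_apply (i : Fin 2) (x : R2) :
    reflectCoord i x = x - (2 * x i) • EuclideanSpace.single i (1 : ℝ) := by
  simp [reflectCoord, smul_smul]

lemma reflectCoord_apply_coord (i k : Fin 2) (x : R2) :
    reflectCoord i x k = if k = i then -x i else x k := by
  rw [reflectCoord_apply]
  by_cases h : k = i
  · subst h; simp; ring
  · simp [h]

lemma norm_reflectCoord (i : Fin 2) (x : R2) : ‖reflectCoord i x‖ = ‖x‖ := by
  simp only [EuclideanSpace.norm_eq, reflectCoord_apply_coord, Fin.sum_univ_two]
  fin_cases i <;> simp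

lemma pd_comp_reflectCoord {i k : Fin 2} {u : R2 → ℝ} {x : R2}
    (hu : DifferentiableAt ℝ u (reflectCoord i x)) :
    pd k (fun y => u (reflectCoord i y)) x =
      (if k = i then -1 else 1) * pd k u (reflectCoord i x) := by
  have h2 : HasFDerivAt (fun y => u (reflectCoord i y)) _ x :=
    HasFDerivAt.comp x hu.hasFDerivAt (reflectCoord i).hasFDerivAt
  have h3 : reflectCoord i (EuclideanSpace.single k (1 : ℝ)) =
      (if k = i then (-1 : ℝ) else 1) • EuclideanSpace.single k (1 : ℝ) := by
    ext l
    rw [reflectCoord_apply_coord]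
    fin_cases i <;> fin_cases k <;> fin_cases l <;> simp
  simp only [pd, h2.fderiv, ContinuousLinearMap.comp_apply, h3, map_smul, smul_eq_mul]

lemma lap_comp_reflectCoord {i : Fin 2} {u : R2 → ℝ} {x : R2}
    (hu : ContDiffAt ℝ 2 u (reflectCoord i x)) :
    lap (fun y => u (reflectCoord i y)) x = lap u (reflectCoord i x) := by
  have hc : ContinuousAt (reflectCoord i) x := (reflectCoord i).continuous.continuousAt
  have h1 : ∀ k, pd k (fun y => u (reflectCoord i y)) =ᶠ[𝓝 x]
      fun y => (if k = i then -1 else 1) * pd k u (reflectCoord i y) := by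
    intro k
    filter_upwards [hc.eventually hu.eventually_differentiableAt] with y h1
      using pd_comp_reflectCoord h1
  have h2 : ∀ k, pd k (fun y => (if k = i then (-1 : ℝ) else 1) * pd k u (reflectCoord i y)) x =
      pd k (pd k u) (reflectCoord i x) := by
    intro k
    have hd : DifferentiableAt ℝ (pd k u) (reflectCoord i x) := hu.differentiableAt_pd
    rw [pd_const_mul, pd_comp_reflectCoord hd]
    · split_ifs <;> ring
    · exact DifferentiableAt.comp x hd (reflectCoord i).differentiableAt
  simp only [lap_eq, (h1 _).pd_eq, h2]

lemma pd_le_of_bounds {i : Fin 2} {h : R2 → ℝ} {d A B : ℝ} (hd : 0 < d) (hB : 0 < B)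
    (hC : ∀ y ∈ closedBall (0 : R2) (2 * d), ContDiffAt ℝ 2 h y)
    (hA : ∀ y ∈ closedBall (0 : R2) (2 * d), |h y| ≤ A)
    (hL : ∀ y ∈ closedBall (0 : R2) (2 * d), |lap h y| ≤ B) :
    pd i h 0 ≤ 2 * A / d + B * d := by
  obtain ⟨j, hij⟩ : ∃ j : Fin 2, j ≠ i := exists_ne i
  have hA0 : 0 ≤ A := (abs_nonneg _).trans (hA 0 (by simp; positivity))
  set S : Set R2 := {x | |x j| ≤ d ∧ 0 ≤ x i ∧ x i ≤ d} with hSdef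
  have hnorm : ∀ x : R2, ‖x‖ ^ 2 = x i ^ 2 + x j ^ 2 := by
    intro x
    rw [EuclideanSpace.real_norm_sq_eq, Fin.sum_univ_two]
    fin_cases i <;> fin_cases j <;> simp at hij ⊢; ring
  have hSsub : S ⊆ closedBall (0 : R2) (2 * d) := by
    rintro x ⟨h1, h2, h3⟩
    rw [mem_closedBall_zero_iff]
    refine abs_le_of_sq_le_sq' ?_ (by positivity) |>.2
    rw [hnorm]
    have : x j ^ 2 ≤ d ^ 2 := sq_le_sq' (abs_le.1 h1).1 (abs_le.1 h1).2
    nlinarith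
  have hci : Continuous fun x : R2 => x i := (differentiable_coord i).continuous
  have hcj : Continuous fun x : R2 => x j := (differentiable_coord j).continuous
  have hSc : IsCompact S := by
    refine (isCompact_closedBall (0 : R2) (2 * d)).of_isClosed_subset ?_ hSsub
    exact (isClosed_le hcj.abs continuous_const).inter
      ((isClosed_le continuous_const hci).inter (isClosed_le hci continuous_const))
  have hρ : ∀ x ∈ S, reflectCoord i x ∈ closedBall (0 : R2) (2 * d) := by
    intro x hx
    have := hSsub hx
    rw [mem_closedBall_zero_iff] at this ⊢
    rwa [norm_reflectCoord]
  set ψ : R2 → ℝ := fun x =>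
    A / d ^ 2 * x j ^ 2 + (-(A / d ^ 2 + B) * x i ^ 2 + (2 * A / d + B * d) * x i) with hψ
  set w : R2 → ℝ := fun x => (1 / 2 * h x + -(1 / 2) * h (reflectCoord i x)) - ψ x with hw
  have hρC : ∀ x ∈ S, ContDiffAt ℝ 2 (fun y => h (reflectCoord i y)) x := fun x hx =>
    ContDiffAt.comp x (hC _ (hρ x hx)) (reflectCoord i).contDiff.contDiffAt
  have hψC : ∀ x, ContDiffAt ℝ 2 ψ x := fun x =>
    ((contDiffAt_const.mul ((contDiff_coord j).contDiffAt.pow 2)).add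
      ((contDiffAt_const.mul ((contDiff_coord i).contDiffAt.pow 2)).add
        (contDiffAt_const.mul (contDiff_coord i).contDiffAt)))
  have hφC : ∀ x ∈ S, ContDiffAt ℝ 2 (fun x => 1 / 2 * h x + -(1 / 2) * h (reflectCoord i x)) x :=
    fun x hx => (contDiffAt_const.mul (hC x (hSsub hx))).add (contDiffAt_const.mul (hρC x hx))
  have hwC : ∀ x ∈ S, ContDiffAt ℝ 2 w x := fun x hx => (hφC x hx).sub (hψC x)
  have hψlap : ∀ x, lap ψ x = -2 * B := by
    intro x
    have c1 : ContDiffAt ℝ 2 (fun y : R2 => y j ^ 2) x := (contDiff_coord j).contDiffAt.pow 2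
    have c2 : ContDiffAt ℝ 2 (fun y : R2 => y i ^ 2) x := (contDiff_coord i).contDiffAt.pow 2
    have c3 : ContDiffAt ℝ 2 (fun y : R2 => y i) x := (contDiff_coord i).contDiffAt
    rw [hψ, lap_add (contDiffAt_const.mul c1)
      ((contDiffAt_const.mul c2).add (contDiffAt_const.mul c3)),
      lap_add (contDiffAt_const.mul c2) (contDiffAt_const.mul c3), lap_const_mul c1,
      lap_const_mul c2, lap_const_mul c3, lap_coord, lap_coord_sq, lap_coord_sq]
    ring
  have hψform : ∀ x : R2, ψ x = A / d ^ 2 * (x j ^ 2 + x i * (2 * d - x i)) + B * (x i * (d - x i)) := by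
    intro x; simp only [hψ]; field_simp; ring
  have hφle : ∀ x ∈ S, 1 / 2 * h x + -(1 / 2) * h (reflectCoord i x) ≤ A := by
    intro x hx
    have := abs_le.1 (hA x (hSsub hx)); have := abs_le.1 (hA _ (hρ x hx)); linarith
  have hmain : ∀ x ∈ S, w x ≤ 0 := by
    refine nonpos_of_lap_pos hSc (fun x hx => (hwC x hx).continuousAt.continuousWithinAt) ?_
    intro x hx
    obtain ⟨h1, h2, h3⟩ := hx
    have hx : x ∈ S := ⟨h1, h2, h3⟩
    have hpos : 0 ≤ B * (x i * (d - x i)) := by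
      have := mul_nonneg h2 (sub_nonneg.2 h3); positivity
    have hAd : A / d ^ 2 * d ^ 2 = A := by field_simp
    have hAd0 : 0 ≤ A / d ^ 2 := by positivity
    by_cases e1 : |x j| = d
    · left
      have : x j ^ 2 = d ^ 2 := by rw [← e1, sq_abs]
      have h5 : 0 ≤ x i * (2 * d - x i) := mul_nonneg h2 (by linarith)
      have := hφle x hx
      simp only [hw, hψform]
      nlinarith
    by_cases e2 : x i = d
    · left
      have := hφle x hx
      simp only [hw, hψform, e2]
      nlinarith [sq_nonneg (x j), mul_nonneg hAd0 (sq_nonneg (x j))]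
    by_cases e3 : x i = 0
    · left
      have : reflectCoord i x = x := by rw [reflectCoord_apply, e3]; simp
      simp only [hw, hψform, e3, this]
      nlinarith [mul_nonneg hAd0 (sq_nonneg (x j))]
    right
    refine ⟨?_, hwC x hx, ?_⟩
    · have o : IsOpen {x : R2 | |x j| < d ∧ 0 < x i ∧ x i < d} :=
        (isOpen_lt hcj.abs continuous_const).inter
          ((isOpen_lt continuous_const hci).inter (isOpen_lt hci continuous_const))
      refine Filter.mem_of_superset (o.mem_nhds
        ⟨lt_of_le_of_ne h1 e1, lt_of_le_of_ne h2 (Ne.symm e3), lt_of_le_of_ne h3 e2⟩) ?_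
      rintro y ⟨a, b, c⟩; exact ⟨a.le, b.le, c.le⟩
    · rw [hw, lap_sub (hφC x hx) (hψC x), hψlap, lap_add (contDiffAt_const.mul (hC x (hSsub hx)))
        (contDiffAt_const.mul (hρC x hx)), lap_const_mul (hC x (hSsub hx)),
        lap_const_mul (hρC x hx), lap_comp_reflectCoord (hC _ (hρ x hx))]
      have := abs_le.1 (hL x (hSsub hx)); have := abs_le.1 (hL _ (hρ x hx)); linarith
  set e : R2 := EuclideanSpace.single i 1
  have hei : e i = 1 := by simp [e]
  have hej : e j = 0 := by simp [e, hij]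
  have hhd : DifferentiableAt ℝ h 0 := (hC 0 (by simp; positivity)).differentiableAt (by norm_num)
  have hline : ∀ s : ℝ, HasDerivAt (fun s : ℝ => s • e) e s := fun s => by
    simpa using (hasDerivAt_id s).smul_const e
  have hderiv : HasDerivAt (fun s : ℝ => 1 / 2 * h (s • e) + -(1 / 2) * h (-(s • e)))
      (pd i h 0) 0 := by
    have h1 : HasDerivAt (fun s : ℝ => h (s • e)) (pd i h 0) 0 :=
      HasFDerivAt.comp_hasDerivAt_of_eq 0 hhd.hasFDerivAt (hline 0) (by simp)
    have h2 : HasDerivAt (fun s : ℝ => h (-(s • e))) (-pd i h 0) 0 := by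
      have h3 : HasDerivAt (fun s : ℝ => -(s • e)) (-e) 0 := (hline 0).neg
      have := HasFDerivAt.comp_hasDerivAt_of_eq 0 hhd.hasFDerivAt h3 (by simp)
      rw [map_neg] at this
      exact this
    exact ((h1.const_mul (1 / 2)).add (h2.const_mul (-(1 / 2)))).congr_deriv (by ring)
  have hseg : ∀ s ∈ Ioo (0 : ℝ) d,
      1 / 2 * h (s • e) + -(1 / 2) * h (-(s • e)) ≤ (2 * A / d + B * d) * s := by
    intro s hs
    have hmem : s • e ∈ S := by
      refine ⟨?_, ?_, ?_⟩ <;> simp [hei, hej] <;> linarith [hs.1, hs.2]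
    have h1 := hmain _ hmem
    have hr : reflectCoord i (s • e) = -(s • e) := by
      rw [reflectCoord_apply]; simp [hei]; module
    simp only [hw, hψ, hr, PiLp.smul_apply, smul_eq_mul, hei, hej] at h1
    have : 0 ≤ (A / d ^ 2 + B) * s ^ 2 := by positivity
    nlinarith
  have ht := hderiv.tendsto_slope_zero_right
  refine le_of_tendsto ht ?_
  filter_upwards [Ioo_mem_nhdsGT hd] with s hs
  have h1 := hseg s hs
  simp only [zero_add, smul_eq_mul, zero_smul, neg_zero]
  rw [inv_mul_le_iff₀ hs.1]
  linarith

/-- Interior gradient estimate for the Poisson equation. -/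
lemma abs_pd_le_of_bounds {i : Fin 2} {h : R2 → ℝ} {x : R2} {d A B : ℝ} (hd : 0 < d) (hB : 0 < B)
    (hC : ∀ y ∈ closedBall x (2 * d), ContDiffAt ℝ 2 h y)
    (hA : ∀ y ∈ closedBall x (2 * d), |h y| ≤ A)
    (hL : ∀ y ∈ closedBall x (2 * d), |lap h y| ≤ B) :
    |pd i h x| ≤ 2 * A / d + B * d := by
  have key : ∀ g : R2 → ℝ, (∀ y ∈ closedBall x (2 * d), ContDiffAt ℝ 2 g y) →
      (∀ y ∈ closedBall x (2 * d), |g y| ≤ A) → (∀ y ∈ closedBall x (2 * d), |lap g y| ≤ B) →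
      pd i g x ≤ 2 * A / d + B * d := by
    intro g gC gA gL
    have hm : ∀ y ∈ closedBall (0 : R2) (2 * d), (1 : ℝ) • y + x ∈ closedBall x (2 * d) := by
      intro y hy; simpa using hy
    have := pd_le_of_bounds (i := i) (h := fun y => g ((1 : ℝ) • y + x)) hd hB
      (fun y hy => ContDiffAt.comp (f := fun y : R2 => (1 : ℝ) • y + x) y (gC _ (hm y hy))
        (by fun_prop)) (fun y hy => gA _ (hm y hy))
      (fun y hy => by rw [lap_comp_affine (gC _ (hm y hy))]; simpa using gL _ (hm y hy))
    rwa [pd_comp_affine, one_mul, smul_zero, zero_add] at this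
    simpa using (gC x (by simp; positivity)).differentiableAt (by norm_num)
  rw [abs_le]
  constructor
  · have := key (fun y => -h y) (fun y hy => (hC y hy).neg) (fun y hy => by simpa using hA y hy)
      (fun y hy => by rw [lap_neg (hC y hy), abs_neg]; exact hL y hy)
    rw [pd_neg] at this; linarith
  · exact key h hC hA hL

/-- The radial profile of the averaging kernel. -/
def avgProfile (s : ℝ) : ℝ := Real.smoothTransition (2 - 4 * s)

/-- A smooth radial cutoff, equal to `1` on the ball of radius `1/2` and supported in the
unit ball. -/
def avgKernel (y : R2) : ℝ := avgProfile (‖y‖ ^ 2)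

/-- A compactly supported potential with `∇ avgPotential y = - avgKernel y • y`. -/
def avgPotential (y : R2) : ℝ := (1 / 2) * ∫ s in (‖y‖ ^ 2)..1, avgProfile s

lemma contDiff_avgProfile {n : ℕ∞} : ContDiff ℝ n avgProfile :=
  Real.smoothTransition.contDiff.comp (by fun_prop)

lemma avgProfile_nonneg (s : ℝ) : 0 ≤ avgProfile s := Real.smoothTransition.nonneg _

lemma avgProfile_le_one (s : ℝ) : avgProfile s ≤ 1 := Real.smoothTransition.le_one _

lemma avgProfile_eq_zero {s : ℝ} (h : 1 / 2 ≤ s) : avgProfile s = 0 :=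
  Real.smoothTransition.zero_of_nonpos (by linarith)

lemma avgProfile_eq_one {s : ℝ} (h : s ≤ 1 / 4) : avgProfile s = 1 :=
  Real.smoothTransition.one_of_one_le (by linarith)

lemma avgKernel_nonneg (y : R2) : 0 ≤ avgKernel y := avgProfile_nonneg _

lemma avgKernel_le_one (y : R2) : avgKernel y ≤ 1 := avgProfile_le_one _

lemma avgKernel_eq_one {y : R2} (h : ‖y‖ ≤ 1 / 2) : avgKernel y = 1 :=
  avgProfile_eq_one (by nlinarith [norm_nonneg y])

lemma avgKernel_eq_zero {y : R2} (h : 1 ≤ ‖y‖) : avgKernel y = 0 :=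
  avgProfile_eq_zero (by nlinarith)

lemma contDiff_avgKernel {n : ℕ∞} : ContDiff ℝ n avgKernel :=
  contDiff_avgProfile.comp (contDiff_norm_sq ℝ)

lemma continuous_avgKernel : Continuous avgKernel := (contDiff_avgKernel (n := 0)).continuous

lemma hasCompactSupport_avgKernel : HasCompactSupport avgKernel :=
  HasCompactSupport.intro (isCompact_closedBall (0 : R2) 1) fun y hy =>
    avgKernel_eq_zero (by simp at hy; exact hy.le)

lemma hasDerivAt_integral_avgProfile (s : ℝ) :
    HasDerivAt (fun s => (1 / 2) * ∫ r in s..1, avgProfile r) (-(1 / 2) * avgProfile s) s := by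
  have hc : Continuous avgProfile := (contDiff_avgProfile (n := 0)).continuous
  have := intervalIntegral.integral_hasDerivAt_left (hc.intervalIntegrable s 1)
    (hc.stronglyMeasurableAtFilter _ _) hc.continuousAt
  exact (this.const_mul (1 / 2)).congr_deriv (by ring)

lemma contDiff_avgPotential : ContDiff ℝ (⊤ : ℕ∞) avgPotential := by
  have h : ContDiff ℝ (⊤ : ℕ∞) (fun s => (1 / 2) * ∫ r in s..1, avgProfile r) := by
    rw [contDiff_infty_iff_deriv]
    refine ⟨fun s => (hasDerivAt_integral_avgProfile s).differentiableAt, ?_⟩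
    have : deriv (fun s => (1 / 2) * ∫ r in s..1, avgProfile r) =
        fun s => -(1 / 2) * avgProfile s := funext fun s => (hasDerivAt_integral_avgProfile s).deriv
    rw [this]
    exact contDiff_const.mul contDiff_avgProfile
  exact h.comp (contDiff_norm_sq ℝ)

lemma pd_avgPotential (i : Fin 2) (y : R2) : pd i avgPotential y = -(y i * avgKernel y) := by
  have hd : DifferentiableAt ℝ (fun y : R2 => ‖y‖ ^ 2) y :=
    (contDiff_norm_sq ℝ (n := 1)).differentiable (by norm_num) y
  have h := HasDerivAt.pd_comp (i := i) (u := fun y : R2 => ‖y‖ ^ 2)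
    (f := fun s => (1 / 2) * ∫ r in s..1, avgProfile r)
    (hasDerivAt_integral_avgProfile (‖y‖ ^ 2)) hd
  have h2 : pd i (fun y : R2 => ‖y‖ ^ 2) y = 2 * y i := by
    simp only [pd, (hasStrictFDerivAt_norm_sq y).hasFDerivAt.fderiv]
    simp [EuclideanSpace.inner_single_right]
  rw [h2] at h
  have h3 : pd i avgPotential y = _ := h
  rw [h3, avgKernel]; ring

lemma avgPotential_nonneg (y : R2) : 0 ≤ avgPotential y := by
  rw [avgPotential]
  rcases le_total (‖y‖ ^ 2) 1 with h | h
  · have := intervalIntegral.integral_nonneg (μ := volume) h (fun s _ => avgProfile_nonneg s)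
    positivity
  · rw [intervalIntegral.integral_symm, intervalIntegral.integral_congr (g := fun _ => 0)]
    · simp
    · intro s hs
      rw [uIcc_of_le h] at hs
      exact avgProfile_eq_zero (by linarith [hs.1])

lemma avgPotential_eq_zero {y : R2} (h : 1 ≤ ‖y‖) : avgPotential y = 0 := by
  have h : 1 ≤ ‖y‖ ^ 2 := by nlinarith
  rw [avgPotential, intervalIntegral.integral_symm,
    intervalIntegral.integral_congr (g := fun _ => 0)]
  · simp
  · intro s hs
    rw [uIcc_of_le h] at hs
    exact avgProfile_eq_zero (by linarith [hs.1])

lemma avgPotential_le_one (y : R2) : avgPotential y ≤ 1 := by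
  rcases le_total 1 ‖y‖ with h | h
  · rw [avgPotential_eq_zero h]; norm_num
  have h' : ‖y‖ ^ 2 ≤ 1 := by nlinarith [norm_nonneg y]
  have hc : Continuous avgProfile := (contDiff_avgProfile (n := 0)).continuous
  have := intervalIntegral.integral_mono_on (μ := volume) h' (hc.intervalIntegrable _ _)
    (continuous_const (y := (1 : ℝ)).intervalIntegrable _ _) (fun s _ => avgProfile_le_one s)
  rw [avgPotential]
  simp at this
  nlinarith [sq_nonneg ‖y‖]

lemma hasCompactSupport_avgPotential : HasCompactSupport avgPotential :=
  HasCompactSupport.intro (isCompact_closedBall (0 : R2) 1) fun y hy =>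
    avgPotential_eq_zero (by simp at hy; exact hy.le)

/-- Weighted average of `h` over the ball of centre `x` and radius `t` (not normalised). -/
def wavg (h : R2 → ℝ) (x : R2) (t : ℝ) : ℝ := ∫ η, avgKernel η * h (t • η + x)

/-- The total mass of the averaging kernel. -/
def kernelMass : ℝ := ∫ η, avgKernel η

/-- The total mass of the averaging potential. -/
def potentialMass : ℝ := ∫ η, avgPotential η

lemma integrable_avgKernel : Integrable avgKernel :=
  continuous_avgKernel.integrable_of_hasCompactSupport hasCompactSupport_avgKernel

lemma integrable_avgPotential : Integrable avgPotential :=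
  contDiff_avgPotential.continuous.integrable_of_hasCompactSupport hasCompactSupport_avgPotential

lemma kernelMass_pos : 0 < kernelMass := by
  refine (continuous_avgKernel).integral_pos_of_hasCompactSupport_nonneg_nonzero
    hasCompactSupport_avgKernel (fun y => avgKernel_nonneg y) (x := 0) ?_
  rw [avgKernel_eq_one (by simp)]; norm_num

lemma potentialMass_nonneg : 0 ≤ potentialMass := integral_nonneg avgPotential_nonneg

lemma wavg_zero (h : R2 → ℝ) (x : R2) : wavg h x 0 = kernelMass * h x := by
  simp [wavg, kernelMass, integral_mul_const]

lemma wavg_neg (h : R2 → ℝ) (x : R2) (t : ℝ) : wavg (fun y => -h y) x t = -wavg h x t := by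
  simp [wavg, integral_neg]

lemma wavg_congr {h g : R2 → ℝ} {x : R2} {t : ℝ} (ht : 0 ≤ t)
    (hg : ∀ y ∈ closedBall x t, h y = g y) : wavg h x t = wavg g x t := by
  refine integral_congr_ae (Eventually.of_forall fun η => ?_)
  rcases le_total 1 ‖η‖ with h1 | h1
  · simp [avgKernel_eq_zero h1]
  · have : t • η + x ∈ closedBall x t := by
      simp [norm_smul, abs_of_nonneg ht]; nlinarith
    simp [hg _ this]

lemma ContDiff.continuous_lap {h : R2 → ℝ} (hh : ContDiff ℝ 2 h) : Continuous (lap h) := by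
  have : lap h = fun x => _root_.pd 0 (_root_.pd 0 h) x + _root_.pd 1 (_root_.pd 1 h) x :=
    funext fun x => lap_eq h x
  rw [this]
  exact hh.pd_one.continuous_pd.add hh.pd_one.continuous_pd

lemma fderiv_apply_eq (h : R2 → ℝ) (x v : R2) : fderiv ℝ h x v = v 0 * pd 0 h x + v 1 * pd 1 h x := by
  have hv : v = v 0 • EuclideanSpace.single 0 (1 : ℝ) + v 1 • EuclideanSpace.single 1 (1 : ℝ) := by
    ext k; fin_cases k <;> simp
  conv_lhs => rw [hv]
  simp [pd]

/-- Derivative of the weighted averages with respect to the radius. -/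
lemma hasDerivAt_wavg {h : R2 → ℝ} (hh : ContDiff ℝ 2 h) (x : R2) (t : ℝ) :
    HasDerivAt (wavg h x) (t * ∫ η, avgPotential η * lap h (t • η + x)) t := by
  have hh1 : ContDiff ℝ 1 h := hh.of_le (by norm_num)
  have hcf : Continuous (fderiv ℝ h) := hh1.continuous_fderiv (by norm_num)
  obtain ⟨C, hC⟩ : ∃ C, ∀ p ∈ closedBall t 1 ×ˢ closedBall (0 : R2) 1,
      ‖fderiv ℝ h (p.1 • p.2 + x) p.2‖ ≤ C := by
    refine ((isCompact_closedBall t 1).prod (isCompact_closedBall (0 : R2) 1)).exists_bound_of_continuousOn ?_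
    exact Continuous.continuousOn (by fun_prop)
  have hmain := hasDerivAt_integral_of_dominated_loc_of_deriv_le (μ := (volume : Measure R2))
    (F := fun t η => avgKernel η * h (t • η + x))
    (F' := fun t η => avgKernel η * fderiv ℝ h (t • η + x) η) (x₀ := t) (s := closedBall t 1)
    (bound := fun η => avgKernel η * C) (closedBall_mem_nhds t one_pos)
    (Eventually.of_forall fun s => by
      have := hh.continuous
      exact (continuous_avgKernel.mul (by fun_prop)).aestronglyMeasurable)
    (by
      have := hh.continuous
      exact (continuous_avgKernel.mul (by fun_prop)).integrable_of_hasCompactSupport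
        hasCompactSupport_avgKernel.mul_right)
    (by exact (continuous_avgKernel.mul (by fun_prop)).aestronglyMeasurable)
    (Eventually.of_forall fun η s hs => by
      rw [norm_mul, Real.norm_of_nonneg (avgKernel_nonneg η)]
      rcases le_total 1 ‖η‖ with h1 | h1
      · simp [avgKernel_eq_zero h1]
      · exact mul_le_mul_of_nonneg_left (hC (s, η) ⟨hs, by simpa using h1⟩) (avgKernel_nonneg η))
    (integrable_avgKernel.mul_const C)
    (Eventually.of_forall fun η s _ => by
      have h1 : HasDerivAt (fun s : ℝ => s • η + x) η s := by
        simpa using ((hasDerivAt_id s).smul_const η).add_const x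
      exact (HasFDerivAt.comp_hasDerivAt s (hh1.differentiable (by norm_num) _).hasFDerivAt
        h1).const_mul _)
  refine hmain.2.congr_deriv ?_
  have hgi : ∀ i, ContDiff ℝ 1 fun η => pd i h (t • η + x) := fun i =>
    (hh.pd_one (i := i)).comp (by fun_prop)
  have hibp : ∀ i, ∫ η : R2, avgKernel η * (η i * pd i h (t • η + x)) =
      ∫ η, t * (avgPotential η * pd i (pd i h) (t • η + x)) := by
    intro i
    have h1 := integral_pd_mul (i := i) (contDiff_avgPotential.of_le (by norm_cast)) (hgi i)
      hasCompactSupport_avgPotential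
    have h2 : ∀ η, pd i (fun η => pd i h (t • η + x)) η = t * pd i (pd i h) (t • η + x) :=
      fun η => pd_comp_affine ((hh.pd_one (i := i)).differentiable (by norm_num) _)
    simp only [h2, pd_avgPotential] at h1
    have h3 : ∀ η : R2, avgKernel η * (η i * pd i h (t • η + x)) =
      -(-(η i * avgKernel η) * pd i h (t • η + x)) := fun η => by ring
    simp only [h3]
    rw [integral_neg, h1, neg_neg]
    exact integral_congr_ae (Eventually.of_forall fun η => by ring)
  have hint1 : ∀ i : Fin 2, Integrable fun η : R2 => avgKernel η * (η i * pd i h (t • η + x)) := by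
    intro i
    have := (hgi i).continuous
    have := (differentiable_coord i).continuous
    exact (continuous_avgKernel.mul (by fun_prop)).integrable_of_hasCompactSupport
      hasCompactSupport_avgKernel.mul_right
  have hint2 : ∀ i : Fin 2,
      Integrable fun η : R2 => t * (avgPotential η * pd i (pd i h) (t • η + x)) := by
    intro i
    have : Continuous (pd i (pd i h)) := hh.pd_one.continuous_pd
    exact ((contDiff_avgPotential.continuous.mul (by fun_prop)).integrable_of_hasCompactSupport
      hasCompactSupport_avgPotential.mul_right).const_mul t
  calc ∫ η, avgKernel η * fderiv ℝ h (t • η + x) η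
      = ∫ η : R2, (avgKernel η * (η 0 * pd 0 h (t • η + x)) +
        avgKernel η * (η 1 * pd 1 h (t • η + x))) := by
        refine integral_congr_ae (Eventually.of_forall fun η => ?_)
        simp only [fderiv_apply_eq]; ring
    _ = ∫ η : R2, (t * (avgPotential η * pd 0 (pd 0 h) (t • η + x)) +
        t * (avgPotential η * pd 1 (pd 1 h) (t • η + x))) := by
        rw [integral_add (hint1 0) (hint1 1), integral_add (hint2 0) (hint2 1), hibp, hibp]
    _ = t * ∫ η, avgPotential η * lap h (t • η + x) := by
        rw [← integral_const_mul]
        refine integral_congr_ae (Eventually.of_forall fun η => ?_)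
        simp only [lap_eq]; ring

lemma integrable_avgPotential_mul {g : R2 → ℝ} (hg : Continuous g) (x : R2) (t : ℝ) :
    Integrable fun η => avgPotential η * g (t • η + x) :=
  (contDiff_avgPotential.continuous.mul (by fun_prop)).integrable_of_hasCompactSupport
    hasCompactSupport_avgPotential.mul_right

lemma wavg_le_of_contDiff {h : R2 → ℝ} (hh : ContDiff ℝ 2 h) {x : R2} {t b : ℝ} (ht : 0 ≤ t)
    (hb : ∀ y ∈ closedBall x t, lap h y ≤ b) :
    wavg h x t ≤ kernelMass * h x + b * potentialMass * t ^ 2 / 2 := by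
  have hd : ∀ s, HasDerivAt (fun s => wavg h x s - b * potentialMass * s ^ 2 / 2)
      (s * (∫ η, avgPotential η * lap h (s • η + x)) - b * potentialMass * s) s := by
    intro s
    have h2 := (((hasDerivAt_id s).pow 2).const_mul (b * potentialMass)).div_const 2
    exact ((hasDerivAt_wavg hh x s).sub h2).congr_deriv (by simp; ring)
  have hanti : AntitoneOn (fun s => wavg h x s - b * potentialMass * s ^ 2 / 2) (Icc 0 t) := by
    refine antitoneOn_of_deriv_nonpos (convex_Icc 0 t)
      (fun s _ => (hd s).continuousAt.continuousWithinAt)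
      (fun s _ => (hd s).differentiableAt.differentiableWithinAt) ?_
    intro s hs
    rw [interior_Icc] at hs
    rw [(hd s).deriv]
    have : ∫ η, avgPotential η * lap h (s • η + x) ≤ ∫ η, avgPotential η * b := by
      refine integral_mono (integrable_avgPotential_mul hh.continuous_lap x s)
        (integrable_avgPotential.mul_const b) fun η => ?_
      rcases le_total 1 ‖η‖ with h1 | h1
      · simp [avgPotential_eq_zero h1]
      · refine mul_le_mul_of_nonneg_left (hb _ ?_) (avgPotential_nonneg η)
        simp [norm_smul, abs_of_pos hs.1]; nlinarith [hs.1, hs.2]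
    rw [integral_mul_const] at this
    have h3 : ∫ η, avgPotential η = potentialMass := rfl
    rw [h3] at this
    nlinarith [hs.1]
  have := hanti (left_mem_Icc.2 ht) (right_mem_Icc.2 ht) ht
  simp only [wavg_zero] at this
  linarith

/-- A function that is `C²` near a closed ball coincides near it with a globally `C²` function. -/
lemma exists_contDiff_eventuallyEq {h : R2 → ℝ} {x : R2} {R : ℝ} (hR : 0 ≤ R)
    (hh : ∀ y ∈ closedBall x R, ContDiffAt ℝ 2 h y) :
    ∃ g : R2 → ℝ, ContDiff ℝ 2 g ∧ ∀ y ∈ closedBall x R, g =ᶠ[𝓝 y] h := by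
  have hU : IsOpen {y | ContDiffAt ℝ 2 h y} := by
    rw [isOpen_iff_mem_nhds]
    intro y hy
    exact ContDiffAt.eventually hy (by simp)
  obtain ⟨δ, hδ, hsub⟩ := (isCompact_closedBall x R).exists_cthickening_subset_open hU hh
  rw [cthickening_closedBall hδ.le hR] at hsub
  let f : ContDiffBump x := ⟨R + δ / 3, R + 2 * δ / 3, by positivity, by linarith⟩
  refine ⟨fun y => f y * h y, ?_, ?_⟩
  · rw [contDiff_iff_contDiffAt]
    intro y
    by_cases hy : y ∈ tsupport f
    · rw [f.tsupport_eq] at hy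
      refine f.contDiff.contDiffAt.mul (hsub ?_)
      exact closedBall_subset_closedBall (by show R + 2 * δ / 3 ≤ _; linarith) hy
    · have : (fun y => f y * h y) =ᶠ[𝓝 y] fun _ => 0 := by
        filter_upwards [(isClosed_tsupport f).isOpen_compl.mem_nhds hy] with z hz
        rw [image_eq_zero_of_notMem_tsupport hz, zero_mul]
      exact contDiffAt_const.congr_of_eventuallyEq this
  · intro y hy
    have : y ∈ ball x f.rIn := by
      rw [mem_closedBall] at hy; rw [mem_ball]; show _ < R + δ / 3; linarith
    filter_upwards [isOpen_ball.mem_nhds this] with z hz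
    rw [f.one_of_mem_closedBall (ball_subset_closedBall hz), one_mul]

lemma wavg_le {h : R2 → ℝ} {x : R2} {t b : ℝ} (ht : 0 ≤ t)
    (hh : ∀ y ∈ closedBall x t, ContDiffAt ℝ 2 h y) (hb : ∀ y ∈ closedBall x t, lap h y ≤ b) :
    wavg h x t ≤ kernelMass * h x + b * potentialMass * t ^ 2 / 2 := by
  obtain ⟨g, hg, hgh⟩ := exists_contDiff_eventuallyEq ht hh
  have := wavg_le_of_contDiff hg ht (b := b) (fun y hy => by rw [(hgh y hy).lap_eq]; exact hb y hy)
  rwa [wavg_congr ht (fun y hy => (hgh y hy).self_of_nhds),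
    (hgh x (mem_closedBall_self ht)).self_of_nhds] at this

lemma le_wavg {h : R2 → ℝ} {x : R2} {t b : ℝ} (ht : 0 ≤ t)
    (hh : ∀ y ∈ closedBall x t, ContDiffAt ℝ 2 h y) (hb : ∀ y ∈ closedBall x t, -b ≤ lap h y) :
    kernelMass * h x - b * potentialMass * t ^ 2 / 2 ≤ wavg h x t := by
  have := wavg_le (h := fun y => -h y) (b := b) ht (fun y hy => (hh y hy).neg)
    (fun y hy => by rw [lap_neg (hh y hy)]; linarith [hb y hy])
  rw [wavg_neg] at this
  linarith

lemma wavg_eq_integral (h : R2 → ℝ) (x : R2) {t : ℝ} (ht : 0 < t) :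
    t ^ 2 * wavg h x t = ∫ ξ, avgKernel (t⁻¹ • (ξ - x)) * h ξ := by
  have h1 := integral_add_right_eq_self (μ := (volume : Measure R2))
    (fun ξ => avgKernel (t⁻¹ • (ξ - x)) * h ξ) x
  have h2 := Measure.integral_comp_smul (volume : Measure R2)
    (fun ξ => avgKernel (t⁻¹ • (ξ + x - x)) * h (ξ + x)) t
  rw [h1] at h2
  simp only [add_sub_cancel_right, smul_smul, inv_mul_cancel₀ ht.ne', one_smul, finrank_euclideanSpace,
    Fintype.card_fin, smul_eq_mul] at h2
  rw [wavg, h2, abs_of_pos (by positivity)]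
  field_simp

lemma hasCompactSupport_avgKernel_comp (x : R2) {t : ℝ} (ht : 0 < t) :
    HasCompactSupport fun ξ => avgKernel (t⁻¹ • (ξ - x)) :=
  HasCompactSupport.intro (isCompact_closedBall x t) fun y hy => avgKernel_eq_zero (by
    rw [mem_closedBall, dist_eq_norm, not_le] at hy
    rw [norm_smul, norm_inv, Real.norm_of_nonneg ht.le, inv_mul_eq_div, one_le_div ht]
    exact hy.le)

lemma integrable_avgKernel_comp_mul {h : R2 → ℝ} (hh : Continuous h) (x : R2) {t : ℝ} (ht : 0 < t) :
    Integrable fun ξ => avgKernel (t⁻¹ • (ξ - x)) * h ξ := by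
  have := continuous_avgKernel
  exact Continuous.integrable_of_hasCompactSupport (by fun_prop)
    (hasCompactSupport_avgKernel_comp x ht).mul_right

lemma mem_closedBall_of_avgKernel_ne_zero {x ξ : R2} {t : ℝ} (ht : 0 < t)
    (h : avgKernel (t⁻¹ • (ξ - x)) ≠ 0) : ξ ∈ closedBall x t := by
  by_contra hy
  refine h (avgKernel_eq_zero ?_)
  rw [mem_closedBall, dist_eq_norm, not_le] at hy
  rw [norm_smul, norm_inv, Real.norm_of_nonneg ht.le, inv_mul_eq_div, one_le_div ht]
  exact hy.le

lemma avgKernel_comp_eq_one {x ξ : R2} {t : ℝ} (ht : 0 < t) (h : ξ ∈ closedBall x (t / 2)) :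
    avgKernel (t⁻¹ • (ξ - x)) = 1 := by
  refine avgKernel_eq_one ?_
  rw [mem_closedBall, dist_eq_norm] at h
  rw [norm_smul, norm_inv, Real.norm_of_nonneg ht.le, inv_mul_eq_div, div_le_iff₀ ht]
  linarith

lemma wavg_le_wavg_of_mem {h : R2 → ℝ} (hh : Continuous h) {x₀ x : R2} {t : ℝ} (ht : 0 < t)
    (h0 : ∀ y ∈ closedBall x₀ (4 * t), 0 ≤ h y) (hx : x ∈ closedBall x₀ t) :
    wavg h x t ≤ 16 * wavg h x₀ (4 * t) := by
  have h1 := wavg_eq_integral h x ht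
  have h2 := wavg_eq_integral h x₀ (t := 4 * t) (by positivity)
  have h3 : ∫ ξ, avgKernel (t⁻¹ • (ξ - x)) * h ξ ≤
      ∫ ξ, avgKernel ((4 * t)⁻¹ • (ξ - x₀)) * h ξ := by
    refine integral_mono (integrable_avgKernel_comp_mul hh x ht)
      (integrable_avgKernel_comp_mul hh x₀ (by positivity)) fun ξ => ?_
    by_cases hk : avgKernel (t⁻¹ • (ξ - x)) = 0
    · simp only [hk, zero_mul]
      by_cases hk' : avgKernel ((4 * t)⁻¹ • (ξ - x₀)) = 0
      · rw [hk', zero_mul]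
      · exact mul_nonneg (avgKernel_nonneg _)
          (h0 _ (mem_closedBall_of_avgKernel_ne_zero (by positivity) hk'))
    · have hξ := mem_closedBall_of_avgKernel_ne_zero ht hk
      have hξ' : ξ ∈ closedBall x₀ (2 * t) := by
        rw [mem_closedBall] at *; linarith [dist_triangle ξ x x₀]
      have e1 : avgKernel ((4 * t)⁻¹ • (ξ - x₀)) = 1 :=
        avgKernel_comp_eq_one (by positivity) (by rwa [show 4 * t / 2 = 2 * t by ring])
      have e2 : 0 ≤ h ξ := h0 _ (closedBall_subset_closedBall (by linarith) hξ')
      simp only [e1]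
      exact mul_le_mul_of_nonneg_right (avgKernel_le_one _) e2
  have ht2 : 0 < t ^ 2 := by positivity
  nlinarith

/-- Harnack inequality for nonnegative functions with bounded Laplacian. -/
lemma exists_harnack : ∃ C : ℝ, 0 < C ∧ ∀ (h : R2 → ℝ) (x₀ : R2) (t b : ℝ), 0 < t → 0 ≤ b →
    (∀ y ∈ closedBall x₀ (4 * t), ContDiffAt ℝ 2 h y) →
    (∀ y ∈ closedBall x₀ (4 * t), 0 ≤ h y) → (∀ y ∈ closedBall x₀ (4 * t), |lap h y| ≤ b) →
    ∀ x ∈ closedBall x₀ t, h x ≤ C * (h x₀ + b * t ^ 2) := by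
  have hk := kernelMass_pos
  have hp := potentialMass_nonneg
  refine ⟨16 + 200 * potentialMass / kernelMass, by positivity, ?_⟩
  intro h x₀ t b ht hb hC h0 hL x hx
  obtain ⟨g, hg, hgh⟩ := exists_contDiff_eventuallyEq (x := x₀) (R := 4 * t) (by positivity) hC
  have hsub : closedBall x t ⊆ closedBall x₀ (4 * t) := by
    intro y hy
    rw [mem_closedBall] at *; linarith [dist_triangle y x x₀]
  have e1 := le_wavg (x := x) (b := b) ht.le (fun y hy => hC y (hsub hy))
    (fun y hy => (abs_le.1 (hL y (hsub hy))).1)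
  have e2 := wavg_le (x := x₀) (t := 4 * t) (b := b) (by positivity) hC
    (fun y hy => (abs_le.1 (hL y hy)).2)
  have e3 := wavg_le_wavg_of_mem hg.continuous ht (fun y hy => by
    rw [(hgh y hy).self_of_nhds]; exact h0 y hy) hx
  rw [wavg_congr ht.le (fun y hy => (hgh y (hsub hy)).self_of_nhds),
    wavg_congr (by positivity) (fun y hy => (hgh y hy).self_of_nhds)] at e3
  have e4 : kernelMass * h x ≤ 16 * kernelMass * h x₀ + 129 * (b * potentialMass * t ^ 2) := by
    have : 0 ≤ b * potentialMass * t ^ 2 := by positivity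
    nlinarith
  have hx0 : 0 ≤ h x₀ := h0 _ (mem_closedBall_self (by positivity))
  have hq : 0 ≤ potentialMass / kernelMass := by positivity
  have e5 : h x ≤ 16 * h x₀ + 129 * (b * (potentialMass / kernelMass) * t ^ 2) := by
    rw [← mul_le_mul_iff_right₀ hk]
    calc _ ≤ _ := e4
      _ = _ := by field_simp
  have e6 : 0 ≤ potentialMass / kernelMass * h x₀ := by positivity
  have e7 : 0 ≤ b * t ^ 2 := by positivity
  have e8 : 0 ≤ potentialMass / kernelMass * (b * t ^ 2) := by positivity
  rw [mul_div_assoc]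
  nlinarith

/-- Entire solutions of the Liouville equation, nonpositive and of finite mass. -/
structure IsLiouvilleSol (z : R2 → ℝ) : Prop where
  contDiff : ContDiff ℝ 2 z
  lap_eq : ∀ x, lap z x = -Real.exp (z x)
  nonpos : ∀ x, z x ≤ 0
  integrable : Integrable fun x => Real.exp (z x)

lemma IsLiouvilleSol.translate {z : R2 → ℝ} (hz : IsLiouvilleSol z) (c : R2) :
    IsLiouvilleSol fun x => z ((1 : ℝ) • x + c) where
  contDiff := hz.contDiff.comp (by fun_prop)
  lap_eq x := by rw [lap_comp_affine hz.contDiff.contDiffAt, hz.lap_eq]; ring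
  nonpos x := hz.nonpos _
  integrable := by
    simp only [one_smul]
    exact hz.integrable.comp_add_right c

lemma IsLiouvilleSol.exists_wavg_le {z : R2 → ℝ} (hz : IsLiouvilleSol z) :
    ∃ C, 0 ≤ C ∧ ∀ t, 1 ≤ t → wavg (fun x => -z x) 0 t ≤ C * (1 + Real.log t) := by
  set m := ∫ x, Real.exp (z x)
  have hm : 0 ≤ m := integral_nonneg fun x => (Real.exp_pos _).le
  have hl : ∀ y, lap (fun x => -z x) y = Real.exp (z y) := fun y => by
    rw [lap_neg hz.contDiff.contDiffAt, hz.lap_eq, neg_neg]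
  set F := wavg (fun x => -z x) 0
  have hd : ∀ s, HasDerivAt F (s * ∫ η, avgPotential η * lap (fun x => -z x) (s • η + 0)) s :=
    hasDerivAt_wavg hz.contDiff.neg 0
  have hle : ∀ s : ℝ, 0 < s →
      s * (∫ η, avgPotential η * lap (fun x => -z x) (s • η + 0)) ≤ m / s := by
    intro s hs
    have h1 : ∫ η, avgPotential η * lap (fun x => -z x) (s • η + 0) ≤
        ∫ η : R2, Real.exp (z (s • η)) := by
      refine integral_mono (integrable_avgPotential_mul hz.contDiff.neg.continuous_lap 0 s)
        (hz.integrable.comp_smul hs.ne') fun η => ?_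
      simp only [hl, add_zero]
      exact mul_le_of_le_one_left (Real.exp_pos _).le (avgPotential_le_one η)
    rw [Measure.integral_comp_smul volume (fun x => Real.exp (z x))] at h1
    simp only [finrank_euclideanSpace, Fintype.card_fin, smul_eq_mul] at h1
    rw [abs_of_pos (by positivity)] at h1
    calc _ ≤ s * ((s ^ 2)⁻¹ * m) := mul_le_mul_of_nonneg_left h1 hs.le
      _ = m / s := by field_simp
  have hanti : AntitoneOn (fun s => F s - m * Real.log s) (Ici 1) := by
    have hd2 : ∀ s : ℝ, 1 ≤ s → HasDerivAt (fun s => F s - m * Real.log s)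
        (s * (∫ η, avgPotential η * lap (fun x => -z x) (s • η + 0)) - m * s⁻¹) s := fun s hs =>
      (hd s).sub ((Real.hasDerivAt_log (by linarith)).const_mul m)
    refine antitoneOn_of_deriv_nonpos (convex_Ici 1)
      (fun s hs => (hd2 s hs).continuousAt.continuousWithinAt)
      (fun s hs => (hd2 s (interior_subset hs)).differentiableAt.differentiableWithinAt) ?_
    intro s hs
    have hs' : (1 : ℝ) ≤ s := interior_subset hs
    rw [(hd2 s hs').deriv]
    have := hle s (by linarith)
    rw [div_eq_mul_inv] at this
    linarith
  refine ⟨|F 1| + m, by positivity, fun t ht => ?_⟩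
  have h1 := hanti (mem_Ici.2 le_rfl) (mem_Ici.2 ht) ht
  simp only [Real.log_one] at h1
  have h2 : 0 ≤ Real.log t := Real.log_nonneg ht
  nlinarith [le_abs_self (F 1), abs_nonneg (F 1)]

lemma IsLiouvilleSol.exists_growth {z : R2 → ℝ} (hz : IsLiouvilleSol z) :
    ∃ C, 0 ≤ C ∧ ∀ t, 1 ≤ t → ∀ x ∈ closedBall (0 : R2) t, |z x| ≤ C * (3 + Real.log t) := by
  obtain ⟨C, hC, h⟩ := hz.exists_wavg_le
  have hk := kernelMass_pos
  refine ⟨16 * C / kernelMass, by positivity, fun t ht x hx => ?_⟩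
  have h1 := le_wavg (h := fun x => -z x) (x := x) (b := 0) (t := t) (by linarith)
    (fun y _ => hz.contDiff.neg.contDiffAt) (fun y _ => by
      rw [lap_neg hz.contDiff.contDiffAt, hz.lap_eq, neg_neg, neg_zero]; exact (Real.exp_pos _).le)
  have h2 := wavg_le_wavg_of_mem (h := fun x => -z x) hz.contDiff.continuous.neg
    (by linarith : 0 < t) (fun y _ => by linarith [hz.nonpos y]) hx
  have h3 := h (4 * t) (by linarith)
  have h4 : Real.log (4 * t) ≤ 2 + Real.log t := by
    rw [Real.log_mul (by norm_num) (by linarith), show (4 : ℝ) = 2 ^ 2 by norm_num, Real.log_pow]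
    have := Real.log_two_lt_d9
    push_cast; linarith
  rw [abs_of_nonpos (hz.nonpos x), div_mul_eq_mul_div, le_div_iff₀ hk]
  have h5 : C * (1 + Real.log (4 * t)) ≤ C * (3 + Real.log t) :=
    mul_le_mul_of_nonneg_left (by linarith) hC
  nlinarith

/-- The kernel `avgKernel` rescaled to radius `R`. -/
def cutoff (R : ℝ) (x : R2) : ℝ := avgKernel (R⁻¹ • x + 0)

lemma contDiff_cutoff (R : ℝ) {n : ℕ∞} : ContDiff ℝ n (cutoff R) :=
  contDiff_avgKernel.comp (by fun_prop)

lemma hasCompactSupport_cutoff {R : ℝ} (hR : 0 < R) : HasCompactSupport (cutoff R) := by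
  have := hasCompactSupport_avgKernel_comp 0 hR
  simp only [sub_zero] at this
  unfold cutoff
  simpa only [add_zero] using this

lemma cutoff_nonneg (R : ℝ) (x : R2) : 0 ≤ cutoff R x := avgKernel_nonneg _

lemma cutoff_le_one (R : ℝ) (x : R2) : cutoff R x ≤ 1 := avgKernel_le_one _

lemma cutoff_eq_one {R : ℝ} (hR : 0 < R) {x : R2} (hx : x ∈ closedBall (0 : R2) (R / 2)) :
    cutoff R x = 1 := by
  simpa [cutoff] using avgKernel_comp_eq_one hR hx

lemma cutoff_eq_zero {R : ℝ} (hR : 0 < R) {x : R2} (hx : x ∉ closedBall (0 : R2) R) :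
    cutoff R x = 0 := by
  by_contra h
  exact hx (mem_closedBall_of_avgKernel_ne_zero (x := 0) hR (by simpa [cutoff] using h))

lemma exists_pd_avgKernel_le : ∃ A : ℝ, 0 < A ∧ ∀ i x, |pd i avgKernel x| ≤ A := by
  have : ∀ i, ∃ A, ∀ x, ‖pd i avgKernel x‖ ≤ A := fun i =>
    (contDiff_avgKernel (n := 1)).continuous_pd.bounded_above_of_compact_support
      hasCompactSupport_avgKernel.pd
  choose A hA using this
  refine ⟨max 1 (max (A 0) (A 1)), by positivity, fun i x => (hA i x).trans ?_⟩
  fin_cases i <;> simp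

lemma pd_cutoff (i : Fin 2) (R : ℝ) (x : R2) :
    pd i (cutoff R) x = R⁻¹ * pd i avgKernel (R⁻¹ • x + 0) :=
  pd_comp_affine ((contDiff_avgKernel (n := 1)).differentiable (by norm_num) _)

lemma pd_cutoff_eq_zero {i : Fin 2} {R : ℝ} (hR : 0 < R) {x : R2} (hx : x ∉ closedBall (0 : R2) R) :
    pd i (cutoff R) x = 0 := by
  have : cutoff R =ᶠ[𝓝 x] fun _ => 0 := by
    filter_upwards [isClosed_closedBall.isOpen_compl.mem_nhds hx] with y hy using
      cutoff_eq_zero hR hy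
  rw [this.pd_eq, pd_const]

/-- Caccioppoli inequality for nonpositive functions with nonpositive Laplacian. -/
lemma exists_caccioppoli : ∃ C : ℝ, 0 < C ∧ ∀ (z : R2 → ℝ), ContDiff ℝ 2 z → (∀ x, z x ≤ 0) →
    (∀ x, lap z x ≤ 0) → ∀ R S : ℝ, 0 < R → (∀ x ∈ closedBall (0 : R2) (2 * R), |z x| ≤ S) →
    ∫ x in closedBall (0 : R2) R, (pd 0 z x ^ 2 + pd 1 z x ^ 2) ≤ C * S ^ 2 := by
  obtain ⟨A, hA, hAk⟩ := exists_pd_avgKernel_le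
  set V : ℝ := volume.real (closedBall (0 : R2) 1)
  have hV : 0 ≤ V := measureReal_nonneg
  refine ⟨8 * A ^ 2 * V + 1, by positivity, ?_⟩
  intro z hz hz0 hl R S hR hS
  set c := cutoff (2 * R)
  have hR2 : 0 < 2 * R := by positivity
  have hc1 : ContDiff ℝ 1 c := contDiff_cutoff _
  have hz1 : ContDiff ℝ 1 z := hz.of_le (by norm_num)
  have hcs : HasCompactSupport c := hasCompactSupport_cutoff hR2
  have hdc : ∀ x, DifferentiableAt ℝ c x := hc1.differentiable (by norm_num)
  have hdz : ∀ x, DifferentiableAt ℝ z x := hz1.differentiable (by norm_num)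
  have hcc := hc1.continuous
  have hzc := hz1.continuous
  have hp : ∀ i, Continuous (pd i z) := fun i => hz1.continuous_pd
  have hpc : ∀ i, Continuous (pd i c) := fun i => hc1.continuous_pd
  have hpp : ∀ i, Continuous (pd i (pd i z)) := fun i => hz.pd_one.continuous_pd
  have hibp : ∀ i, ∫ x, (c x ^ 2 * pd i z x ^ 2 + 2 * (c x * z x * pd i c x * pd i z x) +
      c x ^ 2 * z x * pd i (pd i z) x) = 0 := by
    intro i
    have h := integral_pd_eq_zero (i := i) (f := fun x => c x * c x * (z x * pd i z x))
      ((hc1.mul hc1).mul (hz1.mul hz.pd_one)) (hcs.mul_right.mul_right)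
    rw [← h]
    refine integral_congr_ae (Eventually.of_forall fun x => ?_)
    have hzi : DifferentiableAt ℝ (pd i z) x := hz.pd_one.differentiable (by norm_num) x
    simp only
    rw [pd_mul ((hdc x).fun_mul (hdc x)) ((hdz x).fun_mul hzi), pd_mul (hdc x) (hdc x), pd_mul (hdz x) hzi]
    ring
  have hi : ∀ i, Integrable fun x => (c x ^ 2 * pd i z x ^ 2 +
      2 * (c x * z x * pd i c x * pd i z x) + c x ^ 2 * z x * pd i (pd i z) x) := by
    intro i
    have h1 := hp i; have h2 := hpc i; have h3 := hpp i
    refine Continuous.integrable_of_hasCompactSupport (by fun_prop) ?_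
    refine HasCompactSupport.intro (isCompact_closedBall (0 : R2) (2 * R)) fun x hx => ?_
    simp [c, cutoff_eq_zero hR2 hx]
  have hsum := integral_add (hi 0) (hi 1)
  rw [hibp, hibp, add_zero] at hsum
  have hfin : IsFiniteMeasure (volume.restrict (closedBall (0 : R2) (2 * R))) :=
    ⟨by rw [Measure.restrict_apply_univ]; exact (isCompact_closedBall (0 : R2) (2 * R)).measure_lt_top⟩
  -- pointwise bound
  have hpt : ∀ x, 1 / 2 * (c x ^ 2 * (pd 0 z x ^ 2 + pd 1 z x ^ 2)) ≤
      (c x ^ 2 * pd 0 z x ^ 2 + 2 * (c x * z x * pd 0 c x * pd 0 z x) +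
        c x ^ 2 * z x * pd 0 (pd 0 z) x) + (c x ^ 2 * pd 1 z x ^ 2 +
        2 * (c x * z x * pd 1 c x * pd 1 z x) + c x ^ 2 * z x * pd 1 (pd 1 z) x) +
      indicator (closedBall (0 : R2) (2 * R)) (fun _ => S ^ 2 * (A / R) ^ 2) x := by
    intro x
    by_cases hx : x ∈ closedBall (0 : R2) (2 * R)
    · rw [indicator_of_mem hx]
      have h1 : 0 ≤ c x ^ 2 * (z x * (pd 0 (pd 0 z) x + pd 1 (pd 1 z) x)) := by
        rw [← lap_eq]
        exact mul_nonneg (sq_nonneg _) (mul_nonneg_of_nonpos_of_nonpos (hz0 x) (hl x))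
      have hcx : ∀ i, pd i c x ^ 2 ≤ (A / (2 * R)) ^ 2 := by
        intro i
        rw [← sq_abs, pd_cutoff, abs_mul, abs_inv, abs_of_pos hR2]
        refine pow_le_pow_left₀ (by positivity) ?_ 2
        rw [inv_mul_eq_div]
        exact div_le_div_of_nonneg_right (hAk i _) hR2.le
      have hzx : z x ^ 2 ≤ S ^ 2 := by
        rw [← sq_abs]; exact pow_le_pow_left₀ (abs_nonneg _) (hS x hx) 2
      have h2 : ∀ i, z x ^ 2 * pd i c x ^ 2 ≤ S ^ 2 * (A / (2 * R)) ^ 2 := fun i =>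
        mul_le_mul hzx (hcx i) (sq_nonneg _) (sq_nonneg _)
      have h3 : ∀ i, 0 ≤ 1 / 2 * (c x * pd i z x + 2 * (z x * pd i c x)) ^ 2 := fun i => by
        positivity
      have h4 : S ^ 2 * (A / R) ^ 2 = 4 * (S ^ 2 * (A / (2 * R)) ^ 2) := by
        field_simp; ring
      rw [h4]
      nlinarith [h2 0, h2 1, h3 0, h3 1]
    · rw [indicator_of_notMem hx]
      simp [c, cutoff_eq_zero hR2 hx]
  have hint1 : Integrable fun x => c x ^ 2 * (pd 0 z x ^ 2 + pd 1 z x ^ 2) := by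
    have h1 := hp 0; have h2 := hp 1
    refine Continuous.integrable_of_hasCompactSupport (by fun_prop) ?_
    refine HasCompactSupport.intro (isCompact_closedBall (0 : R2) (2 * R)) fun x hx => ?_
    simp [c, cutoff_eq_zero hR2 hx]
  have hint2 : Integrable
      (indicator (closedBall (0 : R2) (2 * R)) (fun _ => S ^ 2 * (A / R) ^ 2)) :=
    (integrable_indicator_iff measurableSet_closedBall).2 (integrable_const _)
  have hmono := integral_mono (hint1.const_mul (1 / 2)) (((hi 0).add (hi 1)).add hint2) hpt
  have hadd := integral_add ((hi 0).add (hi 1)) hint2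
  simp only [Pi.add_apply] at hmono hadd
  rw [hadd, hsum, integral_const_mul,
    integral_indicator measurableSet_closedBall, setIntegral_const, smul_eq_mul] at hmono
  have hvol : volume.real (closedBall (0 : R2) (2 * R)) = (2 * R) ^ 2 * V := by
    rw [measureReal_def, Measure.addHaar_closedBall' _ _ hR2.le]
    simp [V, measureReal_def, ENNReal.toReal_ofReal (by positivity : (0:ℝ) ≤ (2 * R) ^ 2)]
  rw [hvol] at hmono
  have hlow : ∫ x in closedBall (0 : R2) R, (pd 0 z x ^ 2 + pd 1 z x ^ 2) ≤
      ∫ x, c x ^ 2 * (pd 0 z x ^ 2 + pd 1 z x ^ 2) := by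
    rw [← integral_indicator measurableSet_closedBall]
    refine integral_mono_of_nonneg (Eventually.of_forall fun x => ?_) hint1
      (Eventually.of_forall fun x => ?_)
    · exact indicator_nonneg (fun _ _ => by positivity) x
    · by_cases hx : x ∈ closedBall (0 : R2) R
      · have : c x = 1 := cutoff_eq_one hR2 (by simpa using hx)
        simp [indicator_of_mem hx, this]
      · rw [indicator_of_notMem hx]; positivity
  have h5 : (2 * R) ^ 2 * V * (S ^ 2 * (A / R) ^ 2) = 4 * A ^ 2 * V * S ^ 2 := by
    field_simp; ring
  rw [h5] at hmono
  nlinarith [sq_nonneg S]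

lemma HasCompactSupport.lap {f : R2 → ℝ} (hc : HasCompactSupport f) :
    HasCompactSupport (_root_.lap f) := by
  have : _root_.lap f = fun x => _root_.pd 0 (_root_.pd 0 f) x + _root_.pd 1 (_root_.pd 1 f) x :=
    funext fun x => lap_eq f x
  rw [this]
  exact hc.pd.pd.add hc.pd.pd

lemma lap_eq_of_ne {i j : Fin 2} (hij : i ≠ j) (u : R2 → ℝ) (x : R2) :
    lap u x = pd i (pd i u) x + pd j (pd j u) x := by
  rw [lap_eq]
  fin_cases i <;> fin_cases j <;> simp_all [add_comm]

/-- Real part of the Hopf differential. -/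
def hopfRe (i j : Fin 2) (z : R2 → ℝ) (x : R2) : ℝ :=
  pd i (pd i z) x - pd j (pd j z) x - 1 / 2 * (pd i z x ^ 2 - pd j z x ^ 2)

/-- Imaginary part of the Hopf differential. -/
def hopfIm (i j : Fin 2) (z : R2 → ℝ) (x : R2) : ℝ :=
  2 * pd i (pd j z) x - pd i z x * pd j z x

lemma continuous_hopfRe {i j : Fin 2} {z : R2 → ℝ} (hz : ContDiff ℝ 2 z) :
    Continuous (hopfRe i j z) := by
  have h : ∀ i, Continuous (pd i z) := fun i => (hz.of_le (by norm_num)).continuous_pd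
  have h2 : ∀ i j, Continuous (pd i (pd j z)) := fun i j => hz.pd_one.continuous_pd
  have := h i; have := h j; have := h2 i i; have := h2 j j
  unfold hopfRe
  fun_prop

lemma continuous_hopfIm {i j : Fin 2} {z : R2 → ℝ} (hz : ContDiff ℝ 2 z) :
    Continuous (hopfIm i j z) := by
  have h : ∀ i, Continuous (pd i z) := fun i => (hz.of_le (by norm_num)).continuous_pd
  have h2 : ∀ i j, Continuous (pd i (pd j z)) := fun i j => hz.pd_one.continuous_pd
  have := h i; have := h j; have := h2 i j
  unfold hopfIm
  fun_prop

/-- The Hopf differential of a solution of the Liouville equation satisfies the Cauchy–Riemann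
equations in the weak sense. -/
lemma integral_hopf_mul_pd {i j : Fin 2} (hij : i ≠ j) {z ψ : R2 → ℝ} (hz : ContDiff ℝ 2 z)
    (hl : ∀ x, lap z x = -Real.exp (z x)) (hψ : ContDiff ℝ 2 ψ) (hc : HasCompactSupport ψ) :
    ∫ x, (hopfRe i j z x * pd i ψ x + hopfIm i j z x * pd j ψ x) = 0 := by
  have hz1 : ContDiff ℝ 1 z := hz.of_le (by norm_num)
  have hψ1 : ContDiff ℝ 1 ψ := hψ.of_le (by norm_num)
  have hzi : ContDiff ℝ 1 (pd i z) := hz.pd_one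
  have hzj : ContDiff ℝ 1 (pd j z) := hz.pd_one
  have hψi : ContDiff ℝ 1 (pd i ψ) := hψ.pd_one
  have hψj : ContDiff ℝ 1 (pd j ψ) := hψ.pd_one
  have hez : ContDiff ℝ 1 (fun x => Real.exp (z x)) := Real.contDiff_exp.comp hz1
  set a : R2 → ℝ := fun x => pd j ψ x * (2 * pd j z x) + ψ x * (-Real.exp (z x) -
    1 / 2 * (pd i z x * pd i z x - pd j z x * pd j z x)) with ha
  set b : R2 → ℝ := fun x => pd i ψ x * (-2 * pd j z x) + ψ x * (-(pd i z x * pd j z x)) with hb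
  have hac : ContDiff ℝ 1 a := by fun_prop
  have hbc : ContDiff ℝ 1 b := by fun_prop
  have hacs : HasCompactSupport a := hc.pd.mul_right.add hc.mul_right
  have hbcs : HasCompactSupport b := hc.pd.mul_right.add hc.mul_right
  have d1 : ∀ {f : R2 → ℝ}, ContDiff ℝ 1 f → ∀ x, DifferentiableAt ℝ f x := fun hf =>
    hf.differentiable (by norm_num)
  have hpt : ∀ x, hopfRe i j z x * pd i ψ x + hopfIm i j z x * pd j ψ x =
      pd i a x + pd j b x := by
    intro x
    have h0 := d1 hz1 x; have h1 := d1 hzi x; have h2 := d1 hzj x; have h3 := d1 hψ1 x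
    have h4 := d1 hψi x; have h5 := d1 hψj x; have h6 := d1 hez x
    have e6 : pd i (fun x => Real.exp (z x)) x = Real.exp (z x) * pd i z x :=
      (Real.hasDerivAt_exp (z x)).pd_comp h0
    rw [ha, hb]
    rw [pd_add (by fun_prop) (by fun_prop), pd_mul h5 (by fun_prop), pd_const_mul h2,
      pd_mul h3 (by fun_prop), pd_sub (by fun_prop) (by fun_prop), pd_neg, e6,
      pd_const_mul (by fun_prop), pd_sub (by fun_prop) (by fun_prop), pd_mul h1 h1, pd_mul h2 h2,
      pd_add (by fun_prop) (by fun_prop), pd_mul h4 (by fun_prop), pd_const_mul h2,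
      pd_mul h3 (by fun_prop), pd_neg, pd_mul h1 h2, pd_comm (i := j) (j := i) hψ.contDiffAt,
      pd_comm (i := j) (j := i) hz.contDiffAt]
    have he : Real.exp (z x) = -(pd i (pd i z) x + pd j (pd j z) x) := by
      rw [← lap_eq_of_ne hij, hl, neg_neg]
    rw [he, hopfRe, hopfIm]
    ring
  simp only [hpt]
  rw [integral_add (hac.continuous_pd.integrable_of_hasCompactSupport hacs.pd)
    (hbc.continuous_pd.integrable_of_hasCompactSupport hbcs.pd),
    integral_pd_eq_zero hac hacs, integral_pd_eq_zero hbc hbcs, add_zero]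

lemma hopf_pair_integrable {i j k l : Fin 2} {z ψ : R2 → ℝ} (hz : ContDiff ℝ 2 z)
    (hψ : ContDiff ℝ 1 ψ) (hc : HasCompactSupport ψ) :
    Integrable fun x => hopfRe i j z x * pd k ψ x + hopfIm i j z x * pd l ψ x :=
  (((continuous_hopfRe hz).mul hψ.continuous_pd).integrable_of_hasCompactSupport
    hc.pd.mul_left).add
  (((continuous_hopfIm hz).mul hψ.continuous_pd).integrable_of_hasCompactSupport hc.pd.mul_left)

lemma hopfRe_swap (i j : Fin 2) (z : R2 → ℝ) (x : R2) : hopfRe j i z x = -hopfRe i j z x := by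
  unfold hopfRe; ring

lemma hopfIm_swap {i j : Fin 2} {z : R2 → ℝ} (hz : ContDiff ℝ 2 z) (x : R2) :
    hopfIm j i z x = hopfIm i j z x := by
  unfold hopfIm; rw [pd_comm hz.contDiffAt]; ring

lemma integral_hopfRe_mul_lap {z Ψ : R2 → ℝ} (hz : ContDiff ℝ 2 z)
    (hl : ∀ x, lap z x = -Real.exp (z x)) (hΨ : ContDiff ℝ 3 Ψ) (hc : HasCompactSupport Ψ) :
    ∫ x, hopfRe 0 1 z x * lap Ψ x = 0 := by
  have h0 : ∀ k, ContDiff ℝ 2 (pd k Ψ) := fun k => hΨ.pd (by norm_num)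
  have e1 := integral_hopf_mul_pd (i := 0) (j := 1) (by decide) hz hl (h0 0) hc.pd
  have e2 := integral_hopf_mul_pd (i := 1) (j := 0) (by decide) hz hl (h0 1) hc.pd
  have e3 := integral_sub (hopf_pair_integrable (i := 0) (j := 1) (k := 0) (l := 1) hz
    ((h0 0).of_le (by norm_num)) hc.pd) (hopf_pair_integrable (i := 1) (j := 0) (k := 1) (l := 0)
    hz ((h0 1).of_le (by norm_num)) hc.pd)
  rw [e1, e2, sub_zero] at e3
  rw [← e3]
  refine integral_congr_ae (Eventually.of_forall fun x => ?_)
  simp only [hopfRe_swap 0 1, hopfIm_swap (i := 0) (j := 1) hz, lap_eq,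
    pd_comm (i := 1) (j := 0) (hΨ.of_le (by norm_num)).contDiffAt]
  ring

lemma integral_hopfIm_mul_lap {z Ψ : R2 → ℝ} (hz : ContDiff ℝ 2 z)
    (hl : ∀ x, lap z x = -Real.exp (z x)) (hΨ : ContDiff ℝ 3 Ψ) (hc : HasCompactSupport Ψ) :
    ∫ x, hopfIm 0 1 z x * lap Ψ x = 0 := by
  have h0 : ∀ k, ContDiff ℝ 2 (pd k Ψ) := fun k => hΨ.pd (by norm_num)
  have e1 := integral_hopf_mul_pd (i := 0) (j := 1) (by decide) hz hl (h0 1) hc.pd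
  have e2 := integral_hopf_mul_pd (i := 1) (j := 0) (by decide) hz hl (h0 0) hc.pd
  have e3 := integral_add (hopf_pair_integrable (i := 0) (j := 1) (k := 0) (l := 1) hz
    ((h0 1).of_le (by norm_num)) hc.pd) (hopf_pair_integrable (i := 1) (j := 0) (k := 1) (l := 0)
    hz ((h0 0).of_le (by norm_num)) hc.pd)
  rw [e1, e2, add_zero] at e3
  rw [← e3]
  refine integral_congr_ae (Eventually.of_forall fun x => ?_)
  simp only [hopfRe_swap 0 1, hopfIm_swap (i := 0) (j := 1) hz, lap_eq,
    pd_comm (i := 1) (j := 0) (hΨ.of_le (by norm_num)).contDiffAt]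
  ring

lemma lap_avgPotential (y : R2) : lap avgPotential y =
    -2 * avgProfile (‖y‖ ^ 2) - 2 * ‖y‖ ^ 2 * deriv avgProfile (‖y‖ ^ 2) := by
  have h0 : ∀ i, pd i avgPotential = fun y => -(y i * avgKernel y) := fun i =>
    funext fun y => pd_avgPotential i y
  have hk : ∀ i, pd i avgKernel y = deriv avgProfile (‖y‖ ^ 2) * (2 * y i) := by
    intro i
    have hd : DifferentiableAt ℝ (fun y : R2 => ‖y‖ ^ 2) y :=
      (contDiff_norm_sq ℝ (n := 1)).differentiable (by norm_num) y
    have h2 : pd i (fun y : R2 => ‖y‖ ^ 2) y = 2 * y i := by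
      simp only [pd, (hasStrictFDerivAt_norm_sq y).hasFDerivAt.fderiv]
      simp [EuclideanSpace.inner_single_right]
    have h := HasDerivAt.pd_comp (i := i) (u := fun y : R2 => ‖y‖ ^ 2) (f := avgProfile)
      ((contDiff_avgProfile (n := 1)).differentiable (by norm_num) _).hasDerivAt hd
    rw [h2] at h
    exact h
  have h1 : ∀ i, pd i (pd i avgPotential) y =
      -(avgProfile (‖y‖ ^ 2) + y i * (deriv avgProfile (‖y‖ ^ 2) * (2 * y i))) := by
    intro i
    rw [h0, pd_neg, pd_mul (differentiable_coord i y)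
      ((contDiff_avgKernel (n := 1)).differentiable (by norm_num) y), pd_coord, hk]
    simp [avgKernel]
  rw [lap_eq, h1, h1]
  have : ‖y‖ ^ 2 = y 0 ^ 2 + y 1 ^ 2 := by simp [EuclideanSpace.norm_sq_eq]
  nth_rewrite 6 [this]
  ring

lemma hasDerivAt_scaled_avgKernel (ξ : R2) {s : ℝ} (hs : 0 < s) :
    HasDerivAt (fun s => (s ^ 2)⁻¹ * avgKernel (s⁻¹ • ξ))
      ((s ^ 3)⁻¹ * lap avgPotential (s⁻¹ • ξ)) s := by
  have h0 : ∀ a : ℝ, ‖a • ξ‖ ^ 2 = a ^ 2 * ‖ξ‖ ^ 2 := fun a => by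
    rw [norm_smul, mul_pow, Real.norm_eq_abs, sq_abs]
  have h1 : HasDerivAt (fun a : ℝ => a ^ 2 * avgProfile (a ^ 2 * ‖ξ‖ ^ 2))
      (2 * s⁻¹ * avgProfile ((s⁻¹) ^ 2 * ‖ξ‖ ^ 2) +
        (s⁻¹) ^ 2 * (deriv avgProfile ((s⁻¹) ^ 2 * ‖ξ‖ ^ 2) * (2 * s⁻¹ * ‖ξ‖ ^ 2))) s⁻¹ := by
    have e : HasDerivAt (fun a : ℝ => a ^ 2) (2 * s⁻¹) s⁻¹ := by
      simpa using hasDerivAt_pow 2 s⁻¹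
    have e2 : HasDerivAt (fun a : ℝ => avgProfile (a ^ 2 * ‖ξ‖ ^ 2)) _ s⁻¹ :=
      HasDerivAt.comp s⁻¹ (h₂ := avgProfile) (h := fun a : ℝ => a ^ 2 * ‖ξ‖ ^ 2)
        ((contDiff_avgProfile (n := 1)).differentiable (by norm_num) _).hasDerivAt
        (e.mul_const (‖ξ‖ ^ 2))
    exact e.mul e2
  have h2 := HasDerivAt.comp s h1 (hasDerivAt_inv hs.ne')
  have h3 : (fun s : ℝ => (s ^ 2)⁻¹ * avgKernel (s⁻¹ • ξ)) =
      (fun a : ℝ => a ^ 2 * avgProfile (a ^ 2 * ‖ξ‖ ^ 2)) ∘ fun s => s⁻¹ := by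
    funext r
    simp only [avgKernel, h0, Function.comp, inv_pow]
  rw [h3]
  refine h2.congr_deriv ?_
  rw [lap_avgPotential, h0]
  field_simp
  ring

lemma continuous_wavg {T : R2 → ℝ} (hT : Continuous T) (x : R2) : Continuous (wavg T x) := by
  have h : wavg T x = fun t => ∫ η in closedBall (0 : R2) 1, avgKernel η * T (t • η + x) := by
    funext t
    rw [wavg, ← setIntegral_eq_integral_of_forall_compl_eq_zero (s := closedBall (0 : R2) 1)]
    intro η hη
    rw [avgKernel_eq_zero (by simp at hη; exact hη.le), zero_mul]
  rw [h]
  have := continuous_avgKernel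
  exact continuous_parametric_integral_of_continuous (f := fun t η => avgKernel η * T (t • η + x))
    (by fun_prop) (isCompact_closedBall _ _)

/-- Mean value property of continuous weakly harmonic functions. -/
lemma wavg_eq_of_weakly_harmonic {T : R2 → ℝ} (hT : Continuous T)
    (h : ∀ Ψ : R2 → ℝ, ContDiff ℝ 3 Ψ → HasCompactSupport Ψ → ∫ x, T x * lap Ψ x = 0)
    {R : ℝ} (hR : 0 < R) : wavg T 0 R = kernelMass * T 0 := by
  have hΦ2 : ContDiff ℝ 2 avgPotential := contDiff_avgPotential.of_le (by norm_cast)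
  have hΦ3 : ContDiff ℝ 3 avgPotential := contDiff_avgPotential.of_le (by norm_cast)
  obtain ⟨B, hB⟩ := hΦ2.continuous_lap.bounded_above_of_compact_support
    hasCompactSupport_avgPotential.lap
  have hB0 : 0 ≤ B := (norm_nonneg _).trans (hB 0)
  have hlap0 : ∀ y : R2, 1 < ‖y‖ → lap avgPotential y = 0 := by
    intro y hy
    have : avgPotential =ᶠ[𝓝 y] fun _ => 0 := by
      filter_upwards [(isOpen_lt continuous_const continuous_norm).mem_nhds hy] with w hw
        using avgPotential_eq_zero (le_of_lt hw)
    rw [this.lap_eq, lap_const]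
  set G : ℝ → ℝ := fun s => ∫ ξ, (s ^ 2)⁻¹ * avgKernel (s⁻¹ • ξ) * T ξ
  have hGw : ∀ s, 0 < s → G s = wavg T 0 s := by
    intro s hs
    have := wavg_eq_integral T 0 hs
    simp only [sub_zero] at this
    have h2 : wavg T 0 s = (s ^ 2)⁻¹ * ∫ ξ, avgKernel (s⁻¹ • ξ) * T ξ := by
      rw [← this]; field_simp
    rw [h2, ← integral_const_mul]
    simp only [G, mul_assoc]
  have hcK : ∀ s : ℝ, Continuous fun ξ : R2 => avgKernel (s⁻¹ • ξ) := fun s =>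
    continuous_avgKernel.comp (by fun_prop)
  have hcs : ∀ s : ℝ, 0 < s → HasCompactSupport fun ξ : R2 => avgKernel (s⁻¹ • ξ) := fun s hs => by
    simpa only [sub_zero] using hasCompactSupport_avgKernel_comp 0 hs
  have hderiv : ∀ s, 0 < s → HasDerivAt G 0 s := by
    intro s hs
    have hball : ∀ r ∈ ball s (s / 2), s / 2 < r ∧ r < 2 * s := by
      intro r hr
      rw [mem_ball, Real.dist_eq, abs_lt] at hr
      constructor <;> linarith [hr.1, hr.2]
    have hmain := hasDerivAt_integral_of_dominated_loc_of_deriv_le (μ := (volume : Measure R2))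
      (F := fun s ξ => (s ^ 2)⁻¹ * avgKernel (s⁻¹ • ξ) * T ξ)
      (F' := fun s ξ => (s ^ 3)⁻¹ * lap avgPotential (s⁻¹ • ξ) * T ξ) (x₀ := s)
      (s := ball s (s / 2))
      (bound := indicator (closedBall (0 : R2) (2 * s)) fun ξ => ((s / 2) ^ 3)⁻¹ * B * |T ξ|)
      (ball_mem_nhds s (by positivity))
      (Eventually.of_forall fun r =>
        (((continuous_const).mul (hcK r)).mul hT).aestronglyMeasurable)
      ((((continuous_const).mul (hcK s)).mul hT).integrable_of_hasCompactSupport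
        ((hcs s hs).mul_left.mul_right))
      ((((continuous_const).mul (hΦ2.continuous_lap.comp (by fun_prop))).mul
        hT).aestronglyMeasurable)
      (Eventually.of_forall fun ξ r hr => by
        obtain ⟨h1, h2⟩ := hball r hr
        have hr0 : 0 < r := by linarith
        by_cases hξ : ξ ∈ closedBall (0 : R2) (2 * s)
        · rw [indicator_of_mem hξ, norm_mul, norm_mul]
          refine mul_le_mul_of_nonneg_right (mul_le_mul ?_ (hB _) (norm_nonneg _) (by positivity))
            (norm_nonneg _)
          rw [Real.norm_of_nonneg (by positivity)]
          gcongr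
        · rw [hlap0, mul_zero, zero_mul, norm_zero]
          · exact indicator_nonneg (fun _ _ => by positivity) _
          · rw [norm_smul, norm_inv, Real.norm_of_nonneg hr0.le, inv_mul_eq_div, one_lt_div hr0]
            simp at hξ
            linarith)
      ((integrable_indicator_iff measurableSet_closedBall).2
        ((continuous_const.mul hT.abs).continuousOn.integrableOn_compact (isCompact_closedBall _ _)))
      (Eventually.of_forall fun ξ r hr =>
        (hasDerivAt_scaled_avgKernel ξ (by linarith [(hball r hr).1])).mul_const _)
    refine hmain.2.congr_deriv ?_
    have hd := h (fun ξ => s⁻¹ * avgPotential (s⁻¹ • ξ + 0))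
      (contDiff_const.mul (hΦ3.comp (by fun_prop)))
      (HasCompactSupport.mul_left (by
        refine HasCompactSupport.intro (isCompact_closedBall (0 : R2) s) fun y hy => ?_
        apply avgPotential_eq_zero
        simp at hy
        rw [add_zero, norm_smul, norm_inv, Real.norm_of_nonneg hs.le, inv_mul_eq_div,
          one_le_div hs]
        exact hy.le))
    rw [← hd]
    refine integral_congr_ae (Eventually.of_forall fun ξ => ?_)
    simp only
    rw [lap_const_mul (u := fun ξ => avgPotential (s⁻¹ • ξ + 0)) (by
      exact (hΦ2.comp (by fun_prop)).contDiffAt), lap_comp_affine hΦ2.contDiffAt, add_zero]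
    field_simp
  have hconst : ∀ s, 0 < s → G s = G R := by
    intro s hs
    have := (convex_Ioi (0 : ℝ)).is_const_of_fderivWithin_eq_zero (𝕜 := ℝ) (f := G)
      (fun r hr => (hderiv r hr).differentiableAt.differentiableWithinAt) (fun r hr => by
        have := ((hderiv r hr).hasFDerivAt.hasFDerivWithinAt (s := Ioi 0)).fderivWithin
          (isOpen_Ioi.uniqueDiffWithinAt hr)
        rw [this]; ext; simp) (mem_Ioi.2 hs) (mem_Ioi.2 hR)
    exact this
  have hlim : Tendsto (wavg T 0) (𝓝[>] 0) (𝓝 (kernelMass * T 0)) := by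
    rw [← wavg_zero]
    exact ((continuous_wavg hT 0).tendsto 0).mono_left nhdsWithin_le_nhds
  have hlim2 : Tendsto (wavg T 0) (𝓝[>] 0) (𝓝 (wavg T 0 R)) := by
    refine tendsto_const_nhds.congr' ?_
    filter_upwards [self_mem_nhdsWithin] with s hs
    rw [← hGw s hs, ← hGw R hR, hconst s hs]
  exact tendsto_nhds_unique hlim2 hlim

lemma IsLiouvilleSol.lap_nonpos {z : R2 → ℝ} (hz : IsLiouvilleSol z) (x : R2) : lap z x ≤ 0 := by
  rw [hz.lap_eq]; linarith [Real.exp_pos (z x)]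

lemma IsLiouvilleSol.exists_gradient_growth {z : R2 → ℝ} (hz : IsLiouvilleSol z) :
    ∃ C, 0 ≤ C ∧ ∀ R, 1 ≤ R →
      ∫ x in closedBall (0 : R2) R, (pd 0 z x ^ 2 + pd 1 z x ^ 2) ≤ C * R := by
  obtain ⟨C, hC, h⟩ := hz.exists_growth
  obtain ⟨C', hC', h'⟩ := exists_caccioppoli
  refine ⟨C' * C ^ 2 * 34, by positivity, fun R hR => ?_⟩
  have h1 := h' z hz.contDiff hz.nonpos hz.lap_nonpos R (C * (3 + Real.log (2 * R)))
    (by linarith) (h (2 * R) (by linarith))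
  have h2 : Real.log (2 * R) ≤ 2 * √(2 * R) := by
    have e := Real.log_sqrt (x := 2 * R) (by linarith)
    have := Real.log_le_sub_one_of_pos (x := √(2 * R)) (Real.sqrt_pos.2 (by linarith))
    linarith
  have h3 : 0 ≤ Real.log (2 * R) := Real.log_nonneg (by linarith)
  have h4 : (3 + Real.log (2 * R)) ^ 2 ≤ 34 * R := by
    have e1 : (3 + Real.log (2 * R)) ^ 2 ≤ (3 + 2 * √(2 * R)) ^ 2 :=
      pow_le_pow_left₀ (by linarith) (by linarith) 2
    have e2 : √(2 * R) ^ 2 = 2 * R := Real.sq_sqrt (by linarith)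
    nlinarith [sq_nonneg (3 - 2 * √(2 * R))]
  calc _ ≤ _ := h1
    _ = C' * C ^ 2 * (3 + Real.log (2 * R)) ^ 2 := by ring
    _ ≤ C' * C ^ 2 * (34 * R) := mul_le_mul_of_nonneg_left h4 (by positivity)
    _ = _ := by ring

lemma integral_cutoff_eq_wavg (T : R2 → ℝ) {R : ℝ} (hR : 0 < R) :
    ∫ x, cutoff R x * T x = R ^ 2 * wavg T 0 R := by
  rw [wavg_eq_integral T 0 hR]
  simp [cutoff]

lemma abs_integral_le_of_support {f g : R2 → ℝ} {R : ℝ} (hg : Continuous g)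
    (h0 : ∀ x ∉ closedBall (0 : R2) R, f x = 0) (h1 : ∀ x ∈ closedBall (0 : R2) R, |f x| ≤ g x) :
    |∫ x, f x| ≤ ∫ x in closedBall (0 : R2) R, g x := by
  rw [← setIntegral_eq_integral_of_forall_compl_eq_zero h0]
  have hgi : IntegrableOn g (closedBall (0 : R2) R) volume :=
    hg.continuousOn.integrableOn_compact (isCompact_closedBall _ _)
  refine norm_integral_le_of_norm_le (f := f) (μ := volume.restrict (closedBall (0 : R2) R)) hgi ?_
  filter_upwards [ae_restrict_mem measurableSet_closedBall] with x hx using h1 x hx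

lemma exists_abs_integral_cutoff_le : ∃ C : ℝ, 0 < C ∧ ∀ z : R2 → ℝ, ContDiff ℝ 2 z →
    ∀ E R : ℝ, 1 ≤ R → ∫ x in closedBall (0 : R2) R, (pd 0 z x ^ 2 + pd 1 z x ^ 2) ≤ E →
    (∀ k l, |∫ x, cutoff R x * pd k (pd l z) x| ≤ C * (R + E)) ∧
    ∀ k l, |∫ x, cutoff R x * (pd k z x * pd l z x)| ≤ C * (R + E) := by
  obtain ⟨A, hA, hAk⟩ := exists_pd_avgKernel_le
  set V : ℝ := volume.real (closedBall (0 : R2) 1)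
  have hV : 0 ≤ V := measureReal_nonneg
  refine ⟨A * V + A + 1, by positivity, ?_⟩
  intro z hz E R hR hE
  have hR0 : 0 < R := by linarith
  have hz1 : ContDiff ℝ 1 z := hz.of_le (by norm_num)
  have hp : ∀ i, Continuous (pd i z) := fun i => hz1.continuous_pd
  have hp0 := hp 0; have hp1 := hp 1
  have hgc : Continuous fun x => pd 0 z x ^ 2 + pd 1 z x ^ 2 := by fun_prop
  have hE0 : 0 ≤ E := (integral_nonneg fun x => by positivity).trans hE
  have hle : ∀ l x, pd l z x ^ 2 ≤ pd 0 z x ^ 2 + pd 1 z x ^ 2 := by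
    intro l x
    fin_cases l
    · simpa using sq_nonneg (pd 1 z x)
    · simpa using sq_nonneg (pd 0 z x)
  have hvol : volume.real (closedBall (0 : R2) R) = R ^ 2 * V := by
    rw [measureReal_def, Measure.addHaar_closedBall' _ _ hR0.le]
    simp [V, measureReal_def, ENNReal.toReal_ofReal (by positivity : (0:ℝ) ≤ R ^ 2)]
  have hfin : IsFiniteMeasure (volume.restrict (closedBall (0 : R2) R)) :=
    ⟨by rw [Measure.restrict_apply_univ]; exact (isCompact_closedBall (0 : R2) R).measure_lt_top⟩
  constructor
  · intro k l
    have h1 := integral_pd_mul (i := k) (f := cutoff R) (g := pd l z) (contDiff_cutoff R)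
      hz.pd_one (hasCompactSupport_cutoff hR0)
    have h2 : |∫ x, pd k (cutoff R) x * pd l z x| ≤
        ∫ x in closedBall (0 : R2) R, R⁻¹ * A * (1 + (pd 0 z x ^ 2 + pd 1 z x ^ 2)) := by
      refine abs_integral_le_of_support (by fun_prop)
        (fun x hx => by rw [pd_cutoff_eq_zero hR0 hx, zero_mul]) fun x _ => ?_
      rw [abs_mul, pd_cutoff, abs_mul, abs_inv, abs_of_pos hR0]
      refine mul_le_mul (mul_le_mul_of_nonneg_left (hAk _ _) (by positivity)) ?_ (abs_nonneg _)
        (by positivity)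
      have := hle l x
      rw [← sq_abs] at this
      nlinarith [sq_nonneg (|pd l z x| - 1), abs_nonneg (pd l z x)]
    rw [integral_const_mul, integral_add (integrable_const _)
      (hgc.continuousOn.integrableOn_compact (isCompact_closedBall _ _)), setIntegral_const,
      hvol, smul_eq_mul, mul_one] at h2
    have h3 : ∫ x, cutoff R x * pd k (pd l z) x = -∫ x, pd k (cutoff R) x * pd l z x := by
      rw [h1, neg_neg]
    rw [h3, abs_neg]
    calc _ ≤ _ := h2
      _ ≤ R⁻¹ * A * (R ^ 2 * V + E) := by gcongr
      _ = A * V * R + R⁻¹ * (A * E) := by field_simp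
      _ ≤ A * V * R + 1 * (A * E) := by
        gcongr; exact inv_le_one_of_one_le₀ hR
      _ ≤ _ := by nlinarith [mul_nonneg hA.le hV, mul_nonneg (mul_nonneg hA.le hV) hE0,
          mul_nonneg hA.le hR0.le]
  · intro k l
    have h2 : |∫ x, cutoff R x * (pd k z x * pd l z x)| ≤
        ∫ x in closedBall (0 : R2) R, (pd 0 z x ^ 2 + pd 1 z x ^ 2) := by
      refine abs_integral_le_of_support hgc
        (fun x hx => by rw [cutoff_eq_zero hR0 hx, zero_mul]) fun x _ => ?_
      rw [abs_mul, abs_of_nonneg (cutoff_nonneg R x)]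
      refine (mul_le_of_le_one_left (abs_nonneg _) (cutoff_le_one R x)).trans ?_
      rw [abs_mul]
      have h1 := hle k x
      have h2 := hle l x
      rw [← sq_abs] at h1 h2
      nlinarith [sq_nonneg (|pd k z x| - |pd l z x|)]
    calc _ ≤ _ := h2
      _ ≤ E := hE
      _ ≤ _ := by nlinarith [mul_nonneg hA.le hV, mul_nonneg (mul_nonneg hA.le hV) hE0,
          mul_nonneg hA.le hR0.le, mul_nonneg (mul_nonneg hA.le hV) hR0.le, mul_nonneg hA.le hE0]

lemma eq_zero_of_abs_integral_cutoff_le {T : R2 → ℝ} (hT : Continuous T)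
    (h : ∀ Ψ : R2 → ℝ, ContDiff ℝ 3 Ψ → HasCompactSupport Ψ → ∫ x, T x * lap Ψ x = 0)
    {C : ℝ} (hC : ∀ R, 1 ≤ R → |∫ x, cutoff R x * T x| ≤ C * R) : T 0 = 0 := by
  have hk := kernelMass_pos
  have hlim : Tendsto (fun R : ℝ => C / (kernelMass * R)) atTop (𝓝 0) :=
    (tendsto_const_nhds (x := C)).div_atTop (tendsto_id.const_mul_atTop hk)
  have hle : |T 0| ≤ 0 := by
    refine ge_of_tendsto hlim ?_
    filter_upwards [eventually_ge_atTop 1] with R hR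
    have hR0 : 0 < R := by linarith
    have h1 := hC R hR
    rw [integral_cutoff_eq_wavg T hR0, wavg_eq_of_weakly_harmonic hT h hR0, abs_mul, abs_mul,
      abs_of_pos hk, abs_of_nonneg (sq_nonneg R)] at h1
    rw [le_div_iff₀ (by positivity)]
    nlinarith
  exact abs_nonpos_iff.1 hle

lemma integrable_cutoff_mul {T : R2 → ℝ} (hT : Continuous T) {R : ℝ} (hR : 0 < R) :
    Integrable fun x => cutoff R x * T x :=
  ((contDiff_cutoff R (n := 0)).continuous.mul hT).integrable_of_hasCompactSupport
    (hasCompactSupport_cutoff hR).mul_right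

lemma IsLiouvilleSol.hopf_eq_zero_at_zero {z : R2 → ℝ} (hz : IsLiouvilleSol z) :
    hopfRe 0 1 z 0 = 0 ∧ hopfIm 0 1 z 0 = 0 := by
  obtain ⟨C, hC, hCz⟩ := hz.exists_gradient_growth
  obtain ⟨A, hA, hAz⟩ := exists_abs_integral_cutoff_le
  have hz2 := hz.contDiff
  have hp : ∀ i, Continuous (pd i z) := fun i => (hz2.of_le (by norm_num)).continuous_pd
  have hpp : ∀ i j, Continuous (pd i (pd j z)) := fun i j => hz2.pd_one.continuous_pd
  constructor
  · refine eq_zero_of_abs_integral_cutoff_le (C := 3 * (A * (1 + C))) (continuous_hopfRe hz2)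
      (fun Ψ h1 h2 => integral_hopfRe_mul_lap hz2 hz.lap_eq h1 h2) fun R hR => ?_
    have hR0 : 0 < R := by linarith
    obtain ⟨h1, h2⟩ := hAz z hz2 _ R hR (hCz R hR)
    have i1 := fun k l => integrable_cutoff_mul (hpp k l) hR0
    have i2 : ∀ k l, Integrable fun x => cutoff R x * (pd k z x * pd l z x) :=
      fun k l => integrable_cutoff_mul ((hp k).mul (hp l)) hR0
    have e : ∫ x, cutoff R x * hopfRe 0 1 z x =
        (∫ x, cutoff R x * pd 0 (pd 0 z) x) - (∫ x, cutoff R x * pd 1 (pd 1 z) x) -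
        (1 / 2 * (∫ x, cutoff R x * (pd 0 z x * pd 0 z x)) -
          1 / 2 * ∫ x, cutoff R x * (pd 1 z x * pd 1 z x)) := by
      have i3 : Integrable fun x => cutoff R x * pd 0 (pd 0 z) x - cutoff R x * pd 1 (pd 1 z) x :=
        (i1 0 0).sub (i1 1 1)
      have i4 : Integrable fun x => 1 / 2 * (cutoff R x * (pd 0 z x * pd 0 z x)) -
          1 / 2 * (cutoff R x * (pd 1 z x * pd 1 z x)) :=
        ((i2 0 0).const_mul _).sub ((i2 1 1).const_mul _)
      rw [← integral_sub (i1 0 0) (i1 1 1), ← integral_const_mul, ← integral_const_mul,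
        ← integral_sub ((i2 0 0).const_mul _) ((i2 1 1).const_mul _),
        ← integral_sub i3 i4]
      refine integral_congr_ae (Eventually.of_forall fun x => ?_)
      simp only [hopfRe]; ring
    rw [e]
    have a1 := h1 0 0; have a2 := h1 1 1; have a3 := h2 0 0; have a4 := h2 1 1
    rw [abs_le] at *
    constructor <;> nlinarith
  · refine eq_zero_of_abs_integral_cutoff_le (C := 3 * (A * (1 + C))) (continuous_hopfIm hz2)
      (fun Ψ h1 h2 => integral_hopfIm_mul_lap hz2 hz.lap_eq h1 h2) fun R hR => ?_
    have hR0 : 0 < R := by linarith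
    obtain ⟨h1, h2⟩ := hAz z hz2 _ R hR (hCz R hR)
    have i1 := fun k l => integrable_cutoff_mul (hpp k l) hR0
    have i2 : ∀ k l, Integrable fun x => cutoff R x * (pd k z x * pd l z x) :=
      fun k l => integrable_cutoff_mul ((hp k).mul (hp l)) hR0
    have e : ∫ x, cutoff R x * hopfIm 0 1 z x =
        2 * (∫ x, cutoff R x * pd 0 (pd 1 z) x) - ∫ x, cutoff R x * (pd 0 z x * pd 1 z x) := by
      rw [← integral_const_mul, ← integral_sub ((i1 0 1).const_mul _) (i2 0 1)]
      refine integral_congr_ae (Eventually.of_forall fun x => ?_)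
      simp only [hopfIm]; ring
    rw [e]
    have a1 := h1 0 1; have a3 := h2 0 1
    rw [abs_le] at *
    constructor <;> nlinarith

lemma IsLiouvilleSol.hopf_eq_zero {z : R2 → ℝ} (hz : IsLiouvilleSol z) (c : R2) :
    hopfRe 0 1 z c = 0 ∧ hopfIm 0 1 z c = 0 := by
  have h := (hz.translate c).hopf_eq_zero_at_zero
  have h1 : ∀ k, pd k (fun x => z ((1 : ℝ) • x + c)) = fun x => pd k z ((1 : ℝ) • x + c) := by
    intro k; funext x
    rw [pd_comp_affine (hz.contDiff.differentiable (by norm_num) _), one_mul]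
  have h2 : ∀ k l, pd k (pd l (fun x => z ((1 : ℝ) • x + c))) 0 = pd k (pd l z) c := by
    intro k l
    rw [h1, pd_comp_affine (hz.contDiff.pd_one.differentiable (by norm_num) _)]
    simp
  have h3 : ∀ k, pd k (fun x => z ((1 : ℝ) • x + c)) 0 = pd k z c := by
    intro k; rw [h1]; simp
  simpa only [hopfRe, hopfIm, h2, h3] using h

lemma eq_of_pd_eq_zero {f : R2 → ℝ} (hf : Differentiable ℝ f) (h0 : ∀ i x, pd i f x = 0) (x y : R2) :
    f x = f y := by
  refine is_const_of_fderiv_eq_zero (𝕜 := ℝ) hf (fun x => ?_) x y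
  ext v
  rw [fderiv_apply_eq, h0, h0]; simp

/-- Classification of the entire solutions of the Liouville equation of finite mass having a
maximum at the origin. -/
theorem IsLiouvilleSol.eq_bubble {z : R2 → ℝ} (hz : IsLiouvilleSol z) (hmax : ∀ x, z x ≤ z 0) :
    z = bubble (Real.exp (z 0)) := by
  have hz2 := hz.contDiff
  set v : R2 → ℝ := fun x => Real.exp (-(1 / 2) * z x) with hv
  have hv2 : ContDiff ℝ 2 v := Real.contDiff_exp.comp (contDiff_const.mul hz2)
  have hzd : ∀ x, DifferentiableAt ℝ z x := hz2.differentiable (by norm_num)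
  have hvd : ∀ x, DifferentiableAt ℝ v x := hv2.differentiable (by norm_num)
  have hzpd : ∀ i x, DifferentiableAt ℝ (pd i z) x := fun i =>
    hz2.pd_one.differentiable (by norm_num)
  have hvpd : ∀ i x, DifferentiableAt ℝ (pd i v) x := fun i =>
    hv2.pd_one.differentiable (by norm_num)
  have hv1 : ∀ i, pd i v = fun x => -(1 / 2) * (v x * pd i z x) := by
    intro i; funext x
    have h := HasDerivAt.pd_comp (i := i) (u := fun x => -(1 / 2) * z x) (f := Real.exp)
      (Real.hasDerivAt_exp (-(1 / 2) * z x)) ((hzd x).const_mul _)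
    rw [pd_const_mul (hzd x)] at h
    rw [hv, h]; ring
  have hv2' : ∀ i j x, pd i (pd j v) x =
      -(1 / 2) * (-(1 / 2) * (v x * pd i z x) * pd j z x + v x * pd i (pd j z) x) := by
    intro i j x
    rw [hv1 j, pd_const_mul ((hvd x).fun_mul (hzpd j x)), pd_mul (hvd x) (hzpd j x), hv1 i]
  have hdiag : ∀ x, pd 0 (pd 0 v) x = pd 1 (pd 1 v) x := by
    intro x
    have h := (hz.hopf_eq_zero x).1
    unfold hopfRe at h
    rw [hv2', hv2']
    linear_combination -(1 / 2) * v x * h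
  have hoff : ∀ x, pd 0 (pd 1 v) x = 0 := by
    intro x
    have h := (hz.hopf_eq_zero x).2
    unfold hopfIm at h
    rw [hv2']
    linear_combination -(1 / 4) * v x * h
  have hoff' : ∀ x, pd 1 (pd 0 v) x = 0 := fun x => by
    rw [pd_comm hv2.contDiffAt]; exact hoff x
  -- each second derivative depends on one variable only
  have hgen : ∀ i j : Fin 2, i ≠ j → (∀ x, pd j (pd i v) x = 0) → ∀ (x : R2) (s : ℝ),
      pd i (pd i v) (x + s • EuclideanSpace.single j 1) = pd i (pd i v) x := by
    intro i j _ hji x s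
    have h1 : ∀ y : R2, pd i v (y + s • EuclideanSpace.single j 1) = pd i v y := by
      intro y
      have hline : ∀ r : ℝ, HasDerivAt (fun r : ℝ => pd i v (y + r • EuclideanSpace.single j 1))
          0 r := by
        intro r
        have e1 : HasDerivAt (fun r : ℝ => y + r • EuclideanSpace.single j (1 : ℝ))
            (EuclideanSpace.single j (1 : ℝ)) r := by
          simpa using ((hasDerivAt_id r).smul_const (EuclideanSpace.single j (1 : ℝ))).const_add y
        have e2 := HasFDerivAt.comp_hasDerivAt r (hvpd i _).hasFDerivAt e1
        have e3 := hji (y + r • EuclideanSpace.single j 1)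
        rw [pd] at e3
        rwa [e3] at e2
      have := is_const_of_deriv_eq_zero (fun r => (hline r).differentiableAt)
        (fun r => (hline r).deriv) s 0
      simpa using this
    have h2 := pd_comp_affine (i := i) (u := pd i v) (t := 1)
      (c := s • EuclideanSpace.single j 1) (x := x) (hvpd i _)
    simp only [one_smul, one_mul, h1] at h2
    exact h2.symm
  set l := pd 0 (pd 0 v) 0 with hl
  have hlam : ∀ x, pd 0 (pd 0 v) x = l := by
    intro x
    have hx : x = (0 + x 0 • EuclideanSpace.single 0 (1 : ℝ)) +
        x 1 • EuclideanSpace.single 1 (1 : ℝ) := by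
      ext k; fin_cases k <;> simp
    rw [hx, hgen 0 1 (by decide) hoff', hdiag, hgen 1 0 (by decide) hoff, ← hdiag]
  have hgrad0 : ∀ i, pd i v 0 = 0 := by
    intro i
    have : pd i z 0 = 0 := by
      have hloc : IsLocalMax z 0 := Eventually.of_forall hmax
      simp [pd, hloc.fderiv_eq_zero]
    simp only [hv1, this, mul_zero]
  have hgrad : ∀ i x, pd i v x = l * x i := by
    intro i x
    have h := eq_of_pd_eq_zero (f := fun x => pd i v x - l * x i)
      (fun x => (hvpd i x).sub ((differentiable_coord i x).const_mul l)) (fun k x => by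
        rw [pd_sub (hvpd i x) ((differentiable_coord i x).const_mul l),
          pd_const_mul (differentiable_coord i x), pd_coord]
        fin_cases k <;> fin_cases i
        · simpa [sub_eq_zero] using hlam x
        · simpa using hoff x
        · simpa using hoff' x
        · simpa [sub_eq_zero] using (hdiag x).symm.trans (hlam x)) x 0
    simp only [hgrad0, PiLp.zero_apply, mul_zero, sub_zero] at h
    linarith
  have hval : ∀ x, v x = v 0 + l / 2 * ‖x‖ ^ 2 := by
    intro x
    have hsq : ∀ k : Fin 2, ∀ x : R2, DifferentiableAt ℝ (fun x : R2 => x k * x k) x :=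
      fun k x => (differentiable_coord k x).fun_mul (differentiable_coord k x)
    have h := eq_of_pd_eq_zero
      (f := fun x => v x - l / 2 * (x 0 * x 0 + x 1 * x 1))
      (fun x => (hvd x).sub (((hsq 0 x).fun_add (hsq 1 x)).const_mul _)) (fun k x => by
        rw [pd_sub (hvd x) (((hsq 0 x).fun_add (hsq 1 x)).const_mul _),
          pd_const_mul ((hsq 0 x).fun_add (hsq 1 x)), pd_add (hsq 0 x) (hsq 1 x),
          pd_mul (differentiable_coord 0 x) (differentiable_coord 0 x),
          pd_mul (differentiable_coord 1 x) (differentiable_coord 1 x), pd_coord, pd_coord, hgrad]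
        fin_cases k <;> simp <;> ring) x 0
    simp only [PiLp.zero_apply, mul_zero, sub_zero, add_zero] at h
    have hn : ‖x‖ ^ 2 = x 0 * x 0 + x 1 * x 1 := by
      rw [EuclideanSpace.norm_sq_eq, Fin.sum_univ_two]; simp only [Real.norm_eq_abs, sq_abs]; ring
    rw [hn]; linarith
  have hv0 : 0 < v 0 := Real.exp_pos _
  have hexp : ∀ x, Real.exp (z x) = (v x ^ 2)⁻¹ := by
    intro x
    rw [hv, ← Real.exp_nat_mul, ← Real.exp_neg]
    congr 1; push_cast; ring
  have hlv : 4 * l * v 0 = 1 := by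
    have h1 : pd 0 (pd 0 z) 0 + pd 1 (pd 1 z) 0 = -(v 0 ^ 2)⁻¹ := by
      rw [← _root_.lap_eq, hz.lap_eq, hexp]
    have h2 := hv2' 0 0 0
    have h3 := hv2' 1 1 0
    have hg : ∀ i, pd i z 0 = 0 := fun i => by
      have hloc : IsLocalMax z 0 := Eventually.of_forall hmax
      simp [pd, hloc.fderiv_eq_zero]
    rw [← hdiag] at h3
    simp only [hg, mul_zero, zero_add] at h2 h3
    have h4 : 2 * l = 1 / 2 * (v 0 * (v 0 ^ 2)⁻¹) := by
      linear_combination h2 + h3 - 1 / 2 * v 0 * h1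
    have h5 : v 0 * (v 0 * (v 0 ^ 2)⁻¹) = 1 := by field_simp
    linear_combination 2 * v 0 * h4 + h5
  funext x
  have hvx : v x = v 0 * (1 + Real.exp (z 0) * ‖x‖ ^ 2 / 8) := by
    rw [hval, hexp]
    have : l = 1 / (4 * v 0) := by field_simp; linarith
    rw [this]; field_simp; ring
  rw [bubble, ← Real.exp_eq_exp, Real.exp_log (by positivity), hexp x, hvx, hexp 0]
  field_simp

lemma abs_coord_le_norm (i : Fin 2) (x : R2) : |x i| ≤ ‖x‖ := PiLp.norm_apply_le x i

lemma abs_pd_le_norm_fderiv (i : Fin 2) (f : R2 → ℝ) (x : R2) : |pd i f x| ≤ ‖fderiv ℝ f x‖ := by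
  have := (fderiv ℝ f x).le_opNorm (EuclideanSpace.single i (1 : ℝ))
  simpa [pd] using this

lemma norm_fderiv_le {f : R2 → ℝ} {x : R2} {A : ℝ} (h : ∀ i, |pd i f x| ≤ A) :
    ‖fderiv ℝ f x‖ ≤ 2 * A := by
  have hA : 0 ≤ A := (abs_nonneg _).trans (h 0)
  refine ContinuousLinearMap.opNorm_le_bound _ (by positivity) fun v => ?_
  rw [fderiv_apply_eq, Real.norm_eq_abs]
  calc |v 0 * pd 0 f x + v 1 * pd 1 f x| ≤ |v 0| * |pd 0 f x| + |v 1| * |pd 1 f x| := by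
        rw [← abs_mul, ← abs_mul]; exact abs_add_le _ _
    _ ≤ ‖v‖ * A + ‖v‖ * A := by
        gcongr
        exacts [abs_coord_le_norm 0 v, h 0, abs_coord_le_norm 1 v, h 1]
    _ = _ := by ring

lemma abs_sub_le_of_pd_le {f : R2 → ℝ} {S : Set R2} (hS : Convex ℝ S) {A : ℝ}
    (hd : ∀ x ∈ S, DifferentiableAt ℝ f x) (h : ∀ i, ∀ x ∈ S, |pd i f x| ≤ A) {x y : R2}
    (hx : x ∈ S) (hy : y ∈ S) : |f y - f x| ≤ 2 * A * ‖y - x‖ :=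
  hS.norm_image_sub_le_of_norm_fderiv_le hd (fun x hx => norm_fderiv_le fun i => h i x hx) hx hy

lemma abs_pd_le_of_lipschitz {f : R2 → ℝ} {x : R2} {C : ℝ} (hC : 0 ≤ C)
    (hd : DifferentiableAt ℝ f x) (h : ∀ᶠ y in 𝓝 x, |f y - f x| ≤ C * ‖y - x‖) (i : Fin 2) :
    |pd i f x| ≤ C :=
  (abs_pd_le_norm_fderiv i f x).trans (hd.hasFDerivAt.le_of_lip' hC h)

lemma closedBall_subset_of_mem {x : R2} {R r : ℝ} (hx : x ∈ closedBall (0 : R2) R) :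
    closedBall x r ⊆ closedBall 0 (R + r) := by
  refine closedBall_subset_closedBall' ?_
  rw [mem_closedBall] at hx; linarith

lemma abs_pd_le_of_abs_le {h : R2 → ℝ} {R A : ℝ} (hA : 0 < A)
    (hC : ∀ y ∈ closedBall (0 : R2) (R + 1), ContDiffAt ℝ 2 h y)
    (h0 : ∀ y ∈ closedBall (0 : R2) (R + 1), |h y| ≤ A)
    (hL : ∀ y ∈ closedBall (0 : R2) (R + 1), |lap h y| ≤ A) (i : Fin 2) :
    ∀ x ∈ closedBall (0 : R2) R, |pd i h x| ≤ 5 * A := by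
  intro x hx
  have hs : closedBall x (2 * (1 / 2)) ⊆ closedBall (0 : R2) (R + 1) := by
    rw [mul_one_div_cancel two_ne_zero]; exact closedBall_subset_of_mem hx
  have := abs_pd_le_of_bounds (i := i) (x := x) (d := 1 / 2) (by norm_num) hA
    (fun y hy => hC y (hs hy)) (fun y hy => h0 y (hs hy)) (fun y hy => hL y (hs hy))
  linarith

lemma add_mem_closedBall {x s : R2} {R : ℝ} (hx : x ∈ closedBall (0 : R2) R) (hs : ‖s‖ ≤ 1) :
    x + s ∈ closedBall (0 : R2) (R + 1) := by
  rw [mem_closedBall_zero_iff] at *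
  exact (norm_add_le _ _).trans (add_le_add hx hs)

lemma abs_pd_pd_le_of_abs_le {h : R2 → ℝ} {R A : ℝ} (hA : 0 < A)
    (hC : ∀ y ∈ closedBall (0 : R2) (R + 3), ContDiffAt ℝ 2 h y)
    (h0 : ∀ y ∈ closedBall (0 : R2) (R + 3), |h y| ≤ A)
    (hL : ∀ y ∈ closedBall (0 : R2) (R + 3), |lap h y| ≤ A)
    (hLip : ∀ x ∈ closedBall (0 : R2) (R + 3), ∀ y ∈ closedBall (0 : R2) (R + 3),
      |lap h y - lap h x| ≤ A * ‖y - x‖) (i j : Fin 2) :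
    ∀ x ∈ closedBall (0 : R2) R, |pd i (pd j h) x| ≤ 50 * A := by
  have hmono : ∀ a : ℝ, a ≤ 3 → closedBall (0 : R2) (R + a) ⊆ closedBall 0 (R + 3) := fun a ha =>
    closedBall_subset_closedBall (by linarith)
  have e3 : R + 2 + 1 = R + 3 := by ring
  have e2 : R + 1 + 1 = R + 2 := by ring
  have hg : ∀ k, ∀ x ∈ closedBall (0 : R2) (R + 2), |pd k h x| ≤ 5 * A := fun k =>
    abs_pd_le_of_abs_le hA (by rwa [e3]) (by rwa [e3]) (by rwa [e3]) k
  have hl : ∀ x ∈ closedBall (0 : R2) (R + 2), ∀ y ∈ closedBall (0 : R2) (R + 2),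
      |h y - h x| ≤ 10 * A * ‖y - x‖ := by
    intro x hx y hy
    have := abs_sub_le_of_pd_le (convex_closedBall (0 : R2) (R + 2))
      (fun x hx => (hC x (hmono 2 (by norm_num) hx)).differentiableAt (by norm_num)) hg hx hy
    linarith
  have hlip : ∀ s : R2, ‖s‖ ≤ 1 → s ≠ 0 → ∀ x ∈ closedBall (0 : R2) R,
      |pd j h (x + s) - pd j h x| ≤ 50 * A * ‖s‖ := by
    intro s hs hs0 x hx
    have hsp : 0 < ‖s‖ := norm_pos_iff.2 hs0
    have hin : ∀ y ∈ closedBall (0 : R2) (R + 1), y + s ∈ closedBall (0 : R2) (R + 2) :=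
      fun y hy => e2 ▸ add_mem_closedBall hy hs
    have hC1 : ∀ y ∈ closedBall (0 : R2) (R + 1), ContDiffAt ℝ 2 h ((1 : ℝ) • y + s) := fun y hy => by
      rw [one_smul]; exact hC _ (hmono 2 (by norm_num) (hin y hy))
    have hC2 : ∀ y ∈ closedBall (0 : R2) (R + 1), ContDiffAt ℝ 2 (fun y => h ((1 : ℝ) • y + s)) y :=
      fun y hy => (hC1 y hy).comp y (by fun_prop)
    have hC3 : ∀ y ∈ closedBall (0 : R2) (R + 1), ContDiffAt ℝ 2 h y := fun y hy =>
      hC y (hmono 1 (by norm_num) hy)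
    have hsub : closedBall (0 : R2) (R + 1) ⊆ closedBall 0 (R + 2) :=
      closedBall_subset_closedBall (by linarith)
    have key := abs_pd_le_of_abs_le (h := fun y => h ((1 : ℝ) • y + s) - h y) (R := R)
      (A := 10 * A * ‖s‖) (by positivity) (fun y hy => (hC2 y hy).sub (hC3 y hy))
      (fun y hy => by
        have := hl y (hsub hy) (y + s) (hin y hy)
        simpa using this)
      (fun y hy => by
        rw [lap_sub (hC2 y hy) (hC3 y hy), lap_comp_affine (hC1 y hy), one_pow, one_mul, one_smul]
        have := hLip y (hmono 1 (by norm_num) hy) (y + s) (hmono 2 (by norm_num) (hin y hy))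
        rw [add_sub_cancel_left] at this
        nlinarith [mul_pos hA hsp]) j x hx
    have hx1 : x ∈ closedBall (0 : R2) (R + 1) := closedBall_subset_closedBall (by linarith) hx
    rw [pd_sub ((hC2 x hx1).differentiableAt (by norm_num))
      ((hC3 x hx1).differentiableAt (by norm_num)),
      pd_comp_affine ((hC1 x hx1).differentiableAt (by norm_num)), one_mul, one_smul] at key
    linarith
  intro x hx
  have hx3 : x ∈ closedBall (0 : R2) (R + 3) := closedBall_subset_closedBall (by linarith) hx
  refine abs_pd_le_of_lipschitz (by positivity) (hC x hx3).differentiableAt_pd ?_ i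
  filter_upwards [closedBall_mem_nhds x one_pos] with y hy
  rcases eq_or_ne y x with rfl | hne
  · simp
  · have := hlip (y - x) (by rwa [mem_closedBall, dist_eq_norm] at hy) (sub_ne_zero.2 hne) x hx
    simpa using this

/-- An Arzelà–Ascoli extraction: eventual bounds and eventual Lipschitz bounds on every ball give
a subsequence converging uniformly on balls. -/
lemma exists_subseq_tendstoUniformlyOn {z : ℕ → R2 → ℝ}
    (hb : ∀ R : ℝ, ∃ A : ℝ, ∀ᶠ n in atTop, ∀ x ∈ closedBall (0 : R2) R, |z n x| ≤ A)
    (hl : ∀ R : ℝ, ∃ A : ℝ, ∀ᶠ n in atTop, ∀ x ∈ closedBall (0 : R2) R,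
      ∀ y ∈ closedBall (0 : R2) R, |z n y - z n x| ≤ A * ‖y - x‖) :
    ∃ φ : ℕ → ℕ, StrictMono φ ∧ ∃ g : R2 → ℝ, ∀ R : ℝ,
      TendstoUniformlyOn (fun n => z (φ n)) g atTop (closedBall (0 : R2) R) := by
  choose B hB using hb
  have hB' : ∀ x : R2, ∀ᶠ n in atTop, |z n x| ≤ B ‖x‖ := fun x => by
    filter_upwards [hB ‖x‖] with n hn using hn x (by simp)
  set d := TopologicalSpace.denseSeq R2
  have hd : DenseRange d := TopologicalSpace.denseRange_denseSeq R2
  set a : ℕ → ℕ → ℝ := fun n k => max (-B ‖d k‖) (min (B ‖d k‖) (z n (d k)))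
  have hB0 : ∀ x, 0 ≤ B ‖x‖ := fun x => by
    obtain ⟨n, hn⟩ := (hB' x).exists
    exact (abs_nonneg _).trans hn
  have hcomp : IsCompact (Set.pi univ fun k : ℕ => Set.Icc (-B ‖d k‖) (B ‖d k‖)) :=
    isCompact_univ_pi fun k => isCompact_Icc
  obtain ⟨α, _, φ, hφ, hlim⟩ := hcomp.tendsto_subseq (x := a) fun n => by
    intro k _
    exact ⟨le_max_left _ _, max_le (by linarith [hB0 (d k)]) (min_le_left _ _)⟩
  have hdense : ∀ k, Tendsto (fun n => z (φ n) (d k)) atTop (𝓝 (α k)) := by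
    intro k
    refine (tendsto_pi_nhds.1 hlim k).congr' ?_
    filter_upwards [hφ.tendsto_atTop.eventually (hB' (d k))] with n hn
    rw [abs_le] at hn
    simp only [Function.comp, a]
    rw [min_eq_right hn.2, max_eq_right hn.1]
  have hcau : ∀ x : R2, CauchySeq fun n => z (φ n) x := by
    intro x
    obtain ⟨A, hA⟩ := hl (‖x‖ + 1)
    have hA' := hφ.tendsto_atTop.eventually hA
    rw [Metric.cauchySeq_iff']
    intro ε hε
    obtain ⟨k, hk⟩ := hd.exists_dist_lt x (ε := min 1 (ε / (4 * (|A| + 1)))) (by positivity)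
    have hk1 : dist x (d k) < 1 := hk.trans_le (min_le_left _ _)
    have hk2 : (|A| + 1) * dist x (d k) < ε / 4 := by
      have := hk.trans_le (min_le_right _ _)
      rw [lt_div_iff₀ (by positivity)] at this
      linarith
    obtain ⟨N1, hN1⟩ := eventually_atTop.1 hA'
    obtain ⟨N2, hN2⟩ := Metric.cauchySeq_iff.1 (hdense k).cauchySeq (ε / 4) (by positivity)
    have hclose : ∀ n ≥ N1, |z (φ n) x - z (φ n) (d k)| < ε / 4 := by
      intro n hn
      refine (hN1 n hn (d k) ?_ x ?_).trans_lt ?_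
      · rw [mem_closedBall_zero_iff]
        have := norm_sub_norm_le (d k) x
        rw [← dist_eq_norm, dist_comm] at this
        linarith
      · rw [mem_closedBall_zero_iff]; linarith
      · rw [← dist_eq_norm]
        refine lt_of_le_of_lt ?_ hk2
        gcongr
        linarith [le_abs_self A]
    refine ⟨max N1 N2, fun n hn => ?_⟩
    have h1 := hclose n (le_of_max_le_left hn)
    have h2 := hclose (max N1 N2) (le_max_left _ _)
    have h3 := hN2 n (le_of_max_le_right hn) (max N1 N2) (le_max_right _ _)
    rw [Real.dist_eq] at *
    rw [abs_lt] at *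
    constructor <;> linarith
  choose g hg using fun x => cauchySeq_tendsto_of_complete (hcau x)
  refine ⟨φ, hφ, g, fun R => ?_⟩
  obtain ⟨A, hA⟩ := hl R
  have hA' := hφ.tendsto_atTop.eventually hA
  have hgl : ∀ x ∈ closedBall (0 : R2) R, ∀ y ∈ closedBall (0 : R2) R,
      |g y - g x| ≤ A * ‖y - x‖ := by
    intro x hx y hy
    refine le_of_tendsto ((hg y).sub (hg x)).abs ?_
    filter_upwards [hA'] with n hn using hn x hx y hy
  rw [Metric.tendstoUniformlyOn_iff]
  intro ε hε
  obtain ⟨t, ht, htf, hcov⟩ := (isCompact_closedBall (0 : R2) R).finite_cover_balls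
    (e := ε / (4 * (|A| + 1))) (by positivity)
  have hev : ∀ᶠ n in atTop, ∀ y ∈ t, |z (φ n) y - g y| < ε / 4 := by
    rw [eventually_all_finite htf]
    intro y _
    filter_upwards [Metric.tendsto_nhds.1 (hg y) (ε / 4) (by positivity)] with n hn using hn
  filter_upwards [hA', hev] with n h1 h2 x hx
  obtain ⟨y, hy, hxy⟩ := mem_iUnion₂.1 (hcov hx)
  rw [mem_ball, lt_div_iff₀ (by positivity), dist_eq_norm] at hxy
  have hAle : A * ‖x - y‖ < ε / 4 := by nlinarith [le_abs_self A, norm_nonneg (x - y)]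
  have a1 := (h1 y (ht hy) x hx).trans_lt hAle
  have a2 := (hgl y (ht hy) x hx).trans_lt hAle
  have a3 := h2 y hy
  rw [Real.dist_eq]
  rw [abs_lt] at *
  constructor <;> linarith

lemma abs_rpow_sub_exp_le {A p s : ℝ} (hA : 1 ≤ A) (hp : 2 * A ≤ p) (hs : -A ≤ s) (hs0 : s ≤ 0) :
    1 / 2 ≤ 1 + s / p ∧ |(1 + s / p) ^ p - Real.exp s| ≤ 4 * A ^ 2 / p ∧
      |(1 + s / p) ^ (p - 1) - Real.exp s| ≤ 4 * A ^ 2 / p := by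
  have hp0 : 0 < p := by linarith
  set t := s / p with ht
  have hst : s = p * t := by rw [ht]; field_simp
  have ht0 : t ≤ 0 := div_nonpos_of_nonpos_of_nonneg hs0 hp0.le
  have ht1 : -(A / p) ≤ t := by
    rw [ht, neg_le, ← neg_div]; gcongr; linarith
  have hAp : A / p ≤ 1 / 2 := by rw [div_le_iff₀ hp0]; linarith
  have hw : 1 / 2 ≤ 1 + t := by linarith
  have hw0 : 0 < 1 + t := by linarith
  have hup : (1 + t) ^ p ≤ Real.exp s := by
    rw [Real.rpow_def_of_pos hw0, Real.exp_le_exp, hst]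
    have := Real.log_le_sub_one_of_pos hw0
    nlinarith
  have hlog : t - 2 * t ^ 2 ≤ Real.log (1 + t) := by
    have h1 := Real.one_sub_inv_le_log_of_pos hw0
    have h2 : 1 - (1 + t)⁻¹ = t - t ^ 2 / (1 + t) := by field_simp; ring
    have h3 : t ^ 2 / (1 + t) ≤ 2 * t ^ 2 := by
      rw [div_le_iff₀ hw0]; nlinarith [sq_nonneg t]
    linarith
  have ht2 : t ^ 2 ≤ (A / p) ^ 2 := sq_le_sq' (by linarith) (by linarith [div_nonneg (by linarith : 0 ≤ A) hp0.le])
  have hlow : Real.exp s - 2 * A ^ 2 / p ≤ (1 + t) ^ p := by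
    rw [Real.rpow_def_of_pos hw0]
    have h1 : s - 2 * A ^ 2 / p ≤ Real.log (1 + t) * p := by
      have : p * t ^ 2 ≤ A ^ 2 / p := by
        calc p * t ^ 2 ≤ p * (A / p) ^ 2 := by gcongr
          _ = _ := by field_simp
      rw [hst, mul_div_assoc]; nlinarith
    have h2 : Real.exp s * (1 - 2 * A ^ 2 / p) ≤ Real.exp (Real.log (1 + t) * p) := by
      refine le_trans ?_ (Real.exp_le_exp.2 h1)
      rw [sub_eq_add_neg s, Real.exp_add]
      gcongr
      linarith [Real.add_one_le_exp (-(2 * A ^ 2 / p))]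
    have h3 : Real.exp s ≤ 1 := Real.exp_le_one_iff.2 hs0
    have h4 : 0 ≤ 2 * A ^ 2 / p := by positivity
    nlinarith
  have hpow : (1 + t) ^ (p - 1) * (1 + t) = (1 + t) ^ p := by
    rw [Real.rpow_sub_one hw0.ne']; field_simp
  have hq0 : 0 ≤ (1 + t) ^ (p - 1) := Real.rpow_nonneg hw0.le _
  have hq1 : (1 + t) ^ (p - 1) ≤ 1 := Real.rpow_le_one hw0.le (by linarith) (by linarith)
  have hAA : A / p ≤ 2 * A ^ 2 / p := by gcongr; nlinarith
  have hA4 : 4 * A ^ 2 / p = 2 * A ^ 2 / p + 2 * A ^ 2 / p := by ring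
  refine ⟨hw, ?_, ?_⟩
  · rw [abs_le]; constructor <;> linarith [div_nonneg (by positivity : 0 ≤ 2 * A ^ 2) hp0.le]
  · rw [abs_le]; constructor <;> nlinarith [div_nonneg (by positivity : 0 ≤ 2 * A ^ 2) hp0.le]

/-- A sequence of rescaled solutions, defined on larger and larger balls, which is locally bounded,
has its maximum at the origin and has bounded mass. -/
structure IsBlowUp (z : ℕ → R2 → ℝ) (p : ℕ → ℝ) : Prop where
  tendsto : Tendsto p atTop atTop
  mass : ∃ E, ∀ R, ∀ᶠ n in atTop, ∫ x in closedBall (0 : R2) R, (1 + z n x / p n) ^ p n ≤ E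
  bound : ∀ R, ∃ A, ∀ᶠ n in atTop, ∀ x ∈ closedBall (0 : R2) R, ContDiffAt ℝ 2 (z n) x ∧
    lap (z n) x = -(1 + z n x / p n) ^ p n ∧ -A ≤ z n x ∧ z n x ≤ z n 0 ∧ z n x ≤ 0

lemma IsBlowUp.comp {z : ℕ → R2 → ℝ} {p : ℕ → ℝ} (h : IsBlowUp z p) {φ : ℕ → ℕ}
    (hφ : StrictMono φ) : IsBlowUp (fun n => z (φ n)) (fun n => p (φ n)) where
  tendsto := h.tendsto.comp hφ.tendsto_atTop
  mass := by
    obtain ⟨E, hE⟩ := h.mass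
    exact ⟨E, fun R => hφ.tendsto_atTop.eventually (hE R)⟩
  bound R := by
    obtain ⟨A, hA⟩ := h.bound R
    exact ⟨A, hφ.tendsto_atTop.eventually hA⟩

lemma IsBlowUp.exists_estimates {z : ℕ → R2 → ℝ} {p : ℕ → ℝ} (h : IsBlowUp z p) (R : ℝ) :
    ∃ C : ℝ, 1 ≤ C ∧ ∀ᶠ n in atTop, 1 ≤ p n ∧ ∀ x ∈ closedBall (0 : R2) R,
      ContDiffAt ℝ 2 (z n) x ∧ lap (z n) x = -(1 + z n x / p n) ^ p n ∧ |z n x| ≤ C ∧ z n x ≤ 0 ∧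
      0 < 1 + z n x / p n ∧ |(1 + z n x / p n) ^ p n - Real.exp (z n x)| ≤ C / p n ∧
      |(1 + z n x / p n) ^ (p n - 1) - Real.exp (z n x)| ≤ C / p n ∧ ∀ i, |pd i (z n) x| ≤ C := by
  obtain ⟨A₀, hA₀⟩ := h.bound (R + 1)
  set A := max 1 A₀
  have hA1 : 1 ≤ A := le_max_left _ _
  have hAsq : A ≤ A ^ 2 := by nlinarith
  refine ⟨5 * A ^ 2, by nlinarith, ?_⟩
  filter_upwards [hA₀, h.tendsto.eventually_ge_atTop (2 * A)] with n h1 h2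
  have hp0 : 0 < p n := by linarith
  have hAb : ∀ x ∈ closedBall (0 : R2) (R + 1), -A ≤ z n x := fun x hx =>
    (neg_le_neg (le_max_right _ _)).trans (h1 x hx).2.2.1
  refine ⟨by linarith, fun x hx => ?_⟩
  have hx1 : x ∈ closedBall (0 : R2) (R + 1) := closedBall_subset_closedBall (by linarith) hx
  obtain ⟨b1, b2, b3, b4, b5⟩ := h1 x hx1
  obtain ⟨c1, c2, c3⟩ := abs_rpow_sub_exp_le hA1 h2 (hAb x hx1) b5
  have h45 : 4 * A ^ 2 / p n ≤ 5 * A ^ 2 / p n := by gcongr; norm_num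
  refine ⟨b1, b2, ?_, b5, by linarith, c2.trans h45, c3.trans h45, fun i => ?_⟩
  · rw [abs_le]; constructor <;> nlinarith [hAb x hx1]
  · refine (abs_pd_le_of_abs_le (by linarith) (fun y hy => (h1 y hy).1) (fun y hy => ?_)
      (fun y hy => ?_) i x hx).trans (mul_le_mul_of_nonneg_left hAsq (by norm_num))
    · rw [abs_le]; constructor <;> linarith [hAb y hy, (h1 y hy).2.2.2.2]
    · have := (abs_rpow_sub_exp_le hA1 h2 (hAb y hy) (h1 y hy).2.2.2.2).1
      have hy0 : z n y / p n ≤ 0 := div_nonpos_of_nonpos_of_nonneg (h1 y hy).2.2.2.2 hp0.le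
      rw [(h1 y hy).2.1, abs_neg, abs_of_nonneg (Real.rpow_nonneg (by linarith) _)]
      exact (Real.rpow_le_one (by linarith) (by linarith) hp0.le).trans hA1

lemma abs_exp_sub_exp_le {a b : ℝ} (ha : a ≤ 0) (hb : b ≤ 0) :
    |Real.exp a - Real.exp b| ≤ |a - b| := by
  wlog hab : b ≤ a generalizing a b
  · rw [abs_sub_comm, abs_sub_comm a]; exact this hb ha (by linarith)
  rw [abs_of_nonneg (by simpa using hab), abs_of_nonneg (by linarith)]
  have h1 := Real.add_one_le_exp (b - a)
  have h2 : Real.exp b = Real.exp a * Real.exp (b - a) := by rw [← Real.exp_add]; congr 1; ring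
  have h3 : Real.exp a ≤ 1 := Real.exp_le_one_iff.2 ha
  nlinarith [Real.exp_pos a]

lemma IsBlowUp.uniformCauchySeqOn_nonlinearity {z : ℕ → R2 → ℝ} {p : ℕ → ℝ} (h : IsBlowUp z p)
    (hc : ∀ R, UniformCauchySeqOn z atTop (closedBall (0 : R2) R)) (R : ℝ) :
    UniformCauchySeqOn (fun n x => (1 + z n x / p n) ^ p n) atTop (closedBall (0 : R2) R) ∧
      UniformCauchySeqOn (fun n x => (1 + z n x / p n) ^ (p n - 1)) atTop
        (closedBall (0 : R2) R) := by
  obtain ⟨C, hC, hCz⟩ := h.exists_estimates R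
  simp only [Metric.uniformCauchySeqOn_iff]
  have key : ∀ f : ℕ → R2 → ℝ, (∀ᶠ n in atTop, ∀ x ∈ closedBall (0 : R2) R,
      z n x ≤ 0 ∧ |f n x - Real.exp (z n x)| ≤ C / p n) → ∀ ε > 0, ∃ N, ∀ m ≥ N, ∀ n ≥ N,
      ∀ x ∈ closedBall (0 : R2) R, dist (f m x) (f n x) < ε := by
    intro f hf ε hε
    have hlim : Tendsto (fun n => C / p n) atTop (𝓝 0) := tendsto_const_nhds.div_atTop h.tendsto
    obtain ⟨N1, hN1⟩ := eventually_atTop.1 (hf.and (hlim.eventually (gt_mem_nhds (by positivity : 0 < ε / 3))))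
    obtain ⟨N2, hN2⟩ := Metric.uniformCauchySeqOn_iff.1 (hc R) (ε / 3) (by positivity)
    refine ⟨max N1 N2, fun m hm n hn x hx => ?_⟩
    obtain ⟨a1, a2⟩ := hN1 m (le_of_max_le_left hm)
    obtain ⟨b1, b2⟩ := hN1 n (le_of_max_le_left hn)
    have c := hN2 m (le_of_max_le_right hm) n (le_of_max_le_right hn) x hx
    have d := abs_exp_sub_exp_le (a1 x hx).1 (b1 x hx).1
    have a3 := (a1 x hx).2; have b3 := (b1 x hx).2
    rw [Real.dist_eq] at *
    have d' := d.trans_lt c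
    rw [abs_le] at a3 b3
    rw [abs_lt] at d' ⊢
    constructor <;> linarith
  constructor
  · refine key _ ?_
    filter_upwards [hCz] with n hn x hx
    exact ⟨(hn.2 x hx).2.2.2.1, (hn.2 x hx).2.2.2.2.2.1⟩
  · refine key _ ?_
    filter_upwards [hCz] with n hn x hx
    exact ⟨(hn.2 x hx).2.2.2.1, (hn.2 x hx).2.2.2.2.2.2.1⟩

lemma IsBlowUp.uniformCauchySeqOn_pd {z : ℕ → R2 → ℝ} {p : ℕ → ℝ} (h : IsBlowUp z p)
    (hc : ∀ R, UniformCauchySeqOn z atTop (closedBall (0 : R2) R)) (i : Fin 2) (R : ℝ) :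
    UniformCauchySeqOn (fun n => pd i (z n)) atTop (closedBall (0 : R2) R) := by
  obtain ⟨C, hC, hCz⟩ := h.exists_estimates (R + 1)
  have hf := (h.uniformCauchySeqOn_nonlinearity hc (R + 1)).1
  rw [Metric.uniformCauchySeqOn_iff] at hf ⊢
  intro ε hε
  obtain ⟨N1, hN1⟩ := eventually_atTop.1 hCz
  obtain ⟨N2, hN2⟩ := Metric.uniformCauchySeqOn_iff.1 (hc (R + 1)) (ε / 10) (by positivity)
  obtain ⟨N3, hN3⟩ := hf (ε / 10) (by positivity)
  refine ⟨max N1 (max N2 N3), fun m hm n hn x hx => ?_⟩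
  simp only [ge_iff_le, max_le_iff] at hm hn
  obtain ⟨_, m1⟩ := hN1 m hm.1
  obtain ⟨_, n1⟩ := hN1 n hn.1
  have key := abs_pd_le_of_abs_le (h := fun x => z m x - z n x) (R := R) (A := ε / 10) (by positivity)
    (fun y hy => (m1 y hy).1.sub (n1 y hy).1)
    (fun y hy => by
      have := hN2 m hm.2.1 n hn.2.1 y hy
      rw [Real.dist_eq] at this; exact this.le)
    (fun y hy => by
      have := hN3 m hm.2.2 n hn.2.2 y hy
      rw [lap_sub (m1 y hy).1 (n1 y hy).1, (m1 y hy).2.1, (n1 y hy).2.1, neg_sub_neg]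
      rw [dist_comm, Real.dist_eq] at this
      exact this.le) i x hx
  have hx1 : x ∈ closedBall (0 : R2) (R + 1) := closedBall_subset_closedBall (by linarith) hx
  rw [pd_sub ((m1 x hx1).1.differentiableAt (by norm_num))
    ((n1 x hx1).1.differentiableAt (by norm_num))] at key
  rw [Real.dist_eq]; linarith

lemma pd_rpow_comp {u : R2 → ℝ} {x : R2} {p : ℝ} {i : Fin 2} (hp : p ≠ 0)
    (hx : 0 < 1 + u x / p) (hu : DifferentiableAt ℝ u x) :
    DifferentiableAt ℝ (fun y => (1 + u y / p) ^ p) x ∧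
    pd i (fun y => (1 + u y / p) ^ p) x = (1 + u x / p) ^ (p - 1) * pd i u x := by
  have h1 : HasDerivAt (fun s : ℝ => 1 + s / p) (1 / p) (u x) := by
    simpa using ((hasDerivAt_id (u x)).div_const p).const_add 1
  have h2 : HasDerivAt (fun s : ℝ => (1 + s / p) ^ p) ((1 + u x / p) ^ (p - 1)) (u x) := by
    have := h1.rpow_const (p := p) (Or.inl hx.ne')
    convert this using 1
    field_simp
  exact ⟨h2.differentiableAt.comp x hu, h2.pd_comp (u := u) hu⟩

lemma IsBlowUp.uniformCauchySeqOn_pd_pd {z : ℕ → R2 → ℝ} {p : ℕ → ℝ} (h : IsBlowUp z p)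
    (hc : ∀ R, UniformCauchySeqOn z atTop (closedBall (0 : R2) R)) (i j : Fin 2) (R : ℝ) :
    UniformCauchySeqOn (fun n => pd i (pd j (z n))) atTop (closedBall (0 : R2) R) := by
  obtain ⟨C, hC, hCz⟩ := h.exists_estimates (R + 3)
  obtain ⟨hf, hf'⟩ := h.uniformCauchySeqOn_nonlinearity hc (R + 3)
  have hp0 := h.uniformCauchySeqOn_pd hc 0 (R + 3)
  have hp1 := h.uniformCauchySeqOn_pd hc 1 (R + 3)
  rw [Metric.uniformCauchySeqOn_iff] at hf hf' hp0 hp1 ⊢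
  intro ε hε
  obtain ⟨N1, hN1⟩ := eventually_atTop.1 hCz
  obtain ⟨N2, hN2⟩ := Metric.uniformCauchySeqOn_iff.1 (hc (R + 3)) (ε / 100) (by positivity)
  obtain ⟨N3, hN3⟩ := hf (ε / 100) (by positivity)
  obtain ⟨N4, hN4⟩ := hf' (ε / (400 * C)) (by positivity)
  obtain ⟨N5, hN5⟩ := hp0 (ε / 400) (by positivity)
  obtain ⟨N6, hN6⟩ := hp1 (ε / 400) (by positivity)
  refine ⟨max N1 (max N2 (max N3 (max N4 (max N5 N6)))), fun m hm n hn x hx => ?_⟩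
  simp only [ge_iff_le, max_le_iff] at hm hn
  obtain ⟨pm1, m1⟩ := hN1 m hm.1
  obtain ⟨pn1, n1⟩ := hN1 n hn.1
  have pm : 0 < p m := by linarith
  have pn : 0 < p n := by linarith
  have hpd : ∀ k, ∀ y ∈ closedBall (0 : R2) (R + 3), |pd k (z m) y - pd k (z n) y| ≤ ε / 400 := by
    intro k y hy
    have h0 := hN5 m hm.2.2.2.2.1 n hn.2.2.2.2.1 y hy
    have h1 := hN6 m hm.2.2.2.2.2 n hn.2.2.2.2.2 y hy
    rw [Real.dist_eq] at h0 h1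
    fin_cases k
    exacts [h0.le, h1.le]
  have hlap : ∀ y ∈ closedBall (0 : R2) (R + 3), lap (fun x => z m x - z n x) y =
      (1 + z n y / p n) ^ p n - (1 + z m y / p m) ^ p m := by
    intro y hy
    rw [lap_sub (m1 y hy).1 (n1 y hy).1, (m1 y hy).2.1, (n1 y hy).2.1]; ring
  have hdm : ∀ y ∈ closedBall (0 : R2) (R + 3), DifferentiableAt ℝ (z m) y := fun y hy =>
    (m1 y hy).1.differentiableAt (by norm_num)
  have hdn : ∀ y ∈ closedBall (0 : R2) (R + 3), DifferentiableAt ℝ (z n) y := fun y hy =>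
    (n1 y hy).1.differentiableAt (by norm_num)
  have em : ∀ k, ∀ y ∈ closedBall (0 : R2) (R + 3), _ := fun k y hy =>
    pd_rpow_comp (i := k) pm.ne' (m1 y hy).2.2.2.2.1 (hdm y hy)
  have en : ∀ k, ∀ y ∈ closedBall (0 : R2) (R + 3), _ := fun k y hy =>
    pd_rpow_comp (i := k) pn.ne' (n1 y hy).2.2.2.2.1 (hdn y hy)
  have key := abs_pd_pd_le_of_abs_le (h := fun x => z m x - z n x) (R := R) (A := ε / 100)
    (by positivity) (fun y hy => (m1 y hy).1.sub (n1 y hy).1)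
    (fun y hy => by
      have := hN2 m hm.2.1 n hn.2.1 y hy
      rw [Real.dist_eq] at this; exact this.le)
    (fun y hy => by
      have := hN3 m hm.2.2.1 n hn.2.2.1 y hy
      rw [dist_comm, Real.dist_eq] at this
      rw [hlap y hy]; exact this.le)
    (fun y hy y' hy' => by
      rw [hlap y hy, hlap y' hy']
      have := abs_sub_le_of_pd_le (f := fun y => (1 + z n y / p n) ^ p n - (1 + z m y / p m) ^ p m)
        (convex_closedBall (0 : R2) (R + 3)) (A := ε / 200)
        (fun y hy => (en 0 y hy).1.sub (em 0 y hy).1) (fun k w hw => ?_) hy hy'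
      · linarith
      · rw [pd_sub (en k w hw).1 (em k w hw).1, (en k w hw).2, (em k w hw).2]
        have a1 := hN4 m hm.2.2.2.1 n hn.2.2.2.1 w hw
        rw [dist_comm, Real.dist_eq, lt_div_iff₀ (by positivity)] at a1
        have a2 := hpd k w hw
        have a3 := (n1 w hw).2.2.2.2.2.2.2 k
        have a5 : |(1 + z m w / p m) ^ (p m - 1)| ≤ 1 := by
          have b0 := (m1 w hw).2.2.2.2.1
          rw [abs_of_nonneg (Real.rpow_nonneg b0.le _)]
          have b2 : z m w / p m ≤ 0 := div_nonpos_of_nonpos_of_nonneg (m1 w hw).2.2.2.1 pm.le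
          exact Real.rpow_le_one b0.le (by linarith) (by linarith)
        calc _ = |((1 + z n w / p n) ^ (p n - 1) - (1 + z m w / p m) ^ (p m - 1)) * pd k (z n) w
              - (1 + z m w / p m) ^ (p m - 1) * (pd k (z m) w - pd k (z n) w)| := by
              congr 1; ring
          _ ≤ |(1 + z n w / p n) ^ (p n - 1) - (1 + z m w / p m) ^ (p m - 1)| * |pd k (z n) w|
              + |(1 + z m w / p m) ^ (p m - 1)| * |pd k (z m) w - pd k (z n) w| := by
              rw [← abs_mul, ← abs_mul]; exact abs_sub _ _
          _ ≤ |(1 + z n w / p n) ^ (p n - 1) - (1 + z m w / p m) ^ (p m - 1)| * C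
              + 1 * (ε / 400) := by gcongr
          _ ≤ _ := by linarith) i j x hx
  have hx3 : x ∈ closedBall (0 : R2) (R + 3) := closedBall_subset_closedBall (by linarith) hx
  have hpdj : pd j (fun x => z m x - z n x) =ᶠ[𝓝 x] fun x => pd j (z m) x - pd j (z n) x := by
    filter_upwards [(m1 x hx3).1.eventually_differentiableAt,
      (n1 x hx3).1.eventually_differentiableAt] with y h1 h2 using pd_sub h1 h2
  rw [hpdj.pd_eq, pd_sub (m1 x hx3).1.differentiableAt_pd (n1 x hx3).1.differentiableAt_pd] at key
  rw [Real.dist_eq]; linarith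

/-- The linear form with the given partial derivatives. -/
def linForm (a b : ℝ) : R2 →L[ℝ] ℝ :=
  a • (EuclideanSpace.proj 0 : R2 →L[ℝ] ℝ) + b • (EuclideanSpace.proj 1 : R2 →L[ℝ] ℝ)

lemma linForm_apply (a b : ℝ) (v : R2) : linForm a b v = a * v 0 + b * v 1 := by
  simp [linForm]

lemma fderiv_eq_linForm (f : R2 → ℝ) (x : R2) :
    fderiv ℝ f x = linForm (pd 0 f x) (pd 1 f x) := by
  ext v
  rw [fderiv_apply_eq, linForm_apply]; ring

lemma norm_linForm_le {a b A : ℝ} (ha : |a| ≤ A) (hb : |b| ≤ A) : ‖linForm a b‖ ≤ 2 * A := by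
  have hA : 0 ≤ A := (abs_nonneg _).trans ha
  refine ContinuousLinearMap.opNorm_le_bound _ (by positivity) fun v => ?_
  rw [linForm_apply, Real.norm_eq_abs]
  calc |a * v 0 + b * v 1| ≤ |a| * |v 0| + |b| * |v 1| := by
        rw [← abs_mul, ← abs_mul]; exact abs_add_le _ _
    _ ≤ A * ‖v‖ + A * ‖v‖ := by
        gcongr
        exacts [abs_coord_le_norm 0 v, abs_coord_le_norm 1 v]
    _ = _ := by ring

lemma linForm_sub (a b a' b' : ℝ) : linForm a b - linForm a' b' = linForm (a - a') (b - b') := by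
  ext v; simp only [sub_apply, linForm_apply]; ring

lemma pd_eq_of_hasFDerivAt {f : R2 → ℝ} {a : Fin 2 → ℝ} {x : R2}
    (h : HasFDerivAt f (linForm (a 0) (a 1)) x) (i : Fin 2) : pd i f x = a i := by
  rw [pd, h.fderiv, linForm_apply]
  fin_cases i <;> simp

lemma contDiff_one_of_pd {f : R2 → ℝ} (hd : Differentiable ℝ f) (hc : ∀ i, Continuous (pd i f)) :
    ContDiff ℝ 1 f := by
  rw [contDiff_one_iff_fderiv]
  refine ⟨hd, ?_⟩
  have : fderiv ℝ f = fun x => linForm (pd 0 f x) (pd 1 f x) := funext (fderiv_eq_linForm f)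
  rw [this]
  have h0 := hc 0; have h1 := hc 1
  unfold linForm; fun_prop

lemma contDiff_two_of_pd {f : R2 → ℝ} (hd : Differentiable ℝ f) (hc : ∀ i, ContDiff ℝ 1 (pd i f)) :
    ContDiff ℝ 2 f := by
  rw [show (2 : WithTop ℕ∞) = 1 + 1 by norm_num, contDiff_succ_iff_fderiv]
  refine ⟨hd, by simp, ?_⟩
  have : fderiv ℝ f = fun x => linForm (pd 0 f x) (pd 1 f x) := funext (fderiv_eq_linForm f)
  rw [this]
  have h0 := hc 0; have h1 := hc 1
  unfold linForm; fun_prop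

lemma closedBall_mem_nhds_norm (x : R2) : closedBall (0 : R2) (‖x‖ + 1) ∈ 𝓝 x := by
  refine mem_of_superset (closedBall_mem_nhds x one_pos) (closedBall_subset_of_mem (by simp))

lemma exists_tendstoUniformlyOn {F : ℕ → R2 → ℝ}
    (h : ∀ R, UniformCauchySeqOn F atTop (closedBall (0 : R2) R)) :
    ∃ g, ∀ R, TendstoUniformlyOn F g atTop (closedBall (0 : R2) R) := by
  choose g hg using fun x : R2 => cauchySeq_tendsto_of_complete
    ((h ‖x‖).cauchySeq (x := x) (by simp))
  exact ⟨g, fun R => (h R).tendstoUniformlyOn_of_tendsto fun x _ => hg x⟩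

lemma continuous_of_tendstoUniformlyOn {F : ℕ → R2 → ℝ} {g : R2 → ℝ}
    (h : ∀ R, TendstoUniformlyOn F g atTop (closedBall (0 : R2) R))
    (hF : ∀ R, ∀ᶠ n in atTop, ∀ x ∈ closedBall (0 : R2) R, ContinuousAt (F n) x) : Continuous g := by
  rw [continuous_iff_continuousAt]
  intro x
  refine ((h (‖x‖ + 1)).continuousOn ?_).continuousAt (closedBall_mem_nhds_norm x)
  refine Eventually.frequently ?_
  filter_upwards [hF (‖x‖ + 1)] with n hn using fun y hy => (hn y hy).continuousWithinAt

lemma hasFDerivAt_of_tendstoUniformlyOn_pd {F : ℕ → R2 → ℝ} {g : R2 → ℝ} {g' : Fin 2 → R2 → ℝ}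
    (h : ∀ R, TendstoUniformlyOn F g atTop (closedBall (0 : R2) R))
    (h' : ∀ i R, TendstoUniformlyOn (fun n => pd i (F n)) (g' i) atTop (closedBall (0 : R2) R))
    (hF : ∀ R, ∀ᶠ n in atTop, ∀ x ∈ closedBall (0 : R2) R, DifferentiableAt ℝ (F n) x) (x : R2) :
    HasFDerivAt g (linForm (g' 0 x) (g' 1 x)) x := by
  have hmem := closedBall_mem_nhds_norm x
  refine hasFDerivAt_of_tendstoUniformlyOnFilter (l := atTop) (f := F)
    (f' := fun n y => fderiv ℝ (F n) y) (g' := fun y => linForm (g' 0 y) (g' 1 y)) ?_ ?_ ?_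
  · have : TendstoUniformlyOn (fun n y => fderiv ℝ (F n) y) (fun y => linForm (g' 0 y) (g' 1 y))
        atTop (closedBall (0 : R2) (‖x‖ + 1)) := by
      rw [Metric.tendstoUniformlyOn_iff]
      intro ε hε
      filter_upwards [Metric.tendstoUniformlyOn_iff.1 (h' 0 (‖x‖ + 1)) (ε / 4) (by positivity),
        Metric.tendstoUniformlyOn_iff.1 (h' 1 (‖x‖ + 1)) (ε / 4) (by positivity)] with n h0 h1 y hy
      rw [dist_eq_norm, fderiv_eq_linForm, linForm_sub]
      have a0 := (h0 y hy).le
      have a1 := (h1 y hy).le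
      rw [Real.dist_eq] at a0 a1
      linarith [norm_linForm_le a0 a1]
    exact this.tendstoUniformlyOnFilter.mono_right (le_principal_iff.2 hmem)
  · rw [eventually_prod_iff]
    exact ⟨_, hF (‖x‖ + 1), _, hmem, fun hn _ hy => (hn _ hy).hasFDerivAt⟩
  · exact Eventually.of_forall fun y => (h ‖y‖).tendsto_at (by simp)

lemma norm_iteratedFDeriv_le {h : R2 → ℝ} {x : R2} (hh : ContDiffAt ℝ 2 h x) {A : ℝ}
    (h0 : |h x| ≤ A) (h1 : ∀ i, |pd i h x| ≤ A) (h2 : ∀ i j, |pd i (pd j h) x| ≤ A) {k : ℕ}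
    (hk : k ≤ 2) : ‖iteratedFDeriv ℝ k h x‖ ≤ 4 * A := by
  have hA : 0 ≤ A := (abs_nonneg _).trans h0
  interval_cases k
  · rw [norm_iteratedFDeriv_zero, Real.norm_eq_abs]; linarith
  · rw [norm_iteratedFDeriv_one]; linarith [norm_fderiv_le h1]
  · rw [← norm_iteratedFDeriv_fderiv, norm_iteratedFDeriv_one]
    have hd : DifferentiableAt ℝ (fderiv ℝ h) x :=
      (hh.fderiv_right (m := 1) (by norm_num)).differentiableAt (by norm_num)
    refine ContinuousLinearMap.opNorm_le_bound _ (by positivity) fun v => ?_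
    have key : ∀ j, fderiv ℝ (fderiv ℝ h) x v (EuclideanSpace.single j 1) =
        fderiv ℝ (pd j h) x v := by
      intro j
      have : HasFDerivAt (pd j h) ((ContinuousLinearMap.apply ℝ ℝ
          (EuclideanSpace.single j (1 : ℝ))).comp (fderiv ℝ (fderiv ℝ h) x)) x :=
        (ContinuousLinearMap.apply ℝ ℝ (EuclideanSpace.single j (1 : ℝ))).hasFDerivAt.comp x
          hd.hasFDerivAt
      rw [this.fderiv]; rfl
    have hv : ∀ j, |fderiv ℝ (fderiv ℝ h) x v (EuclideanSpace.single j 1)| ≤ 2 * A * ‖v‖ := by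
      intro j
      rw [key]
      exact ((fderiv ℝ (pd j h) x).le_opNorm v).trans
        (mul_le_mul_of_nonneg_right (norm_fderiv_le fun i => h2 i j) (norm_nonneg _))
    have hl : ∀ L : R2 →L[ℝ] ℝ, L =
        linForm (L (EuclideanSpace.single 0 1)) (L (EuclideanSpace.single 1 1)) := by
      intro L
      ext w
      have hw : w = w 0 • EuclideanSpace.single 0 (1 : ℝ) + w 1 • EuclideanSpace.single 1 (1 : ℝ) := by
        ext k; fin_cases k <;> simp
      conv_lhs => rw [hw]
      rw [linForm_apply, map_add, map_smul, map_smul, smul_eq_mul, smul_eq_mul]; ring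
    rw [hl (fderiv ℝ (fderiv ℝ h) x v)]
    linarith [norm_linForm_le (hv 0) (hv 1)]

lemma tendstoUniformlyOn_iteratedFDeriv {F : ℕ → R2 → ℝ} {g : R2 → ℝ} {R : ℝ} (hg : ContDiff ℝ 2 g)
    (hF : ∀ᶠ n in atTop, ∀ x ∈ closedBall (0 : R2) R, ContDiffAt ℝ 2 (F n) x)
    (h0 : TendstoUniformlyOn F g atTop (closedBall (0 : R2) R))
    (h1 : ∀ i, TendstoUniformlyOn (fun n => pd i (F n)) (pd i g) atTop (closedBall (0 : R2) R))
    (h2 : ∀ i j, TendstoUniformlyOn (fun n => pd i (pd j (F n))) (pd i (pd j g)) atTop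
      (closedBall (0 : R2) R)) {k : ℕ} (hk : k ≤ 2) :
    TendstoUniformlyOn (fun n x => iteratedFDeriv ℝ k (F n) x) (fun x => iteratedFDeriv ℝ k g x)
      atTop (closedBall (0 : R2) R) := by
  rw [Metric.tendstoUniformlyOn_iff]
  intro ε hε
  have h1' : ∀ᶠ n in atTop, ∀ i, ∀ x ∈ closedBall (0 : R2) R,
      dist (pd i g x) (pd i (F n) x) < ε / 5 := by
    rw [eventually_all]
    exact fun i => Metric.tendstoUniformlyOn_iff.1 (h1 i) (ε / 5) (by positivity)
  have h2' : ∀ᶠ n in atTop, ∀ i j, ∀ x ∈ closedBall (0 : R2) R,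
      dist (pd i (pd j g) x) (pd i (pd j (F n)) x) < ε / 5 := by
    rw [eventually_all]
    intro i
    rw [eventually_all]
    exact fun j => Metric.tendstoUniformlyOn_iff.1 (h2 i j) (ε / 5) (by positivity)
  filter_upwards [hF, Metric.tendstoUniformlyOn_iff.1 h0 (ε / 5) (by positivity), h1', h2']
    with n a b c d x hx
  have hgx : ContDiffAt ℝ 2 g x := hg.contDiffAt
  have hle : ((k : ℕ) : WithTop ℕ∞) ≤ 2 := by exact_mod_cast hk
  rw [dist_eq_norm, ← iteratedFDeriv_sub_apply (hgx.of_le hle) ((a x hx).of_le hle)]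
  have hpd : ∀ j, pd j (fun y => g y - F n y) =ᶠ[𝓝 x] fun y => pd j g y - pd j (F n) y := by
    intro j
    filter_upwards [hgx.eventually_differentiableAt, (a x hx).eventually_differentiableAt] with y
      h1 h2 using pd_sub h1 h2
  have := norm_iteratedFDeriv_le (h := fun y => g y - F n y) (hgx.sub (a x hx)) (A := ε / 5)
    (b x hx).le (fun i => by rw [(hpd i).self_of_nhds]; exact (c i x hx).le)
    (fun i j => by
      rw [(hpd j).pd_eq, pd_sub hgx.differentiableAt_pd (a x hx).differentiableAt_pd]
      exact (d i j x hx).le) hk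
  calc _ ≤ _ := this
    _ < ε := by linarith

theorem IsBlowUp.exists_subseq_bubble {z : ℕ → R2 → ℝ} {p : ℕ → ℝ} (h : IsBlowUp z p) :
    ∃ φ : ℕ → ℕ, StrictMono φ ∧ ∃ μ : ℝ, 0 < μ ∧ μ ≤ 1 ∧
      (∀ R, ∀ k ≤ 2, TendstoUniformlyOn (fun n x => iteratedFDeriv ℝ k (z (φ n)) x)
        (fun x => iteratedFDeriv ℝ k (bubble μ) x) atTop (closedBall (0 : R2) R)) ∧
      (Tendsto (fun n => z n 0) atTop (𝓝 0) → μ = 1) := by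
  obtain ⟨φ, hφ, g, hg⟩ := exists_subseq_tendstoUniformlyOn (z := z)
    (fun R => by
      obtain ⟨C, _, hC⟩ := h.exists_estimates R
      refine ⟨C, ?_⟩
      filter_upwards [hC] with n hn x hx using (hn.2 x hx).2.2.1)
    (fun R => by
      obtain ⟨C, _, hC⟩ := h.exists_estimates R
      refine ⟨2 * C, ?_⟩
      filter_upwards [hC] with n hn x hx y hy
      exact abs_sub_le_of_pd_le (convex_closedBall (0 : R2) R)
        (fun x hx => (hn.2 x hx).1.differentiableAt (by norm_num))
        (fun i x hx => (hn.2 x hx).2.2.2.2.2.2.2 i) hx hy)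
  have h' := h.comp hφ
  set w : ℕ → R2 → ℝ := fun n => z (φ n)
  set q : ℕ → ℝ := fun n => p (φ n)
  have hc : ∀ R, UniformCauchySeqOn w atTop (closedBall (0 : R2) R) := fun R =>
    (hg R).uniformCauchySeqOn
  have hC2 : ∀ R, ∀ᶠ n in atTop, ∀ x ∈ closedBall (0 : R2) R, ContDiffAt ℝ 2 (w n) x := by
    intro R
    obtain ⟨A, hA⟩ := h'.bound R
    filter_upwards [hA] with n hn x hx using (hn x hx).1
  choose g1 hg1 using fun i => exists_tendstoUniformlyOn (h'.uniformCauchySeqOn_pd hc i)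
  choose g2 hg2 using fun j i => exists_tendstoUniformlyOn (h'.uniformCauchySeqOn_pd_pd hc i j)
  have d1 : ∀ x, HasFDerivAt g (linForm (g1 0 x) (g1 1 x)) x :=
    hasFDerivAt_of_tendstoUniformlyOn_pd hg hg1 fun R => by
      filter_upwards [hC2 R] with n hn x hx using (hn x hx).differentiableAt (by norm_num)
  have d2 : ∀ j x, HasFDerivAt (g1 j) (linForm (g2 j 0 x) (g2 j 1 x)) x := fun j =>
    hasFDerivAt_of_tendstoUniformlyOn_pd (hg1 j) (hg2 j) fun R => by
      filter_upwards [hC2 R] with n hn x hx using (hn x hx).differentiableAt_pd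
  have e1 : ∀ i, pd i g = g1 i := fun i => funext fun x =>
    pd_eq_of_hasFDerivAt (a := fun i => g1 i x) (d1 x) i
  have e2 : ∀ i j, pd i (pd j g) = g2 j i := fun i j => funext fun x => by
    rw [e1]
    exact pd_eq_of_hasFDerivAt (a := fun i => g2 j i x) (d2 j x) i
  have c2 : ∀ i j, Continuous (g2 j i) := fun i j =>
    continuous_of_tendstoUniformlyOn (hg2 j i) fun R => by
      filter_upwards [hC2 R] with n hn x hx using (hn x hx).pd_one.continuousAt_pd
  have hg2' : ContDiff ℝ 2 g := by
    refine contDiff_two_of_pd (fun x => (d1 x).differentiableAt) fun j => ?_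
    refine contDiff_one_of_pd ?_ fun i => by rw [e2]; exact c2 i j
    rw [e1]; exact fun x => (d2 j x).differentiableAt
  have hpt : ∀ x, Tendsto (fun n => w n x) atTop (𝓝 (g x)) := fun x =>
    (hg ‖x‖).tendsto_at (by simp)
  have hf : ∀ R, TendstoUniformlyOn (fun n x => (1 + w n x / q n) ^ q n) (fun x => Real.exp (g x))
      atTop (closedBall (0 : R2) R) := by
    intro R
    refine (h'.uniformCauchySeqOn_nonlinearity hc R).1.tendstoUniformlyOn_of_tendsto fun x hx => ?_
    obtain ⟨C, _, hC⟩ := h'.exists_estimates R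
    have hlim : Tendsto (fun n => C / q n) atTop (𝓝 0) := tendsto_const_nhds.div_atTop h'.tendsto
    have h1 : Tendsto (fun n => (1 + w n x / q n) ^ q n - Real.exp (w n x)) atTop (𝓝 0) := by
      refine squeeze_zero_norm' ?_ hlim
      filter_upwards [hC] with n hn using (hn.2 x hx).2.2.2.2.2.1
    have h2 := h1.add ((Real.continuous_exp.tendsto (g x)).comp (hpt x))
    simpa using h2
  have hnp : ∀ x, g x ≤ 0 := by
    intro x
    refine le_of_tendsto (hpt x) ?_
    obtain ⟨A, hA⟩ := h'.bound ‖x‖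
    filter_upwards [hA] with n hn using (hn x (by simp)).2.2.2.2
  have hmax : ∀ x, g x ≤ g 0 := by
    intro x
    refine le_of_tendsto_of_tendsto (hpt x) (hpt 0) ?_
    obtain ⟨A, hA⟩ := h'.bound ‖x‖
    filter_upwards [hA] with n hn using (hn x (by simp)).2.2.2.1
  have hlap : ∀ x, lap g x = -Real.exp (g x) := by
    intro x
    have h1 : Tendsto (fun n => lap (w n) x) atTop (𝓝 (lap g x)) := by
      simp only [lap_eq, e2]
      exact ((hg2 0 0 ‖x‖).tendsto_at (by simp)).add ((hg2 1 1 ‖x‖).tendsto_at (by simp))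
    have h2 : Tendsto (fun n => -(1 + w n x / q n) ^ q n) atTop (𝓝 (-Real.exp (g x))) :=
      ((hf ‖x‖).tendsto_at (by simp)).neg
    refine tendsto_nhds_unique h1 (h2.congr' ?_)
    obtain ⟨A, hA⟩ := h'.bound ‖x‖
    filter_upwards [hA] with n hn using (hn x (by simp)).2.1.symm
  have hgc : Continuous fun x => Real.exp (g x) := Real.continuous_exp.comp hg2'.continuous
  have hint : Integrable fun x => Real.exp (g x) := by
    obtain ⟨E, hE⟩ := h'.mass
    refine (aecover_closedBall (μ := (volume : Measure R2)) (x := (0 : R2)) (l := atTop)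
      (r := fun n : ℕ => (n : ℝ)) tendsto_natCast_atTop_atTop).integrable_of_integral_norm_bounded
      (E + 1) (fun n => hgc.continuousOn.integrableOn_compact (isCompact_closedBall _ _)) ?_
    refine Eventually.of_forall fun N => ?_
    set V := volume.real (closedBall (0 : R2) N)
    have hV : 0 ≤ V := measureReal_nonneg
    obtain ⟨C, _, hC⟩ := h'.exists_estimates N
    obtain ⟨n, hn1, hn2, hn3⟩ := ((hE N).and (hC.and (Metric.tendstoUniformlyOn_iff.1 (hf N)
      (1 / (V + 1)) (by positivity)))).exists
    have hfin : IsFiniteMeasure (volume.restrict (closedBall (0 : R2) (N : ℝ))) :=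
      ⟨by rw [Measure.restrict_apply_univ]; exact (isCompact_closedBall (0 : R2) (N : ℝ)).measure_lt_top⟩
    have hci : IntegrableOn (fun x => (1 + w n x / q n) ^ q n) (closedBall (0 : R2) N) volume := by
      refine ContinuousOn.integrableOn_compact (isCompact_closedBall _ _) fun x hx => ?_
      have hx' := hn2.2 x hx
      refine ContinuousAt.continuousWithinAt ?_
      exact ((hx'.1.continuousAt.div_const _).const_add 1).rpow_const (Or.inl hx'.2.2.2.2.1.ne')
    calc ∫ x in closedBall (0 : R2) N, ‖Real.exp (g x)‖
        ≤ ∫ x in closedBall (0 : R2) N, ((1 + w n x / q n) ^ q n + 1 / (V + 1)) := by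
          refine setIntegral_mono_on
            (hgc.norm.continuousOn.integrableOn_compact (isCompact_closedBall _ _))
            (hci.add (integrable_const _)) measurableSet_closedBall fun x hx => ?_
          have := hn3 x hx
          rw [Real.dist_eq, abs_lt] at this
          rw [Real.norm_eq_abs, Real.abs_exp]
          linarith [this.2]
      _ = (∫ x in closedBall (0 : R2) N, (1 + w n x / q n) ^ q n) + V * (1 / (V + 1)) := by
          rw [integral_add hci (integrable_const _), setIntegral_const, smul_eq_mul]
      _ ≤ E + 1 := by
          refine add_le_add hn1 ?_
          rw [mul_one_div, div_le_one (by positivity)]; linarith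
  have hsol : IsLiouvilleSol g := ⟨hg2', hlap, hnp, hint⟩
  have hbub := hsol.eq_bubble hmax
  refine ⟨φ, hφ, Real.exp (g 0), Real.exp_pos _, Real.exp_le_one_iff.2 (hnp 0), ?_, ?_⟩
  · intro R k hk
    rw [← hbub]
    exact tendstoUniformlyOn_iteratedFDeriv hg2' (hC2 R) (hg R)
      (fun i => by rw [e1]; exact hg1 i R) (fun i j => by rw [e2]; exact hg2 j i R) hk
  · intro h0
    rw [tendsto_nhds_unique (hpt 0) (h0.comp hφ.tendsto_atTop), Real.exp_zero]

lemma IsSolution.contDiffAt {Ω : Set R2} {p : ℝ} {u : R2 → ℝ} (h : IsSolution Ω p u)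
    (hop : IsOpen Ω) {x : R2} (hx : x ∈ Ω) : ContDiffAt ℝ 2 u x :=
  h.1.contDiffAt (hop.mem_nhds hx)

lemma IsSolution.continuousOn {Ω : Set R2} {p : ℝ} {u : R2 → ℝ} (h : IsSolution Ω p u) :
    ContinuousOn u (closure Ω) := h.2.1.continuousOn

lemma IsSolution.eq_zero {Ω : Set R2} {p : ℝ} {u : R2 → ℝ} (h : IsSolution Ω p u)
    (hop : IsOpen Ω) {x : R2} (hx : x ∈ closure Ω) (hx' : x ∉ Ω) : u x = 0 :=
  h.2.2.2 x (by rw [hop.frontier_eq]; exact ⟨hx, hx'⟩)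

/-- The maximum of a solution of the Lane–Emden problem cannot be too small. -/
lemma IsSolution.four_le {Ω : Set R2} {p M R : ℝ} {u : R2 → ℝ} (h : IsSolution Ω p u)
    (hop : IsOpen Ω) (hp : 1 < p) (hR : 0 < R) (hΩ : Ω ⊆ ball 0 R) {x₀ : R2} (hx₀ : x₀ ∈ Ω)
    (hM : 0 < M) (hux : u x₀ = M) (hu : ∀ x ∈ Ω, |u x| ≤ M) : 4 ≤ R ^ 2 * M ^ (p - 1) := by
  by_contra! hlt
  have hcl : closure Ω ⊆ closedBall 0 R :=
    closure_minimal (hΩ.trans ball_subset_closedBall) isClosed_closedBall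
  have hc : IsCompact (closure Ω) :=
    (isCompact_closedBall (0 : R2) R).of_isClosed_subset isClosed_closure hcl
  have hnorm : ∀ x : R2, x 0 ^ 2 + x 1 ^ 2 = ‖x‖ ^ 2 := fun x => by
    simp [EuclideanSpace.norm_sq_eq]
  have hlt' : M ^ (p - 1) * M / 4 < M / R ^ 2 := by
    rw [lt_div_iff₀ (by positivity)]; nlinarith
  obtain ⟨A, hA1, hA2⟩ := exists_between hlt'
  have hA0 : 0 < A := lt_of_le_of_lt (by positivity) hA1
  have key := nonpos_of_lap_pos hc
    (w := fun x => u x + (A * x 0 ^ 2 + (A * x 1 ^ 2 + -(A * R ^ 2)))) ?_ ?_ x₀ (subset_closure hx₀)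
  · simp only at key
    rw [lt_div_iff₀ (by positivity)] at hA2
    nlinarith [hnorm x₀, sq_nonneg ‖x₀‖]
  · have h0 := (differentiable_coord 0).continuous
    have h1 := (differentiable_coord 1).continuous
    exact h.continuousOn.add (Continuous.continuousOn (by fun_prop))
  · intro x hx
    by_cases hxΩ : x ∈ Ω
    · right
      have hu2 := h.contDiffAt hop hxΩ
      have hs : ∀ i, ContDiffAt ℝ 2 (fun y : R2 => y i ^ 2) x := fun i =>
        ((contDiff_coord i).pow 2).contDiffAt
      have c1 : ∀ i, ContDiffAt ℝ 2 (fun y : R2 => A * y i ^ 2) x := fun i =>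
        contDiffAt_const.mul (hs i)
      have c2 : ContDiffAt ℝ 2 (fun y : R2 => A * y 1 ^ 2 + -(A * R ^ 2)) x :=
        (c1 1).add contDiffAt_const
      have c3 : ContDiffAt ℝ 2 (fun y : R2 => A * y 0 ^ 2 + (A * y 1 ^ 2 + -(A * R ^ 2))) x :=
        (c1 0).add c2
      refine ⟨mem_of_superset (hop.mem_nhds hxΩ) subset_closure, hu2.add c3, ?_⟩
      rw [lap_add hu2 c3, lap_add (c1 0) c2, lap_add (c1 1) contDiffAt_const,
        lap_const_mul (hs 0), lap_const_mul (hs 1), lap_const, lap_coord_sq, lap_coord_sq]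
      have he := h.2.2.1 x hxΩ
      have hb : |u x| ^ (p - 1) * u x ≤ M ^ (p - 1) * M :=
        (mul_le_mul_of_nonneg_left (le_abs_self _) (by positivity)).trans
          (mul_le_mul (Real.rpow_le_rpow (abs_nonneg _) (hu x hxΩ) (by linarith)) (hu x hxΩ)
            (abs_nonneg _) (by positivity))
      linarith
    · left
      rw [h.eq_zero hop hx hxΩ]
      have := hcl hx
      rw [mem_closedBall_zero_iff] at this
      have h2 : ‖x‖ ^ 2 ≤ R ^ 2 := pow_le_pow_left₀ (norm_nonneg _) this 2
      nlinarith [hnorm x]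

/-- Quantitative local graph property of a smooth compact boundary. -/
lemma SmoothBoundary.exists_uniform {Ω : Set R2} (hsm : SmoothBoundary Ω)
    (hbdd : Bornology.IsBounded Ω) :
    ∃ Λ δ : ℝ, 0 < Λ ∧ 0 < δ ∧ ∀ y ∈ frontier Ω, ∀ d, 0 < d → d < δ → ∃ b : R2, ‖b‖ = 1 ∧
      ∀ P : R2, ‖P - y‖ ≤ 2 * d → ∃ σ : ℝ, |σ| ≤ Λ * d ∧ P + σ • b ∈ frontier Ω := by
  have hc : IsCompact (frontier Ω) :=
    isCompact_of_isClosed_isBounded isClosed_frontier (hbdd.closure.subset frontier_subset_closure)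
  refine hc.induction_on (p := fun S => ∃ Λ δ : ℝ, 0 < Λ ∧ 0 < δ ∧ ∀ y ∈ S, ∀ d, 0 < d → d < δ →
    ∃ b : R2, ‖b‖ = 1 ∧ ∀ P : R2, ‖P - y‖ ≤ 2 * d →
      ∃ σ : ℝ, |σ| ≤ Λ * d ∧ P + σ • b ∈ frontier Ω)
    ⟨1, 1, one_pos, one_pos, fun y hy => absurd hy (notMem_empty y)⟩ ?_ ?_ ?_
  · rintro s t hst ⟨Λ, δ, h1, h2, h3⟩
    exact ⟨Λ, δ, h1, h2, fun y hy => h3 y (hst hy)⟩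
  · rintro s t ⟨Λ, δ, h1, h2, h3⟩ ⟨Λ', δ', h1', h2', h3'⟩
    refine ⟨max Λ Λ', min δ δ', lt_max_of_lt_left h1, lt_min h2 h2', ?_⟩
    rintro y (hy | hy) d hd hd'
    · obtain ⟨b, hb, h⟩ := h3 y hy d hd (hd'.trans_le (min_le_left _ _))
      refine ⟨b, hb, fun P hP => ?_⟩
      obtain ⟨σ, hσ, h⟩ := h P hP
      exact ⟨σ, hσ.trans (mul_le_mul_of_nonneg_right (le_max_left _ _) hd.le), h⟩
    · obtain ⟨b, hb, h⟩ := h3' y hy d hd (hd'.trans_le (min_le_right _ _))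
      refine ⟨b, hb, fun P hP => ?_⟩
      obtain ⟨σ, hσ, h⟩ := h P hP
      exact ⟨σ, hσ.trans (mul_le_mul_of_nonneg_right (le_max_right _ _) hd.le), h⟩
  · intro x hx
    obtain ⟨V, hV, hxV, e, g, hg, hgraph⟩ := hsm x hx
    obtain ⟨L, t, ht, hL⟩ := (hg.contDiffAt (x := e x 0)).of_le
      (m := 1) (by exact_mod_cast le_top) |>.exists_lipschitzOnWith
    obtain ⟨r0, hr0, hr0V⟩ := Metric.isOpen_iff.1 hV x hxV
    obtain ⟨r1, hr1, hr1t⟩ := Metric.mem_nhds_iff.1 ht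
    set r := min r0 r1
    have hr : 0 < r := lt_min hr0 hr1
    set Λ : ℝ := 2 * (L + 1)
    have hΛ : 0 < Λ := by positivity
    set δ : ℝ := r / (2 * (2 + Λ))
    have hδ : 0 < δ := by positivity
    have hδr : (2 + Λ) * δ = r / 2 := by simp only [δ]; field_simp
    refine ⟨ball x (r / 2) ∩ frontier Ω,
      inter_mem (mem_nhdsWithin_of_mem_nhds (ball_mem_nhds x (half_pos hr))) self_mem_nhdsWithin, Λ, δ, hΛ, hδ, ?_⟩
    rintro y ⟨hyx, hyΩ⟩ d hd hdδ
    have hcoord : ∀ (A B : R2) (i : Fin 2), |e A i - e B i| ≤ ‖A - B‖ := fun A B i => by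
      have h1 := abs_coord_le_norm i (e A - e B)
      rwa [← dist_eq_norm, e.isometry.dist_eq, dist_eq_norm] at h1
    have hrd : (2 + Λ) * d < r / 2 := by rw [← hδr]; gcongr
    rw [mem_ball, dist_eq_norm] at hyx
    have hyV : y ∈ V := hr0V (by
      rw [mem_ball, dist_eq_norm]; linarith [min_le_left r0 r1])
    have hyg : e y 1 = g (e y 0) := by
      have : y ∈ frontier Ω ∩ V := ⟨hyΩ, hyV⟩
      rw [hgraph] at this
      exact this.2
    set eA := e.toRealAffineIsometryEquiv
    have heA : ∀ z, eA z = e z := fun z => rfl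
    set b : R2 := eA.linearIsometryEquiv.symm (EuclideanSpace.single 1 1)
    have he : ∀ (P : R2) (σ : ℝ), e (P + σ • b) = e P + σ • EuclideanSpace.single 1 1 := by
      intro P σ
      have := eA.map_vadd P (σ • b)
      rw [map_smul, LinearIsometryEquiv.apply_symm_apply] at this
      simp only [vadd_eq_add, heA] at this
      rw [add_comm P, this, add_comm]
    refine ⟨b, by simp [b], fun P hP => ⟨g (e P 0) - e P 1, ?_, ?_⟩⟩
    all_goals
      have hPx : ‖P - x‖ ≤ ‖P - y‖ + ‖y - x‖ := norm_sub_le_norm_sub_add_norm_sub P y x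
      have hmem : ∀ z : R2, ‖z - x‖ < r → e z 0 ∈ t := fun z hz => hr1t (by
        rw [mem_ball, Real.dist_eq]
        exact (hcoord z x 0).trans_lt (hz.trans_le (min_le_right _ _)))
      have hg1 := hL.dist_le_mul _ (hmem P (by nlinarith)) _ (hmem y (by linarith))
      have hσ : |g (e P 0) - e P 1| ≤ Λ * d := by
        have e1 : g (e P 0) - e P 1 = (g (e P 0) - g (e y 0)) + (e y 1 - e P 1) := by rw [hyg]; ring
        rw [Real.dist_eq, Real.dist_eq] at hg1
        have h2 := hcoord P y 0
        have h3 := hcoord y P 1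
        rw [norm_sub_rev] at h3
        rw [e1]
        refine (abs_add_le _ _).trans ?_
        have : (L : ℝ) * |e P 0 - e y 0| ≤ L * (2 * d) := by gcongr; linarith
        simp only [Λ]
        nlinarith
    · exact hσ
    · have hQ : P + (g (e P 0) - e P 1) • b ∈ V := hr0V (by
        rw [mem_ball, dist_eq_norm]
        have : ‖P + (g (e P 0) - e P 1) • b - x‖ ≤ ‖P - x‖ + |g (e P 0) - e P 1| := by
          rw [add_sub_right_comm]
          refine (norm_add_le _ _).trans ?_
          rw [norm_smul]; simp [b]
        have h4 : r ≤ r0 := min_le_left _ _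
        nlinarith)
      have : P + (g (e P 0) - e P 1) • b ∈ {y | y ∈ V ∧ e y 1 = g (e y 0)} := by
        refine ⟨hQ, ?_⟩
        rw [he]; simp
      rw [← hgraph] at this
      exact this.1

/-- The size of the gradient of `u` in `Ω`, extended by zero. -/
def gradENorm (Ω : Set R2) (u : R2 → ℝ) : R2 → ENNReal := Ω.indicator fun x => ‖fderiv ℝ u x‖ₑ

lemma measurable_gradENorm {Ω : Set R2} (hop : IsOpen Ω) (u : R2 → ℝ) :
    Measurable (gradENorm Ω u) :=
  (measurable_fderiv ℝ u).enorm.indicator hop.measurableSet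

lemma enorm_le_lintegral_ray {Ω : Set R2} {p : ℝ} {u : R2 → ℝ} (h : IsSolution Ω p u)
    (hop : IsOpen Ω) {P v : R2} (hv : ‖v‖ = 1) {σ ℓ : ℝ} (hP : P ∈ Ω) (hσ : 0 ≤ σ) (hσℓ : σ ≤ ℓ)
    (hout : P + σ • v ∉ Ω) : ‖u P‖ₑ ≤ ∫⁻ r in Icc 0 ℓ, gradENorm Ω u (P + r • v) := by
  have hγ : Continuous fun r : ℝ => P + r • v := by fun_prop
  set T : Set ℝ := Icc 0 σ ∩ (fun r : ℝ => P + r • v) ⁻¹' Ωᶜ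
  have hT : IsCompact T := isCompact_Icc.inter_right (hop.isClosed_compl.preimage hγ)
  have hTne : T.Nonempty := ⟨σ, ⟨hσ, le_rfl⟩, hout⟩
  have hs := hT.sInf_mem hTne
  set s := sInf T
  have hin : ∀ r ∈ Ico 0 s, P + r • v ∈ Ω := by
    intro r hr
    by_contra hr'
    exact absurd (csInf_le hT.bddBelow ⟨⟨hr.1, hr.2.le.trans hs.1.2⟩, hr'⟩) (not_le.2 hr.2)
  have hs0 : 0 < s := by
    rcases hs.1.1.eq_or_lt with h0 | h0
    · exact absurd hP (by simpa [← h0] using hs.2)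
    · exact h0
  have hcl : ∀ r ∈ Icc 0 s, P + r • v ∈ closure Ω := by
    have h1 : MapsTo (fun r : ℝ => P + r • v) (closure (Ico 0 s)) (closure Ω) :=
      MapsTo.closure (fun r hr => hin r hr) hγ
    rwa [closure_Ico hs0.ne] at h1
  have hγ1 : ContDiff ℝ 1 fun r : ℝ => P + r • v := by fun_prop
  have hf : ContDiffOn ℝ 1 (fun r : ℝ => u (P + r • v)) (Icc 0 s) :=
    h.2.1.comp hγ1.contDiffOn hcl
  have hus : u (P + s • v) = 0 := h.eq_zero hop (hcl s ⟨hs0.le, le_rfl⟩) hs.2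
  have key := enorm_sub_le_lintegral_deriv_of_contDiffOn_Icc hf hs0.le
  simp only [hus, zero_smul, add_zero, zero_sub, enorm_neg] at key
  refine key.trans ?_
  rw [setLIntegral_congr Ioo_ae_eq_Icc.symm]
  refine (setLIntegral_mono' measurableSet_Ioo fun r hr => ?_).trans
    (lintegral_mono_set (Ioo_subset_Icc_self.trans (Icc_subset_Icc le_rfl (hs.1.2.trans hσℓ))))
  have hr' := hin r ⟨hr.1.le, hr.2⟩
  have hd : HasDerivAt (fun r : ℝ => P + r • v) v r := by
    simpa using ((hasDerivAt_id r).smul_const v).const_add P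
  have := ((h.contDiffAt hop hr').differentiableAt (by norm_num)).hasFDerivAt.comp_hasDerivAt r hd
  have h2 : deriv (fun r : ℝ => u (P + r • v)) r = fderiv ℝ u (P + r • v) v := this.deriv
  rw [h2, gradENorm, indicator_of_mem hr', enorm_le_iff_norm_le]
  simpa [hv] using (fderiv ℝ u (P + r • v)).le_opNorm v

lemma ENNReal.le_mul_sq_add_inv (g : ENNReal) {c : NNReal} (hc : 0 < c) :
    g ≤ c * g ^ 2 + (c : ENNReal)⁻¹ := by
  rcases le_total g (c : ENNReal)⁻¹ with h | h
  · exact h.trans le_add_self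
  · refine le_add_right ?_
    have hc0 : (c : ENNReal) ≠ 0 := by exact_mod_cast hc.ne'
    calc g = c * ((c : ENNReal)⁻¹ * g) := by
          rw [← mul_assoc, ENNReal.mul_inv_cancel hc0 ENNReal.coe_ne_top, one_mul]
      _ ≤ c * g ^ 2 := by rw [sq]; gcongr

lemma lintegral_gradENorm_sq {Ω : Set R2} (hop : IsOpen Ω) {u : R2 → ℝ}
    (hint : IntegrableOn (fun x => ‖gradient u x‖ ^ 2) Ω) :
    ∫⁻ x, gradENorm Ω u x ^ 2 = ENNReal.ofReal (∫ x in Ω, ‖gradient u x‖ ^ 2) := by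
  rw [ofReal_integral_eq_lintegral_ofReal hint (Eventually.of_forall fun x => by positivity),
    ← lintegral_indicator hop.measurableSet]
  refine lintegral_congr fun x => ?_
  by_cases hx : x ∈ Ω
  · rw [gradENorm, indicator_of_mem hx, indicator_of_mem hx, ENNReal.ofReal_pow (norm_nonneg _),
      ofReal_norm]
    congr 1
    rw [enorm_eq_iff_norm_eq, gradient, LinearIsometryEquiv.norm_map]
  · simp [gradENorm, hx]

lemma setLIntegral_gradENorm_le {Ω : Set R2} (hop : IsOpen Ω) {u : R2 → ℝ}
    (hint : IntegrableOn (fun x => ‖gradient u x‖ ^ 2) Ω) {c : ℝ} (hc : 0 < c) {B : Set R2}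
    (hB : volume B ≠ ⊤) (w : R2) :
    ∫⁻ P in B, gradENorm Ω u (P + w) ≤
      ENNReal.ofReal (c * (∫ y in Ω, ‖gradient u y‖ ^ 2) + c⁻¹ * volume.real B) := by
  have hG := measurable_gradENorm hop u
  have hE : 0 ≤ ∫ y in Ω, ‖gradient u y‖ ^ 2 := integral_nonneg fun y => by positivity
  obtain ⟨k, rfl⟩ : ∃ k : NNReal, (k : ℝ) = c := ⟨⟨c, hc.le⟩, rfl⟩
  have hk : 0 < k := by exact_mod_cast hc
  have hm : Measurable fun P => gradENorm Ω u (P + w) ^ 2 :=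
    (hG.comp (measurable_add_const w)).pow_const 2
  have h1 : ∫⁻ P, gradENorm Ω u (P + w) ^ 2 =
      ENNReal.ofReal (∫ y in Ω, ‖gradient u y‖ ^ 2) := by
    rw [lintegral_add_right_eq_self (fun P => gradENorm Ω u P ^ 2) w,
      lintegral_gradENorm_sq hop hint]
  have h2 : ∫⁻ P in B, (k * gradENorm Ω u (P + w) ^ 2 + (k : ENNReal)⁻¹) =
      k * (∫⁻ P in B, gradENorm Ω u (P + w) ^ 2) + (k : ENNReal)⁻¹ * volume B := by
    rw [lintegral_add_right _ measurable_const, lintegral_const_mul _ hm, setLIntegral_const]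
  have h3 : ENNReal.ofReal ((k : ℝ)⁻¹ * volume.real B) = (k : ENNReal)⁻¹ * volume B := by
    rw [ENNReal.ofReal_mul (by positivity), ENNReal.ofReal_inv_of_pos hc,
      ENNReal.ofReal_coe_nnreal, Measure.real, ENNReal.ofReal_toReal hB]
  rw [ENNReal.ofReal_add (by positivity) (by positivity), h3, ENNReal.ofReal_mul hc.le,
    ENNReal.ofReal_coe_nnreal, ← h1]
  refine (lintegral_mono fun P => ENNReal.le_mul_sq_add_inv _ hk).trans ?_
  rw [h2]
  exact add_le_add_left (mul_le_mul_right (setLIntegral_le_lintegral _ _) _) _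

lemma setIntegral_abs_le {Ω : Set R2} {p : ℝ} {u : R2 → ℝ} (h : IsSolution Ω p u)
    (hop : IsOpen Ω) (hint : IntegrableOn (fun x => ‖gradient u x‖ ^ 2) Ω) {x b : R2} {s ℓ c : ℝ}
    (hb : ‖b‖ = 1) (hs : closedBall x s ⊆ Ω) (hℓ : 0 ≤ ℓ) (hc : 0 < c)
    (hout : ∀ P ∈ closedBall x s, ∃ σ : ℝ, |σ| ≤ ℓ ∧ P + σ • b ∉ Ω) :
    ∫ y in closedBall x s, |u y| ≤
      2 * ℓ * (c * (∫ y in Ω, ‖gradient u y‖ ^ 2) + c⁻¹ * volume.real (closedBall x s)) := by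
  have hG := measurable_gradENorm hop u
  set B := closedBall x s
  set E := ∫ y in Ω, ‖gradient u y‖ ^ 2
  have hE : 0 ≤ E := integral_nonneg fun y => by positivity
  have hBfin : volume B ≠ ⊤ := measure_closedBall_lt_top.ne
  obtain ⟨A, hA⟩ : ∃ A, A = c * E + c⁻¹ * volume.real B := ⟨_, rfl⟩
  have hA0 : 0 ≤ A := hA ▸ add_nonneg (mul_nonneg hc.le hE)
    (mul_nonneg (inv_nonneg.2 hc.le) measureReal_nonneg)
  rw [← hA]
  have hray : ∀ v : R2, ∫⁻ P in B, ∫⁻ r in Icc 0 ℓ, gradENorm Ω u (P + r • v) ≤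
      ENNReal.ofReal (ℓ * A) := by
    intro v
    have hm : Measurable fun q : R2 × ℝ => gradENorm Ω u (q.1 + q.2 • v) :=
      hG.comp (by fun_prop)
    rw [lintegral_lintegral_swap hm.aemeasurable]
    have hbd : ∀ r : ℝ, ∫⁻ P in B, gradENorm Ω u (P + r • v) ≤
        ENNReal.ofReal A := fun r =>
      hA ▸ setLIntegral_gradENorm_le hop hint hc hBfin (r • v)
    refine (lintegral_mono fun r => hbd r).trans ?_
    rw [setLIntegral_const, Real.volume_Icc, sub_zero, ← ENNReal.ofReal_mul (by positivity),
      mul_comm]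
  have hle : ∀ P ∈ B, ‖u P‖ₑ ≤ (∫⁻ r in Icc 0 ℓ, gradENorm Ω u (P + r • b)) +
      ∫⁻ r in Icc 0 ℓ, gradENorm Ω u (P + r • (-b)) := by
    intro P hP
    obtain ⟨σ, hσ, hσΩ⟩ := hout P hP
    rcases le_total 0 σ with h0 | h0
    · rw [abs_of_nonneg h0] at hσ
      exact (enorm_le_lintegral_ray h hop hb (hs hP) h0 hσ hσΩ).trans le_self_add
    · rw [abs_of_nonpos h0] at hσ
      exact (enorm_le_lintegral_ray h hop (by rwa [norm_neg]) (hs hP) (neg_nonneg.2 h0) hσ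
        (by simpa using hσΩ)).trans le_add_self
  have hmeas : ∀ v : R2, Measurable fun P => ∫⁻ r in Icc 0 ℓ, gradENorm Ω u (P + r • v) := by
    intro v
    have hm : Measurable fun q : R2 × ℝ => gradENorm Ω u (q.1 + q.2 • v) :=
      hG.comp (by fun_prop)
    exact hm.lintegral_prod_right'
  have htot : ∫⁻ P in B, ‖u P‖ₑ ≤
      ENNReal.ofReal (2 * ℓ * A) := by
    calc ∫⁻ P in B, ‖u P‖ₑ ≤ ∫⁻ P in B, ((∫⁻ r in Icc 0 ℓ, gradENorm Ω u (P + r • b)) +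
          ∫⁻ r in Icc 0 ℓ, gradENorm Ω u (P + r • (-b))) :=
          setLIntegral_mono' measurableSet_closedBall hle
      _ ≤ ENNReal.ofReal (ℓ * A) +
          ENNReal.ofReal (ℓ * A) := by
          rw [lintegral_add_left (hmeas b)]
          exact add_le_add (hray b) (hray (-b))
      _ = _ := by
          rw [← ENNReal.ofReal_add (by positivity) (by positivity)]; congr 1; ring
  have huc : ContinuousOn u B := fun y hy =>
    (h.contDiffAt hop (hs hy)).continuousAt.continuousWithinAt
  rw [integral_eq_lintegral_of_nonneg_ae (Eventually.of_forall fun y => abs_nonneg _)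
    (huc.abs.aestronglyMeasurable measurableSet_closedBall)]
  refine ENNReal.toReal_le_of_le_ofReal (by positivity) ?_
  refine (lintegral_congr fun y => ?_).trans_le htot
  rw [← Real.norm_eq_abs, ofReal_norm]

lemma neg_setIntegral_abs_le_wavg {u : R2 → ℝ} {x : R2} {t : ℝ} (ht : 0 < t)
    (hu : ContinuousOn u (closedBall x t)) :
    -(∫ y in closedBall x t, |u y|) ≤ t ^ 2 * wavg u x t := by
  have hi : IntegrableOn (fun y => |u y|) (closedBall x t) :=
    hu.abs.integrableOn_compact (isCompact_closedBall x t)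
  rw [wavg_eq_integral u x ht, ← integral_indicator measurableSet_closedBall]
  refine neg_le_of_abs_le ?_
  rw [← Real.norm_eq_abs]
  refine (norm_integral_le_integral_norm _).trans
    (integral_mono_of_nonneg (Eventually.of_forall fun y => norm_nonneg _)
      (hi.integrable_indicator measurableSet_closedBall) (Eventually.of_forall fun y => ?_))
  simp only
  by_cases hy : avgKernel (t⁻¹ • (y - x)) = 0
  · simp only [hy, zero_mul, norm_zero]
    exact indicator_nonneg (fun y _ => abs_nonneg _) y
  · rw [indicator_of_mem (mem_closedBall_of_avgKernel_ne_zero ht hy), norm_mul, Real.norm_eq_abs,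
      Real.norm_eq_abs, abs_of_nonneg (avgKernel_nonneg _)]
    exact mul_le_of_le_one_left (abs_nonneg _) (avgKernel_le_one _)

lemma exists_frontier_dist_eq {Ω : Set R2} (hop : IsOpen Ω) (hbdd : Bornology.IsBounded Ω)
    {x : R2} (hx : x ∈ Ω) : 0 < infDist x Ωᶜ ∧ ball x (infDist x Ωᶜ) ⊆ Ω ∧
      ∃ y ∈ frontier Ω, dist x y = infDist x Ωᶜ := by
  have hne : (Ωᶜ).Nonempty := by
    rw [nonempty_compl]
    rintro rfl
    exact (NormedSpace.unbounded_univ ℝ R2) hbdd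
  have hpos : 0 < infDist x Ωᶜ :=
    (hop.isClosed_compl.notMem_iff_infDist_pos hne).1 (fun h => h hx)
  have hball : ball x (infDist x Ωᶜ) ⊆ Ω := by
    simpa using ball_infDist_compl_subset (s := Ω) (x := x)
  obtain ⟨y, hy, hxy⟩ := hop.isClosed_compl.exists_infDist_eq_dist hne x
  refine ⟨hpos, hball, y, ?_, hxy.symm⟩
  rw [hop.frontier_eq]
  refine ⟨closure_mono hball ?_, hy⟩
  rw [closure_ball x hpos.ne', mem_closedBall, dist_comm, hxy]

/-- Near the boundary a solution of small energy is small. -/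
lemma IsSolution.kernelMass_mul_le {Ω : Set R2} {p M Λ δ τ : ℝ} {u : R2 → ℝ}
    (h : IsSolution Ω p u) (hop : IsOpen Ω) (hbdd : Bornology.IsBounded Ω) (hp : 1 < p)
    (hM : 0 < M) (hu : ∀ x ∈ Ω, |u x| ≤ M)
    (hint : IntegrableOn (fun x => ‖gradient u x‖ ^ 2) Ω) (hΛ : 0 < Λ)
    (hgeo : ∀ y ∈ frontier Ω, ∀ d, 0 < d → d < δ → ∃ b : R2, ‖b‖ = 1 ∧
      ∀ P : R2, ‖P - y‖ ≤ 2 * d → ∃ σ : ℝ, |σ| ≤ Λ * d ∧ P + σ • b ∈ frontier Ω)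
    {x : R2} (hx : x ∈ Ω) (hd : infDist x Ωᶜ < δ) (hτ : 0 < τ) :
    kernelMass * (-u x) ≤ M ^ (p - 1) * M * potentialMass * infDist x Ωᶜ ^ 2 / 8 +
      4 * Λ * ((∫ y in Ω, ‖gradient u y‖ ^ 2) / τ + volume.real (ball (0 : R2) 1) * τ) := by
  obtain ⟨hd0, hball, y, hy, hxy⟩ := exists_frontier_dist_eq hop hbdd hx
  set d := infDist x Ωᶜ
  set E := ∫ y in Ω, ‖gradient u y‖ ^ 2
  set t := d / 2 with htd
  have ht : 0 < t := by positivity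
  have hs : closedBall x t ⊆ Ω := (closedBall_subset_ball (by simp only [t]; linarith)).trans hball
  obtain ⟨b, hb, hgeo⟩ := hgeo y hy d hd0 hd
  have h1 := setIntegral_abs_le h hop hint (x := x) (s := t) (ℓ := Λ * d) (c := t / τ) hb hs
    (by positivity) (by positivity) (fun P hP => by
      rw [mem_closedBall] at hP
      obtain ⟨σ, hσ, hσ'⟩ := hgeo P (by
        rw [← dist_eq_norm]
        linarith [dist_triangle P x y])
      rw [hop.frontier_eq] at hσ'
      exact ⟨σ, hσ, hσ'.2⟩)
  have h2 := neg_setIntegral_abs_le_wavg (u := u) ht fun y hy =>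
    (h.contDiffAt hop (hs hy)).continuousAt.continuousWithinAt
  have h3 := wavg_le (h := u) (x := x) (b := M ^ (p - 1) * M) ht.le
    (fun y hy => h.contDiffAt hop (hs hy)) (fun y hy => by
      have h4 := h.2.2.1 y (hs hy)
      have h5 : |u y| ^ (p - 1) * |u y| ≤ M ^ (p - 1) * M :=
        mul_le_mul (Real.rpow_le_rpow (abs_nonneg _) (hu y (hs hy)) (by linarith)) (hu y (hs hy))
          (abs_nonneg _) (by positivity)
      have h6 : |u y| ^ (p - 1) * -|u y| ≤ |u y| ^ (p - 1) * u y :=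
        mul_le_mul_of_nonneg_left (neg_abs_le _) (by positivity)
      linarith)
  have hvol : volume.real (closedBall x t) = t ^ 2 * volume.real (ball (0 : R2) 1) := by
    simpa using Measure.addHaar_real_closedBall (volume : Measure R2) x ht.le
  rw [hvol] at h1
  have h7 : 2 * (Λ * d) * (t / τ * E + (t / τ)⁻¹ * (t ^ 2 * volume.real (ball (0 : R2) 1))) =
      t ^ 2 * (4 * Λ * (E / τ + volume.real (ball (0 : R2) 1) * τ)) := by
    have : d = 2 * t := by simp only [t]; ring
    rw [this]; field_simp; ring
  rw [h7] at h1
  have h8 : -(4 * Λ * (E / τ + volume.real (ball (0 : R2) 1) * τ)) ≤ wavg u x t := by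
    have : 0 < t ^ 2 := by positivity
    refine le_of_mul_le_mul_left ?_ this
    linarith
  have h9 : M ^ (p - 1) * M * potentialMass * t ^ 2 / 2 =
      M ^ (p - 1) * M * potentialMass * d ^ 2 / 8 := by simp only [t]; ring
  rw [h9] at h3
  linarith

/-- A family of solutions of the Lane–Emden problems with maximum points `xp` and minimum points
`xm` such that `p` times the energy is bounded and `u (xp) + u (xm) = O(1 / p)`. -/
structure IsNodalFamily (Ω : Set R2) (u : ℝ → R2 → ℝ) (xp xm : ℝ → R2) (K : ℝ) : Prop where
  isOpen : IsOpen Ω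
  bounded : Bornology.IsBounded Ω
  smooth : SmoothBoundary Ω
  sol : ∀ p > (1 : ℝ), IsSolution Ω p (u p)
  xp_mem : ∀ p > (1 : ℝ), xp p ∈ Ω
  xm_mem : ∀ p > (1 : ℝ), xm p ∈ Ω
  max_pos : ∀ p > (1 : ℝ), 0 < u p (xp p)
  abs_le : ∀ p > (1 : ℝ), ∀ x ∈ Ω, |u p x| ≤ u p (xp p)
  xm_le : ∀ p > (1 : ℝ), ∀ x ∈ Ω, u p (xm p) ≤ u p x
  energy : CondA Ω u
  sum : Tendsto (fun p : ℝ => p * (u p (xp p) + u p (xm p))) atTop (𝓝 K)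

namespace IsNodalFamily

variable {Ω : Set R2} {u : ℝ → R2 → ℝ} {xp xm : ℝ → R2} {K : ℝ}

lemma exists_le_rpow (h : IsNodalFamily Ω u xp xm K) :
    ∃ c > 0, ∀ p > (1 : ℝ), c ≤ u p (xp p) ^ (p - 1) := by
  obtain ⟨R, hR, hΩ⟩ := h.bounded.subset_ball_lt 0 (0 : R2)
  refine ⟨4 / R ^ 2, by positivity, fun p hp => ?_⟩
  rw [div_le_iff₀' (by positivity)]
  exact (h.sol p hp).four_le h.isOpen hp hR hΩ (h.xp_mem p hp) (h.max_pos p hp) rfl (h.abs_le p hp)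

lemma eps_pos (h : IsNodalFamily Ω u xp xm K) {p : ℝ} (hp : 1 < p) : 0 < eps u xp p := by
  have := h.max_pos p hp
  unfold eps; positivity

lemma eps_sq (h : IsNodalFamily Ω u xp xm K) {p : ℝ} (hp : 1 < p) :
    eps u xp p ^ 2 = (p * u p (xp p) ^ (p - 1))⁻¹ := by
  have := h.max_pos p hp
  rw [eps, div_pow, one_pow, Real.sq_sqrt (by positivity), one_div]

lemma tendsto_eps (h : IsNodalFamily Ω u xp xm K) : Tendsto (eps u xp) atTop (𝓝 0) := by
  obtain ⟨c, hc, hcM⟩ := h.exists_le_rpow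
  have h1 : Tendsto (fun p : ℝ => p * u p (xp p) ^ (p - 1)) atTop atTop := by
    refine tendsto_atTop_mono' _ ?_ (tendsto_id.atTop_mul_const hc)
    filter_upwards [eventually_gt_atTop 1] with p hp
    exact mul_le_mul_of_nonneg_left (hcM p hp) (by simp; linarith)
  refine (tendsto_sqrt_atTop.comp h1).inv_tendsto_atTop.congr fun p => ?_
  simp [eps]

lemma eventually_half_le (h : IsNodalFamily Ω u xp xm K) : ∀ᶠ p in atTop, 1 / 2 ≤ u p (xp p) := by
  obtain ⟨c, hc, hcM⟩ := h.exists_le_rpow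
  have h1 : Tendsto (fun p : ℝ => (1 / 2 : ℝ) ^ (p - 1)) atTop (𝓝 0) :=
    (tendsto_rpow_atTop_of_base_lt_one _ (by norm_num) (by norm_num)).comp
      (tendsto_atTop_add_const_right _ (-1) tendsto_id)
  filter_upwards [h1.eventually_lt_const hc, eventually_gt_atTop 1] with p hp hp1
  by_contra! hlt
  have := Real.rpow_le_rpow (h.max_pos p hp1).le hlt.le (by linarith : 0 ≤ p - 1)
  linarith [hcM p hp1]

lemma eventually_energy (h : IsNodalFamily Ω u xp xm K) : ∀ᶠ p in atTop,
    IntegrableOn (fun x => ‖gradient (u p) x‖ ^ 2) Ω ∧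
      p * ∫ x in Ω, ‖gradient (u p) x‖ ^ 2 ≤ 16 * π * Real.exp 1 + 1 := by
  have h0 : 0 < 16 * π * Real.exp 1 := by positivity
  filter_upwards [Tendsto.eventually_const_lt h0 h.energy,
    Tendsto.eventually_le_const (lt_add_one _) h.energy]
    with p hp hp'
  refine ⟨?_, hp'⟩
  by_contra hn
  rw [integral_undef hn, mul_zero] at hp
  exact lt_irrefl _ hp

lemma eventually_xm_le (h : IsNodalFamily Ω u xp xm K) : ∀ᶠ p in atTop,
    p * (u p (xp p) + u p (xm p)) ≤ K + 1 := h.sum.eventually_le_const (lt_add_one _)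

/-- The minimum points stay far from the boundary at the scale `eps`. -/
lemma eventually_lt_infDist (h : IsNodalFamily Ω u xp xm K) (L : ℝ) (hL : 0 < L) :
    ∀ᶠ p in atTop, L * eps u xp p < infDist (xm p) Ωᶜ := by
  obtain ⟨Λ, δ, hΛ, hδ, hgeo⟩ := h.smooth.exists_uniform h.bounded
  set C := volume.real (ball (0 : R2) 1)
  have hC : 0 ≤ C := measureReal_nonneg
  have hk := kernelMass_pos
  have hτ : ∃ τ > 0, 4 * Λ * (C * τ) ≤ kernelMass / 16 :=
    ⟨kernelMass / (64 * Λ * (C + 1)), by positivity, by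
      have e1 : 4 * Λ * (C * (kernelMass / (64 * Λ * (C + 1)))) =
        kernelMass / 16 * (C / (C + 1)) := by field_simp; ring
      rw [e1]
      exact mul_le_of_le_one_right (by positivity) ((div_le_one (by positivity)).2 (by linarith))⟩
  obtain ⟨τ, hτ, hτC⟩ := hτ
  have hε : ∀ᶠ p in atTop, L * eps u xp p < δ := by
    have := h.tendsto_eps.const_mul L
    rw [mul_zero] at this
    exact this.eventually_lt_const hδ
  set A := 16 * π * Real.exp 1 + 1
  set Q := 2 * kernelMass * (K + 1) + potentialMass * L ^ 2 / 8 + 8 * Λ * (A / τ)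
  filter_upwards [hε, h.eventually_half_le, h.eventually_energy, h.eventually_xm_le,
    eventually_gt_atTop 1, eventually_gt_atTop (16 * Q / kernelMass)] with p hpε hM hE hm hp1 hpQ
  by_contra! hd
  set M := u p (xp p)
  have hM0 : 0 < M := by linarith
  have hp0 : 0 < p := by linarith
  set E := ∫ x in Ω, ‖gradient (u p) x‖ ^ 2
  have key := (h.sol p hp1).kernelMass_mul_le h.isOpen h.bounded hp1 hM0 (h.abs_le p hp1) hE.1 hΛ
    hgeo (h.xm_mem p hp1) (hd.trans_lt hpε) hτ
  have hE' : E ≤ A / p := by rw [le_div_iff₀' hp0]; exact hE.2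
  have hm' : M + u p (xm p) ≤ (K + 1) / p := by rw [le_div_iff₀' hp0]; exact hm
  have hd2 : M ^ (p - 1) * infDist (xm p) Ωᶜ ^ 2 ≤ L ^ 2 / p := by
    have h1 : infDist (xm p) Ωᶜ ^ 2 ≤ (L * eps u xp p) ^ 2 :=
      pow_le_pow_left₀ infDist_nonneg hd 2
    rw [mul_pow, h.eps_sq hp1] at h1
    have hMp : 0 < M ^ (p - 1) := by positivity
    calc M ^ (p - 1) * infDist (xm p) Ωᶜ ^ 2 ≤ M ^ (p - 1) * (L ^ 2 * (p * M ^ (p - 1))⁻¹) := by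
          gcongr
      _ = L ^ 2 / p := by field_simp
  have h2 : M ^ (p - 1) * M * potentialMass * infDist (xm p) Ωᶜ ^ 2 / 8 ≤
      M * (potentialMass * L ^ 2 / 8 / p) := by
    have := mul_le_mul_of_nonneg_left hd2 (mul_nonneg hM0.le potentialMass_nonneg)
    calc _ = M * potentialMass * (M ^ (p - 1) * infDist (xm p) Ωᶜ ^ 2) / 8 := by ring
      _ ≤ M * potentialMass * (L ^ 2 / p) / 8 := by linarith
      _ = _ := by ring
  have h3 : 4 * Λ * (E / τ + C * τ) ≤ 4 * Λ * (A / τ) / p + kernelMass / 16 := by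
    have : 4 * Λ * (E / τ) ≤ 4 * Λ * (A / p / τ) := by gcongr
    calc _ = 4 * Λ * (E / τ) + 4 * Λ * (C * τ) := by ring
      _ ≤ 4 * Λ * (A / p / τ) + kernelMass / 16 := add_le_add this hτC
      _ = _ := by ring
  have h4 : kernelMass * M ≤ kernelMass * (-u p (xm p)) + kernelMass * ((K + 1) / p) := by
    have := mul_le_mul_of_nonneg_left hm' hk.le
    linarith
  have hQ : Q / p ≤ kernelMass / 16 := by
    rw [div_lt_iff₀ hk] at hpQ
    rw [div_le_iff₀ hp0]
    linarith
  have hK1 : 0 ≤ kernelMass * ((K + 1) / p) := by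
    have := (_root_.abs_le.1 (h.abs_le p hp1 _ (h.xm_mem p hp1))).1
    exact mul_nonneg hk.le (by linarith)
  have hA1 : 0 ≤ 4 * Λ * (A / τ) / p := by positivity
  have e1 : Q / p = 2 * (kernelMass * ((K + 1) / p)) + potentialMass * L ^ 2 / 8 / p +
      2 * (4 * Λ * (A / τ) / p) := by simp only [Q]; ring
  have h5 : kernelMass * ((K + 1) / p) ≤ M * (2 * (kernelMass * ((K + 1) / p))) := by nlinarith
  have h6 : 4 * Λ * (A / τ) / p ≤ M * (2 * (4 * Λ * (A / τ) / p)) := by nlinarith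
  have h7 : M * (Q / p) ≤ M * (kernelMass / 16) := mul_le_mul_of_nonneg_left hQ hM0.le
  rw [e1] at h7
  nlinarith

end IsNodalFamily

namespace IsNodalFamily

variable {Ω : Set R2} {u : ℝ → R2 → ℝ} {xp xm : ℝ → R2} {K : ℝ}

lemma one_add_zm_div (h : IsNodalFamily Ω u xp xm K) {p : ℝ} (hp : 1 < p) (x : R2) :
    1 + zm u xp xm p x / p = -u p (eps u xp p • x + xm p) / u p (xp p) := by
  have := h.max_pos p hp
  have : 0 < p := by linarith
  rw [zm]; field_simp; ring

lemma contDiffAt_zm (h : IsNodalFamily Ω u xp xm K) {p : ℝ} (hp : 1 < p) {x : R2}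
    (hx : eps u xp p • x + xm p ∈ Ω) : ContDiffAt ℝ 2 (zm u xp xm p) x := by
  have h1 := (h.sol p hp).contDiffAt h.isOpen hx
  have h2 : ContDiffAt ℝ 2 (fun y : R2 => eps u xp p • y + xm p) x :=
    ContDiff.contDiffAt (by fun_prop)
  exact contDiffAt_const.mul ((h1.comp x h2).neg.sub contDiffAt_const)

lemma lap_zm (h : IsNodalFamily Ω u xp xm K) {p : ℝ} (hp : 1 < p) {x : R2}
    (hx : eps u xp p • x + xm p ∈ Ω) : lap (zm u xp xm p) x =
      |u p (eps u xp p • x + xm p)| ^ (p - 1) * u p (eps u xp p • x + xm p) /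
        (u p (xp p) ^ (p - 1) * u p (xp p)) := by
  have h1 := (h.sol p hp).contDiffAt h.isOpen hx
  have h2 : ContDiffAt ℝ 2 (fun y : R2 => eps u xp p • y + xm p) x :=
    ContDiff.contDiffAt (by fun_prop)
  have h3 : ContDiffAt ℝ 2 (fun y : R2 => u p (eps u xp p • y + xm p)) x := h1.comp x h2
  have h4 : zm u xp xm p = fun y => p / u p (xp p) *
    (-u p (eps u xp p • y + xm p) - u p (xp p)) := rfl
  have hM := h.max_pos p hp
  have hp0 : 0 < p := by linarith
  rw [h4, lap_const_mul (h3.neg.sub contDiffAt_const), lap_sub h3.neg contDiffAt_const, lap_neg h3,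
    lap_const, lap_comp_affine h1, h.eps_sq hp]
  have h5 := (h.sol p hp).2.2.1 _ hx
  rw [← h5]
  have : 0 < u p (xp p) ^ (p - 1) := by positivity
  field_simp
  ring

lemma abs_lap_zm_le (h : IsNodalFamily Ω u xp xm K) {p : ℝ} (hp : 1 < p) {x : R2}
    (hx : eps u xp p • x + xm p ∈ Ω) : |lap (zm u xp xm p) x| ≤ 1 := by
  have hM := h.max_pos p hp
  have h1 := h.abs_le p hp _ hx
  have h2 : 0 < u p (xp p) ^ (p - 1) * u p (xp p) := by positivity
  rw [h.lap_zm hp hx, abs_div, abs_of_pos h2, div_le_one h2, abs_mul,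
    abs_of_nonneg (Real.rpow_nonneg (abs_nonneg _) _)]
  exact mul_le_mul (Real.rpow_le_rpow (abs_nonneg _) h1 (by linarith)) h1 (abs_nonneg _)
    (by positivity)

lemma lap_zm_eq_neg_rpow (h : IsNodalFamily Ω u xp xm K) {p : ℝ} (hp : 1 < p) {x : R2}
    (hx : eps u xp p • x + xm p ∈ Ω) (hz : 0 < 1 + zm u xp xm p x / p) :
    lap (zm u xp xm p) x = -(1 + zm u xp xm p x / p) ^ p := by
  have hM := h.max_pos p hp
  rw [h.one_add_zm_div hp] at hz ⊢
  rw [h.lap_zm hp hx]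
  set v := u p (eps u xp p • x + xm p)
  have hv : 0 < -v := (div_pos_iff_of_pos_right hM).1 hz
  have e : ∀ s : ℝ, 0 < s → s ^ p = s ^ (p - 1) * s := fun s hs => by
    rw [← Real.rpow_add_one hs.ne', sub_add_cancel]
  rw [abs_of_neg (by linarith), Real.div_rpow hv.le hM.le, e _ hv, e _ hM]
  ring

lemma zm_le_zm_zero (h : IsNodalFamily Ω u xp xm K) {p : ℝ} (hp : 1 < p) {x : R2}
    (hx : eps u xp p • x + xm p ∈ Ω) : zm u xp xm p x ≤ zm u xp xm p 0 := by
  have hM := h.max_pos p hp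
  have := h.xm_le p hp _ hx
  have hp0 : 0 < p := by linarith
  simp only [zm, smul_zero, zero_add]
  gcongr

lemma zm_zero (u : ℝ → R2 → ℝ) (xp xm : ℝ → R2) (p : ℝ) :
    zm u xp xm p 0 = -(p * (u p (xp p) + u p (xm p))) / u p (xp p) := by
  simp only [zm, smul_zero, zero_add]; ring

lemma sum_nonneg (h : IsNodalFamily Ω u xp xm K) {p : ℝ} (hp : 1 < p) :
    0 ≤ p * (u p (xp p) + u p (xm p)) := by
  have := (_root_.abs_le.1 (h.abs_le p hp _ (h.xm_mem p hp))).1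
  exact mul_nonneg (by linarith) (by linarith)

lemma zm_zero_nonpos (h : IsNodalFamily Ω u xp xm K) {p : ℝ} (hp : 1 < p) :
    zm u xp xm p 0 ≤ 0 := by
  rw [zm_zero]
  exact div_nonpos_of_nonpos_of_nonneg (neg_nonpos.2 (h.sum_nonneg hp)) (h.max_pos p hp).le

lemma eventually_le_zm_zero (h : IsNodalFamily Ω u xp xm K) :
    ∀ᶠ p in atTop, -(2 * (p * (u p (xp p) + u p (xm p)))) ≤ zm u xp xm p 0 := by
  filter_upwards [eventually_gt_atTop 1, h.eventually_half_le] with p hp hM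
  rw [zm_zero, le_div_iff₀ (by linarith)]
  nlinarith [h.sum_nonneg hp]

lemma tendsto_zm_zero (h : IsNodalFamily Ω u xp xm 0) :
    Tendsto (fun p => zm u xp xm p 0) atTop (𝓝 0) := by
  have h1 : Tendsto (fun p => -(2 * (p * (u p (xp p) + u p (xm p))))) atTop (𝓝 0) := by
    simpa using (h.sum.const_mul 2).neg
  refine tendsto_of_tendsto_of_tendsto_of_le_of_le' h1 tendsto_const_nhds h.eventually_le_zm_zero ?_
  filter_upwards [eventually_gt_atTop 1] with p hp using h.zm_zero_nonpos hp

lemma eventually_mem (h : IsNodalFamily Ω u xp xm K) (R : ℝ) (hR : 0 < R) :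
    ∀ᶠ p in atTop, ∀ x ∈ closedBall (0 : R2) R, eps u xp p • x + xm p ∈ Ω := by
  filter_upwards [eventually_gt_atTop 1, h.eventually_lt_infDist R hR] with p hp hd x hx
  refine (exists_frontier_dist_eq h.isOpen h.bounded (h.xm_mem p hp)).2.1 ?_
  rw [mem_closedBall_zero_iff] at hx
  rw [mem_ball, dist_eq_norm, add_sub_cancel_right, norm_smul,
    Real.norm_of_nonneg (h.eps_pos hp).le]
  have := mul_le_mul_of_nonneg_left hx (h.eps_pos hp).le
  linarith

/-- The rescaled functions are locally bounded. -/
lemma exists_le_zm (h : IsNodalFamily Ω u xp xm K) (R : ℝ) (hR : 0 < R) :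
    ∃ A, ∀ᶠ p in atTop, ∀ x ∈ closedBall (0 : R2) R, eps u xp p • x + xm p ∈ Ω ∧
      -A ≤ zm u xp xm p x ∧ 3 / 4 ≤ 1 + zm u xp xm p x / p := by
  obtain ⟨C, hC, hharnack⟩ := exists_harnack
  set A := C * (2 * (K + 1) + R ^ 2)
  refine ⟨A, ?_⟩
  filter_upwards [eventually_gt_atTop 1, h.eventually_mem (4 * R) (by positivity),
    h.eventually_le_zm_zero, h.eventually_xm_le, eventually_ge_atTop (4 * A)]
    with p hp hmem h0 hK hA x hx
  have hxΩ := hmem x (closedBall_subset_closedBall (by linarith) hx)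
  have hp0 : 0 < p := by linarith
  have h1 := hharnack (fun y => -zm u xp xm p y) 0 R 1 hR zero_le_one 
    (fun y hy => (h.contDiffAt_zm hp (hmem y hy)).neg)
    (fun y hy => neg_nonneg.2 ((h.zm_le_zm_zero hp (hmem y hy)).trans (h.zm_zero_nonpos hp)))
    (fun y hy => by
      rw [lap_neg (h.contDiffAt_zm hp (hmem y hy)), abs_neg]
      exact h.abs_lap_zm_le hp (hmem y hy)) x hx
  have h2 : -A ≤ zm u xp xm p x := by
    have : C * (-zm u xp xm p 0 + 1 * R ^ 2) ≤ A := by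
      simp only [A]; gcongr ?_ * ?_; linarith
    linarith
  refine ⟨hxΩ, h2, ?_⟩
  have : -(1 / 4) ≤ zm u xp xm p x / p := by
    rw [le_div_iff₀ hp0]; linarith
  linarith

end IsNodalFamily

lemma hasDerivAt_max_zero_sq (s : ℝ) : HasDerivAt (fun s : ℝ => max s 0 ^ 2) (2 * max s 0) s := by
  rcases lt_trichotomy s 0 with hs | rfl | hs
  · rw [max_eq_right hs.le, mul_zero]
    refine (hasDerivAt_const s (0 : ℝ)).congr_of_eventuallyEq ?_
    filter_upwards [Iio_mem_nhds hs] with r hr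
    have hr' : r < 0 := hr
    simp [hr'.le]
  · rw [max_self, mul_zero, hasDerivAt_iff_tendsto_slope_zero]
    refine squeeze_zero_norm (a := fun t => |t|) (fun t => ?_) ?_
    · simp only [zero_add, max_self, smul_eq_mul, norm_mul, norm_inv, Real.norm_eq_abs]
      rcases eq_or_ne t 0 with rfl | ht
      · simp
      · rw [inv_mul_le_iff₀ (abs_pos.2 ht)]
        rcases le_total t 0 with h | h
        · simp [max_eq_right h, mul_self_nonneg]
        · simp [max_eq_left h, sq]
    · have : Tendsto (fun t : ℝ => |t|) (𝓝 0) (𝓝 |0|) := continuous_abs.tendsto 0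
      rw [abs_zero] at this
      exact this.mono_left nhdsWithin_le_nhds
  · rw [max_eq_left hs.le]
    have h : HasDerivAt (fun s : ℝ => s ^ 2) (2 * s) s := by simpa using hasDerivAt_pow 2 s
    refine h.congr_of_eventuallyEq ?_
    filter_upwards [Ioi_mem_nhds hs] with r hr
    have hr' : 0 < r := hr
    simp [hr'.le]

/-- A `C¹` cutoff of the values below `1 / 4`. -/
def levelCutoff (s : ℝ) : ℝ := max (s - 1 / 4) 0 ^ 2

lemma hasDerivAt_levelCutoff (s : ℝ) : HasDerivAt levelCutoff (2 * max (s - 1 / 4) 0) s := by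
  have := (hasDerivAt_max_zero_sq (s - 1 / 4)).comp s ((hasDerivAt_id s).sub_const (1 / 4))
  rw [mul_one] at this
  exact this

lemma contDiff_levelCutoff : ContDiff ℝ 1 levelCutoff := by
  rw [contDiff_one_iff_deriv]
  refine ⟨fun s => (hasDerivAt_levelCutoff s).differentiableAt, ?_⟩
  have : deriv levelCutoff = fun s => 2 * max (s - 1 / 4) 0 :=
    funext fun s => (hasDerivAt_levelCutoff s).deriv
  rw [this]; fun_prop

lemma levelCutoff_nonneg (s : ℝ) : 0 ≤ levelCutoff s := sq_nonneg _

lemma levelCutoff_eq_zero {s : ℝ} (h : s ≤ 1 / 4) : levelCutoff s = 0 := by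
  rw [levelCutoff, max_eq_right (by linarith)]; norm_num

lemma le_levelCutoff {s : ℝ} (h : 3 / 4 ≤ s) : 1 / 4 ≤ levelCutoff s := by
  rw [levelCutoff, max_eq_left (by linarith)]; nlinarith

/-- A Caccioppoli type estimate: on superlevel sets, the Laplacian is controlled by the energy. -/
lemma exists_integrable_dominating {Ω : Set R2} (hop : IsOpen Ω) (hbdd : Bornology.IsBounded Ω)
    {v : R2 → ℝ} (hv : ∀ x ∈ Ω, ContDiffAt ℝ 2 v x) (hvc : ContinuousOn v (closure Ω))
    (hv0 : ∀ x ∈ closure Ω, x ∉ Ω → v x = 0) (hv1 : ∀ x ∈ Ω, v x ≤ 1)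
    (hlap : ∀ x ∈ Ω, 1 / 4 ≤ v x → lap v x ≤ 0)
    (hint : IntegrableOn (fun x => pd 0 v x ^ 2 + pd 1 v x ^ 2) Ω) :
    ∃ Q : R2 → ℝ, Integrable Q ∧ (∀ x, 0 ≤ Q x) ∧
      ∫ x, Q x = 2 * ∫ x in Ω, (pd 0 v x ^ 2 + pd 1 v x ^ 2) ∧
      ∀ x ∈ Ω, levelCutoff (v x) * -lap v x ≤ Q x := by
  set S := closure Ω ∩ v ⁻¹' Ici (1 / 4)
  have hSc : IsClosed S := hvc.preimage_isClosed_of_isClosed isClosed_closure isClosed_Ici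
  have hScomp : IsCompact S :=
    isCompact_of_isClosed_isBounded hSc (hbdd.closure.subset inter_subset_left)
  have hSΩ : S ⊆ Ω := by
    rintro x ⟨h1, h2⟩
    by_contra hx
    have : (1 / 4 : ℝ) ≤ v x := h2
    rw [hv0 x h1 hx] at this
    norm_num at this
  set F : Fin 2 → R2 → ℝ := fun i => Ω.indicator fun x => levelCutoff (v x) * pd i v x
  have hF0 : ∀ i, ∀ x ∉ S, F i x = 0 := by
    intro i x hx
    by_cases hxΩ : x ∈ Ω
    · simp only [F, indicator_of_mem hxΩ]
      rw [levelCutoff_eq_zero, zero_mul]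
      by_contra! hlt
      exact hx ⟨subset_closure hxΩ, hlt.le⟩
    · simp [F, hxΩ]
  have hFΩ : ∀ i, ∀ x ∈ Ω, F i =ᶠ[𝓝 x] fun y => levelCutoff (v y) * pd i v y := by
    intro i x hx
    filter_upwards [hop.mem_nhds hx] with y hy
    simp only [F, indicator_of_mem hy]
  have hFS : ∀ i, ∀ x ∉ S, F i =ᶠ[𝓝 x] fun _ => 0 := by
    intro i x hx
    filter_upwards [hSc.isOpen_compl.mem_nhds hx] with y hy using hF0 i y hy
  have hκv : ∀ x ∈ Ω, ContDiffAt ℝ 1 (fun y => levelCutoff (v y)) x := fun x hx =>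
    contDiff_levelCutoff.contDiffAt.comp x ((hv x hx).of_le (by norm_num))
  have hF1 : ∀ i, ContDiff ℝ 1 (F i) := by
    intro i
    rw [contDiff_iff_contDiffAt]
    intro x
    by_cases hx : x ∈ Ω
    · exact ((hκv x hx).mul (hv x hx).pd_one).congr_of_eventuallyEq (hFΩ i x hx)
    · exact contDiffAt_const.congr_of_eventuallyEq (hFS i x fun h => hx (hSΩ h))
  have hFc : ∀ i, HasCompactSupport (F i) := fun i => HasCompactSupport.intro hScomp (hF0 i)
  have hGi : ∀ i, Integrable (pd i (F i)) := fun i =>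
    (hF1 i).continuous_pd.integrable_of_hasCompactSupport (hFc i).pd
  have hpd : ∀ i, ∀ x ∈ Ω, pd i (F i) x =
      2 * max (v x - 1 / 4) 0 * pd i v x ^ 2 + levelCutoff (v x) * pd i (pd i v) x := by
    intro i x hx
    have hd := (hv x hx).differentiableAt (by norm_num)
    rw [(hFΩ i x hx).pd_eq, pd_mul ((hκv x hx).differentiableAt (by norm_num))
      ((hv x hx).pd_one.differentiableAt (by norm_num)),
      HasDerivAt.pd_comp (u := v) (f := levelCutoff) (hasDerivAt_levelCutoff (v x)) hd]
    ring
  have hDi := hint.integrable_indicator hop.measurableSet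
  set D := Ω.indicator fun x => pd 0 v x ^ 2 + pd 1 v x ^ 2
  have hQΩ : ∀ x ∈ Ω, levelCutoff (v x) * -lap v x ≤
      2 * D x - (pd 0 (F 0) x + pd 1 (F 1) x) := by
    intro x hx
    rw [hpd 0 x hx, hpd 1 x hx, lap_eq]
    simp only [D, indicator_of_mem hx]
    have h1 : max (v x - 1 / 4) 0 ≤ 1 := max_le (by linarith [hv1 x hx]) zero_le_one
    nlinarith [mul_nonneg (sub_nonneg.2 h1) (add_nonneg (sq_nonneg (pd 0 v x))
      (sq_nonneg (pd 1 v x)))]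
  refine ⟨fun x => 2 * D x - (pd 0 (F 0) x + pd 1 (F 1) x),
    (hDi.const_mul 2).sub ((hGi 0).add (hGi 1)), fun x => ?_, ?_, hQΩ⟩
  · by_cases hx : x ∈ Ω
    · refine le_trans ?_ (hQΩ x hx)
      rcases le_total (v x) (1 / 4) with h | h
      · rw [levelCutoff_eq_zero h, zero_mul]
      · exact mul_nonneg (levelCutoff_nonneg _) (neg_nonneg.2 (hlap x hx h))
    · have : ∀ i, pd i (F i) x = 0 := fun i => by
        rw [(hFS i x fun h => hx (hSΩ h)).pd_eq, pd_const]
      simp [D, hx, this]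
  · have hG : Integrable fun x => pd 0 (F 0) x + pd 1 (F 1) x := (hGi 0).add (hGi 1)
    simp only
    rw [integral_sub (hDi.const_mul 2) hG, integral_add (hGi 0) (hGi 1),
      integral_pd_eq_zero (hF1 0) (hFc 0), integral_pd_eq_zero (hF1 1) (hFc 1),
      integral_const_mul, integral_indicator hop.measurableSet]
    ring

lemma norm_gradient_sq (u : R2 → ℝ) (x : R2) :
    ‖gradient u x‖ ^ 2 = pd 0 u x ^ 2 + pd 1 u x ^ 2 := by
  have : ∀ i, gradient u x i = pd i u x := fun i => by
    have h1 : inner ℝ (gradient u x) (EuclideanSpace.single i (1 : ℝ)) = pd i u x := by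
      rw [gradient, InnerProductSpace.toDual_symm_apply, pd]
    rw [← h1, EuclideanSpace.inner_single_right]; simp
  simp [EuclideanSpace.norm_sq_eq, this]

namespace IsNodalFamily

variable {Ω : Set R2} {u : ℝ → R2 → ℝ} {xp xm : ℝ → R2} {K : ℝ}

lemma setIntegral_rpow_le (h : IsNodalFamily Ω u xp xm K) {p R : ℝ} (hp : 1 < p)
    (hint : IntegrableOn (fun x => ‖gradient (u p) x‖ ^ 2) Ω)
    (hR : ∀ x ∈ closedBall (0 : R2) R, eps u xp p • x + xm p ∈ Ω ∧
      3 / 4 ≤ 1 + zm u xp xm p x / p) :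
    ∫ x in closedBall (0 : R2) R, (1 + zm u xp xm p x / p) ^ p ≤
      8 * p * (∫ x in Ω, ‖gradient (u p) x‖ ^ 2) / u p (xp p) ^ 2 := by
  have hM := h.max_pos p hp
  have hp0 : 0 < p := by linarith
  have hε := h.eps_pos hp
  have hε2 := h.eps_sq hp
  have hone := h.one_add_zm_div hp
  set M := u p (xp p)
  set ε := eps u xp p
  have hu2 : ∀ x ∈ Ω, ContDiffAt ℝ 2 (u p) x := fun x hx => (h.sol p hp).contDiffAt h.isOpen hx
  have hgrad : ∀ x ∈ Ω, pd 0 (fun y => -M⁻¹ * u p y) x ^ 2 + pd 1 (fun y => -M⁻¹ * u p y) x ^ 2 =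
      (M ^ 2)⁻¹ * ‖gradient (u p) x‖ ^ 2 := by
    intro x hx
    have hd := (hu2 x hx).differentiableAt (by norm_num)
    rw [pd_const_mul hd, pd_const_mul hd, norm_gradient_sq]
    ring
  have hlap : ∀ x ∈ Ω, lap (fun y => -M⁻¹ * u p y) x = M⁻¹ * (|u p x| ^ (p - 1) * u p x) := by
    intro x hx
    rw [lap_const_mul (hu2 x hx), ← (h.sol p hp).2.2.1 x hx]
    ring
  obtain ⟨Q, hQi, hQ0, hQ, hQle⟩ := exists_integrable_dominating h.isOpen h.bounded
    (v := fun y => -M⁻¹ * u p y) (fun x hx => contDiffAt_const.mul (hu2 x hx))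
    (continuousOn_const.mul (h.sol p hp).continuousOn)
    (fun x hx hx' => by simp [(h.sol p hp).eq_zero h.isOpen hx hx'])
    (fun x hx => by
      have := (_root_.abs_le.1 (h.abs_le p hp x hx)).1
      have h2 : -M⁻¹ * u p x = -u p x / M := by ring
      rw [h2, div_le_one hM]; linarith)
    (fun x hx hx' => by
      rw [hlap x hx]
      have h2 : -M⁻¹ * u p x = -u p x / M := by ring
      rw [h2] at hx'
      have h3 : 0 < -u p x := (div_pos_iff_of_pos_right hM).1 (by linarith)
      exact mul_nonpos_of_nonneg_of_nonpos (by positivity)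
        (mul_nonpos_of_nonneg_of_nonpos (by positivity) (by linarith)))
    ((integrableOn_congr_fun hgrad h.isOpen.measurableSet).2 (hint.const_mul _))
  rw [setIntegral_congr_fun h.isOpen.measurableSet hgrad, integral_const_mul] at hQ
  have hMp : 0 < M ^ (p - 1) := by positivity
  have hpt : ∀ x ∈ closedBall (0 : R2) R, (1 + zm u xp xm p x / p) ^ p ≤
      4 * (M ^ (p - 1))⁻¹ * Q (ε • x + xm p) := by
    intro x hx
    obtain ⟨hxΩ, hx34⟩ := hR x hx
    rw [hone] at hx34 ⊢
    have hq := hQle _ hxΩ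
    rw [hlap _ hxΩ] at hq
    set w := u p (ε • x + xm p)
    have e0 : -M⁻¹ * w = -w / M := by ring
    simp only [e0] at hq
    set s := -w / M with hs
    have hs0 : 0 < s := by linarith
    have hw : w = -(M * s) := by rw [hs]; field_simp
    have e1 : |w| = M * s := by rw [hw, abs_neg, abs_of_pos (by positivity)]
    have e2 : -(M⁻¹ * (|w| ^ (p - 1) * w)) = M ^ (p - 1) * s ^ p := by
      rw [e1, hw, Real.mul_rpow hM.le hs0.le]
      have : s ^ p = s ^ (p - 1) * s := by rw [← Real.rpow_add_one hs0.ne', sub_add_cancel]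
      rw [this]; field_simp
    rw [e2] at hq
    have h4 : 1 / 4 * (M ^ (p - 1) * s ^ p) ≤ levelCutoff s * (M ^ (p - 1) * s ^ p) :=
      mul_le_mul_of_nonneg_right (le_levelCutoff hx34) (by positivity)
    rw [mul_assoc, ← div_eq_inv_mul, ← mul_div_assoc, le_div_iff₀ hMp]
    linarith
  have hQs : Integrable fun x : R2 => Q (ε • x + xm p) :=
    (hQi.comp_add_right (xm p)).comp_smul hε.ne'
  have hscale : ∫ x : R2, Q (ε • x + xm p) = p * M ^ (p - 1) * ∫ x, Q x := by
    rw [Measure.integral_comp_smul (volume : Measure R2) (fun y => Q (y + xm p)) ε,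
      integral_add_right_eq_self Q (xm p)]
    simp only [finrank_euclideanSpace, Fintype.card_fin, smul_eq_mul, hε2, inv_inv]
    rw [abs_of_pos (by positivity)]
  calc ∫ x in closedBall (0 : R2) R, (1 + zm u xp xm p x / p) ^ p
      ≤ ∫ x in closedBall (0 : R2) R, 4 * (M ^ (p - 1))⁻¹ * Q (ε • x + xm p) := by
        refine integral_mono_of_nonneg ?_ (hQs.const_mul _).integrableOn ?_
        · filter_upwards [ae_restrict_mem measurableSet_closedBall] with x hx
          exact Real.rpow_nonneg (by linarith [(hR x hx).2]) _
        · filter_upwards [ae_restrict_mem measurableSet_closedBall] with x hx using hpt x hx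
    _ ≤ ∫ x : R2, 4 * (M ^ (p - 1))⁻¹ * Q (ε • x + xm p) :=
        setIntegral_le_integral (hQs.const_mul _) (Eventually.of_forall fun x =>
          mul_nonneg (by positivity) (hQ0 _))
    _ = 8 * p * (∫ x in Ω, ‖gradient (u p) x‖ ^ 2) / M ^ 2 := by
        rw [integral_const_mul, hscale, hQ]; field_simp; ring

/-- The rescaled functions blow up like solutions of the Liouville equation. -/
lemma isBlowUp (h : IsNodalFamily Ω u xp xm K) {pn : ℕ → ℝ} (hpn : Tendsto pn atTop atTop) :
    IsBlowUp (fun n => zm u xp xm (pn n)) pn where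
  tendsto := hpn
  mass := by
    refine ⟨32 * (16 * π * Real.exp 1 + 1), fun R => ?_⟩
    obtain ⟨A, hA⟩ := h.exists_le_zm (max R 1) (by positivity)
    refine hpn.eventually (p := fun p => ∫ x in closedBall (0 : R2) R,
      (1 + zm u xp xm p x / p) ^ p ≤ 32 * (16 * π * Real.exp 1 + 1)) ?_
    filter_upwards [hA, eventually_gt_atTop 1, h.eventually_energy, h.eventually_half_le]
      with p hA hp hE hM
    refine (h.setIntegral_rpow_le hp hE.1 fun x hx => ?_).trans ?_
    · have := hA x (closedBall_subset_closedBall (le_max_left _ _) hx)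
      exact ⟨this.1, this.2.2⟩
    · rw [div_le_iff₀ (by positivity)]
      have h1 : 1 ≤ 4 * u p (xp p) ^ 2 := by
        have := pow_le_pow_left₀ (by norm_num) hM 2
        linarith
      have h2 : 0 ≤ 16 * π * Real.exp 1 + 1 := by positivity
      nlinarith [mul_nonneg h2 (sub_nonneg.2 h1)]
  bound := by
    intro R
    obtain ⟨A, hA⟩ := h.exists_le_zm (max R 1) (by positivity)
    refine ⟨A, hpn.eventually (p := fun p => ∀ x ∈ closedBall (0 : R2) R,
      ContDiffAt ℝ 2 (zm u xp xm p) x ∧ lap (zm u xp xm p) x = -(1 + zm u xp xm p x / p) ^ p ∧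
      -A ≤ zm u xp xm p x ∧ zm u xp xm p x ≤ zm u xp xm p 0 ∧ zm u xp xm p x ≤ 0) ?_⟩
    filter_upwards [hA, eventually_gt_atTop 1] with p hA hp x hx
    obtain ⟨h1, h2, h3⟩ := hA x (closedBall_subset_closedBall (le_max_left _ _) hx)
    exact ⟨h.contDiffAt_zm hp h1, h.lap_zm_eq_neg_rpow hp h1 (by linarith), h2,
      h.zm_le_zm_zero hp h1, (h.zm_le_zm_zero hp h1).trans (h.zm_zero_nonpos hp)⟩

lemma eventually_subset (h : IsNodalFamily Ω u xp xm K) {S : Set R2} (hS : IsCompact S) :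
    ∀ᶠ p in atTop,
      S ⊆ {x : R2 | eps u xp p • x + xm p ∈ Ω ∧ u p (eps u xp p • x + xm p) < 0} := by
  obtain ⟨R, hR, hSR⟩ := hS.isBounded.subset_closedBall_lt 0 (0 : R2)
  obtain ⟨A, hA⟩ := h.exists_le_zm R hR
  filter_upwards [hA, eventually_gt_atTop 1] with p hA hp x hx
  obtain ⟨h1, -, h2⟩ := hA x (hSR hx)
  refine ⟨h1, ?_⟩
  rw [h.one_add_zm_div hp] at h2
  have := (div_pos_iff_of_pos_right (h.max_pos p hp)).1 (by linarith)
  linarith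

end IsNodalFamily

theorem stmt13
    (Ω : Set R2) (hne : Ω.Nonempty) (hop : IsOpen Ω)
    (hbdd : Bornology.IsBounded Ω) (hconn : IsConnected Ω) (hsm : SmoothBoundary Ω)
    (u : ℝ → R2 → ℝ)
    (hsol : ∀ p > (1:ℝ), IsSolution Ω p (u p))
    (hnod : ∀ p > (1:ℝ), IsNodal Ω (u p))
    (xp xm : ℝ → R2)
    (hxpmem : ∀ p > (1:ℝ), xp p ∈ Ω)
    (hxpmax : ∀ p > (1:ℝ), ∀ x ∈ Ω, u p x ≤ u p (xp p))
    (hxmmem : ∀ p > (1:ℝ), xm p ∈ Ω)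
    (hxmmin : ∀ p > (1:ℝ), ∀ x ∈ Ω, u p (xm p) ≤ u p x)
    (hcomp : ∀ p > (1:ℝ), -u p (xm p) ≤ u p (xp p))
    (hA : CondA Ω u) (K : ℝ) (hK : 0 ≤ K)
    (hB : Tendsto (fun p : ℝ => p * (u p (xp p) + u p (xm p))) atTop (𝓝 K)) :
    (∀ Kc : Set R2, IsCompact Kc → ∀ᶠ p : ℝ in atTop,
      Kc ⊆ {x : R2 | eps u xp p • x + xm p ∈ Ω ∧ u p (eps u xp p • x + xm p) < 0}) ∧
    ∀ pn : ℕ → ℝ, Tendsto pn atTop atTop →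
      ∃ φ : ℕ → ℕ, StrictMono φ ∧ ∃ μ : ℝ, 0 < μ ∧ μ ≤ 1 ∧
        TendstoC2loc atTop
          (fun n : ℕ => {x : R2 | eps u xp (pn (φ n)) • x + xm (pn (φ n)) ∈ Ω ∧
            u (pn (φ n)) (eps u xp (pn (φ n)) • x + xm (pn (φ n))) < 0})
          (fun n : ℕ => zm u xp xm (pn (φ n))) (bubble μ) ∧
        (K = 0 → μ = 1) := by
  have hfam : IsNodalFamily Ω u xp xm K :=
    { isOpen := hop
      bounded := hbdd
      smooth := hsm
      sol := hsol
      xp_mem := hxpmem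
      xm_mem := hxmmem
      max_pos := fun p hp => by
        obtain ⟨x, hx, hux⟩ := (hnod p hp).1
        exact hux.trans_le (hxpmax p hp x hx)
      abs_le := fun p hp x hx =>
        abs_le.2 ⟨by linarith [hxmmin p hp x hx, hcomp p hp], hxpmax p hp x hx⟩
      xm_le := hxmmin
      energy := hA
      sum := hB }
  refine ⟨fun S hS => hfam.eventually_subset hS, fun pn hpn => ?_⟩
  obtain ⟨φ, hφ, μ, hμ0, hμ1, hconv, hμ⟩ := (hfam.isBlowUp hpn).exists_subseq_bubble
  refine ⟨φ, hφ, μ, hμ0, hμ1, fun S hS => ⟨?_, fun k hk => ?_⟩, ?_⟩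
  · exact (hpn.comp hφ.tendsto_atTop).eventually (hfam.eventually_subset hS)
  · obtain ⟨R, hR⟩ := hS.isBounded.subset_closedBall (0 : R2)
    exact (hconv R k hk).mono hR
  · rintro rfl
    exact hμ (hfam.tendsto_zm_zero.comp hpn)
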